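/- Homeo(M), for M a compact 2-manifold with the compact-open topology, is a Steinhaus topological group: there exists k ≥ 1 (in fact k = 92 works) such that for every symmetric countably syndetic subset W ⊆ Homeo(M), the set W^k has nonempty interior. -/

import Mathlib

open Pointwise Set Topology

noncomputable instance homeoGroup (X : Type*) [TopologicalSpace X] : Group (X ≃ₜ X) where
  mul f g := g.trans f
  one := Homeomorph.refl X
  inv := Homeomorph.symm
  mul_assoc _ _ _ := rfl
  one_mul f := by ext x; rfl
  mul_one f := by ext x; rfl
  inv_mul_cancel f := by ext x; exact f.symm_apply_apply x

open Pointwise Set Topology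
namespace HS

theorem maps_supp {X : Type*} [TopologicalSpace X] {f : X ≃ₜ X} {S : Set X}
    (h : ∀ x, x ∉ S → f x = x) {x : X} (hx : x ∈ S) : f x ∈ S := by
  by_contra hc
  have := f.injective (h _ hc)
  rw [this] at hc
  exact hc hx

theorem symm_supp {X : Type*} [TopologicalSpace X] {f : X ≃ₜ X} {S : Set X}
    (h : ∀ x, x ∉ S → f x = x) {x : X} (hx : x ∉ S) : f.symm x = x := by
  rw [Homeomorph.symm_apply_eq, h x hx]

/-- Build a homeomorphism from two mutually inverse continuous maps. -/
def mkHomeo {X Y : Type*} [TopologicalSpace X] [TopologicalSpace Y] (f : X → Y) (g : Y → X)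
    (h1 : ∀ x, g (f x) = x) (h2 : ∀ y, f (g y) = y) (hf : Continuous f) (hg : Continuous g) :
    X ≃ₜ Y where
  toFun := f
  invFun := g
  left_inv := h1
  right_inv := h2
  continuous_toFun := hf
  continuous_invFun := hg

theorem exists_homeo {X Y : Type*} [TopologicalSpace X] [TopologicalSpace Y] (f : X → Y)
    (g : Y → X) (h1 : ∀ x, g (f x) = x) (h2 : ∀ y, f (g y) = y) (hf : Continuous f)
    (hg : Continuous g) : ∃ F : X ≃ₜ Y, (∀ x, F x = f x) ∧ ∀ y, F.symm y = g y :=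
  ⟨mkHomeo f g h1 h2 hf hg, fun _ => rfl, fun _ => rfl⟩

open Classical in
theorem ext_cont {X Y : Type*} [TopologicalSpace X] [TopologicalSpace Y] [T2Space Y]
    (e : OpenPartialHomeomorph X Y) {K : Set X} (hK : IsCompact K) (hKs : K ⊆ e.source)
    (ρ : X ≃ₜ X) (hρ : ∀ x, x ∉ K → ρ x = x) :
    Continuous (fun y => if y ∈ e.target then e (ρ (e.symm y)) else y) := by
  have hsrc : ∀ x ∈ e.source, ρ x ∈ e.source := by
    intro x hx
    by_cases h : x ∈ K
    · exact hKs (maps_supp hρ h)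
    · rwa [hρ x h]
  have hcl : IsClosed (e '' K) := (hK.image_of_continuousOn (e.continuousOn.mono hKs)).isClosed
  rw [continuous_iff_continuousAt]
  intro y
  by_cases hy : y ∈ e.target
  · have h1 : ContinuousOn (fun y => e (ρ (e.symm y))) e.target := by
      refine e.continuousOn.comp (ρ.continuous.comp_continuousOn e.continuousOn_symm) ?_
      intro z hz
      exact hsrc _ (e.map_target hz)
    refine (h1.continuousAt (e.open_target.mem_nhds hy)).congr ?_
    filter_upwards [e.open_target.mem_nhds hy] with z hz
    simp [hz]
  · have hyK : y ∉ e '' K := by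
      rintro ⟨x, hx, rfl⟩
      exact hy (e.map_source (hKs hx))
    refine continuousAt_id.congr ?_
    filter_upwards [hcl.isOpen_compl.mem_nhds hyK] with z hz
    by_cases hzt : z ∈ e.target
    · simp only [hzt, if_true]
      have : e.symm z ∉ K := fun h => hz ⟨_, h, e.right_inv hzt⟩
      rw [hρ _ this, e.right_inv hzt]; rfl
    · simp [hzt]

theorem ext_homeo {X Y : Type*} [TopologicalSpace X] [TopologicalSpace Y] [T2Space Y]
    (e : OpenPartialHomeomorph X Y) {K : Set X} (hK : IsCompact K) (hKs : K ⊆ e.source)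
    (ρ : X ≃ₜ X) (hρ : ∀ x, x ∉ K → ρ x = x) :
    ∃ ψ : Y ≃ₜ Y, (∀ z ∈ e.source, ψ (e z) = e (ρ z)) ∧
      (∀ z ∈ e.source, ψ.symm (e z) = e (ρ.symm z)) ∧ (∀ y, y ∉ e '' K → ψ y = y) := by
  classical
  have hρ' : ∀ x, x ∉ K → ρ.symm x = x := fun x hx => symm_supp hρ hx
  have hsrc : ∀ (ρ : X ≃ₜ X), (∀ x, x ∉ K → ρ x = x) → ∀ x ∈ e.source, ρ x ∈ e.source := by
    intro ρ hρ x hx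
    by_cases h : x ∈ K
    · exact hKs (maps_supp hρ h)
    · rwa [hρ x h]
  have key : ∀ (ρ : X ≃ₜ X), (∀ x, x ∉ K → ρ x = x) → (∀ x, x ∉ K → ρ.symm x = x) →
      ∀ y, (fun y => if y ∈ e.target then e (ρ.symm (e.symm y)) else y)
        ((fun y => if y ∈ e.target then e (ρ (e.symm y)) else y) y) = y := by
    intro ρ h1 h2 y
    by_cases hy : y ∈ e.target
    · have h3 := hsrc ρ h1 _ (e.map_target hy)
      simp [hy, e.map_source h3, e.left_inv h3, e.right_inv hy]
    · simp [hy]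
  obtain ⟨F, hF1, hF2⟩ := exists_homeo _ _ (key ρ hρ hρ') (key ρ.symm hρ' hρ)
    (ext_cont e hK hKs ρ hρ) (ext_cont e hK hKs ρ.symm hρ')
  refine ⟨F, ?_, ?_, ?_⟩
  · intro z hz
    simp [hF1, e.map_source hz, e.left_inv hz]
  · intro z hz
    simp [hF2, e.map_source hz, e.left_inv hz]
  · intro y hy
    by_cases hyt : y ∈ e.target
    · have : e.symm y ∉ K := fun h => hy ⟨_, h, e.right_inv hyt⟩
      simp [hF1, hyt, hρ _ this, e.right_inv hyt]
    · simp [hF1, hyt]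

theorem unif_cont {X Y : Type*} [TopologicalSpace X] [PseudoMetricSpace Y] (f : X → Y)
    (h : ∀ ε > 0, ∃ F : X → Y, Continuous F ∧ ∀ x, dist (f x) (F x) ≤ ε) : Continuous f := by
  refine continuous_of_uniform_approx_of_continuous ?_
  intro u hu
  obtain ⟨ε, hε, hu⟩ := Metric.mem_uniformity_dist.1 hu
  obtain ⟨F, hF, h1⟩ := h (ε/2) (half_pos hε)
  exact ⟨F, hF, fun y => hu ((h1 y).trans_lt (half_lt_self hε))⟩

section glue
variable {X : Type*} [MetricSpace X] {ι : Type*}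

open Classical in
/-- glued function -/
noncomputable def glueFun (f : ι → X ≃ₜ X) (S : ι → Set X) (x : X) : X :=
  if h : ∃ i, x ∈ S i then f h.choose x else x

theorem glueFun_mem {f : ι → X ≃ₜ X} {S : ι → Set X} (hd : ∀ i j, i ≠ j → Disjoint (S i) (S j))
    {i : ι} {x : X} (hx : x ∈ S i) : glueFun f S x = f i x := by
  have h : ∃ i, x ∈ S i := ⟨i, hx⟩
  have : h.choose = i := by
    by_contra hc
    exact Set.disjoint_left.1 (hd _ _ hc) h.choose_spec hx
  rw [glueFun, dif_pos h, this]

theorem glueFun_not {f : ι → X ≃ₜ X} {S : ι → Set X} 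
    {x : X} (hx : ∀ i, x ∉ S i) : glueFun f S x = x := by
  rw [glueFun, dif_neg (by push Not; exact hx)]

theorem glue_cont (f : ι → X ≃ₜ X) (S : ι → Set X) (hd : ∀ i j, i ≠ j → Disjoint (S i) (S j))
    (hf : ∀ i x, x ∉ S i → f i x = x)
    (hfin : ∀ ε > 0, {i | ∃ x, ε < dist (f i x) x}.Finite) : Continuous (glueFun f S) := by
  classical
  have fin : ∀ T : Finset ι, ∃ F : X → X, Continuous F ∧ (∀ i ∈ T, ∀ x ∈ S i, F x = f i x) ∧
      (∀ x, (∀ i ∈ T, x ∉ S i) → F x = x) := by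
    intro T
    induction T using Finset.induction_on with
    | empty => exact ⟨id, continuous_id, by simp, by simp⟩
    | insert j T hj ih =>
      obtain ⟨F, hF, h1, h2⟩ := ih
      refine ⟨F ∘ f j, hF.comp (f j).continuous, ?_, ?_⟩
      · intro i hi x hx
        rcases Finset.mem_insert.1 hi with rfl | hi
        · refine h2 _ ?_
          intro k hk hk'
          have : k ≠ i := by rintro rfl; exact hj hk
          exact Set.disjoint_left.1 (hd _ _ this) hk' (maps_supp (hf i) hx)
        · have : i ≠ j := fun h => hj (h ▸ hi)
          have hxj : x ∉ S j := Set.disjoint_left.1 (hd _ _ this) hx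
          simp only [Function.comp, hf j x hxj]
          exact h1 i hi x hx
      · intro x hx
        have hxj : x ∉ S j := hx j (Finset.mem_insert_self _ _)
        simp only [Function.comp, hf j x hxj]
        exact h2 x (fun i hi => hx i (Finset.mem_insert_of_mem hi))
  refine unif_cont _ ?_
  intro ε hε
  obtain ⟨F, hF, h1, h2⟩ := fin (hfin (ε/2) (half_pos hε)).toFinset
  refine ⟨F, hF, fun x => ?_⟩
  by_cases hx : ∃ i, x ∈ S i
  · obtain ⟨i, hi⟩ := hx
    rw [glueFun_mem hd hi]
    by_cases hiT : i ∈ (hfin (ε/2) (half_pos hε)).toFinset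
    · rw [h1 i hiT x hi]; simpa using hε.le
    · have : F x = x := h2 x (by
        intro k hk hk'
        by_cases hki : k = i
        · subst hki; exact hiT hk
        · exact Set.disjoint_left.1 (hd _ _ hki) hk' hi)
      rw [this]
      simp only [Set.Finite.mem_toFinset, Set.mem_ofPred_eq, not_exists, not_lt] at hiT
      have := hiT x
      linarith
  · push Not at hx
    rw [glueFun_not hx, h2 x (fun i _ => hx i)]; simpa using hε.le

theorem glue (f : ι → X ≃ₜ X) (S : ι → Set X) (hd : ∀ i j, i ≠ j → Disjoint (S i) (S j))
    (hf : ∀ i x, x ∉ S i → f i x = x)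
    (hfin : ∀ ε > 0, {i | ∃ x, ε < dist (f i x) x}.Finite) :
    ∃ F : X ≃ₜ X, (∀ i, ∀ x ∈ S i, F x = f i x) ∧ (∀ x, (∀ i, x ∉ S i) → F x = x) := by
  have hf' : ∀ i x, x ∉ S i → (f i).symm x = x := fun i x hx => symm_supp (hf i) hx
  have hfin' : ∀ ε > 0, {i | ∃ x, ε < dist ((f i).symm x) x}.Finite := by
    intro ε hε
    refine (hfin ε hε).subset ?_
    rintro i ⟨x, hx⟩
    refine ⟨(f i).symm x, ?_⟩
    rw [Homeomorph.apply_symm_apply, dist_comm]; exact hx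
  refine ⟨mkHomeo (glueFun f S) (glueFun (fun i => (f i).symm) S) ?_ ?_ (glue_cont f S hd hf hfin)
    (glue_cont _ S hd hf' hfin'), ?_, ?_⟩
  · intro x
    by_cases hx : ∃ i, x ∈ S i
    · obtain ⟨i, hi⟩ := hx
      rw [glueFun_mem hd hi, glueFun_mem hd (maps_supp (hf i) hi), Homeomorph.symm_apply_apply]
    · push Not at hx
      rw [glueFun_not hx, glueFun_not hx]
  · intro x
    by_cases hx : ∃ i, x ∈ S i
    · obtain ⟨i, hi⟩ := hx
      rw [glueFun_mem hd hi, glueFun_mem hd (maps_supp (hf' i) hi), Homeomorph.apply_symm_apply]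
    · push Not at hx
      rw [glueFun_not hx, glueFun_not hx]
  · intro i x hx; exact glueFun_mem hd hx
  · intro x hx; exact glueFun_not hx

theorem glue_finite [Finite ι] (f : ι → X ≃ₜ X) (S : ι → Set X)
    (hd : ∀ i j, i ≠ j → Disjoint (S i) (S j))
    (hf : ∀ i x, x ∉ S i → f i x = x) :
    ∃ F : X ≃ₜ X, (∀ i, ∀ x ∈ S i, F x = f i x) ∧ (∀ x, (∀ i, x ∉ S i) → F x = x) :=
  glue f S hd hf (fun _ _ => Set.toFinite _)
end glue

section rad
/-- piecewise linear map through (u,u),(x,y),(R,R), identity outside [u,R] -/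
noncomputable def pl (u x y R t : ℝ) : ℝ :=
  if t ≤ u then t else if t ≤ x then u + (y-u)/(x-u)*(t-u) else
    if t ≤ R then y + (R-y)/(R-x)*(t-x) else t

theorem pl_inv {u x y R : ℝ} (h1 : u < x) (h2 : x < R) (h3 : u < y) (h4 : y < R) (t : ℝ) :
    pl u y x R (pl u x y R t) = t := by
  have a1 : 0 < x - u := by linarith
  have a2 : 0 < y - u := by linarith
  have a3 : 0 < R - x := by linarith
  have a4 : 0 < R - y := by linarith
  unfold pl
  by_cases c1 : t ≤ u
  · simp [c1]
  push Not at c1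
  by_cases c2 : t ≤ x
  · have e1 : u < u + (y-u)/(x-u)*(t-u) := by
      have : 0 < (y-u)/(x-u)*(t-u) := mul_pos (div_pos a2 a1) (by linarith)
      linarith
    have e2 : u + (y-u)/(x-u)*(t-u) ≤ y := by
      have : (y-u)/(x-u)*(t-u) ≤ y - u := by
        rw [div_mul_eq_mul_div, div_le_iff₀ a1]; nlinarith
      linarith
    simp only [not_le.2 c1, c2, not_le.2 e1, e2, if_true, if_false]
    field_simp; ring
  push Not at c2
  by_cases c3 : t ≤ R
  · have e1 : y < y + (R-y)/(R-x)*(t-x) := by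
      have : 0 < (R-y)/(R-x)*(t-x) := mul_pos (div_pos a4 a3) (by linarith)
      linarith
    have e2 : y + (R-y)/(R-x)*(t-x) ≤ R := by
      have : (R-y)/(R-x)*(t-x) ≤ R - y := by
        rw [div_mul_eq_mul_div, div_le_iff₀ a3]; nlinarith
      linarith
    simp only [not_le.2 c1, not_le.2 c2, c3, not_le.2 e1, not_le.2 (h3.trans e1), e2, if_true, if_false]
    field_simp; ring
  push Not at c3
  simp [not_le.2 c1, not_le.2 c2, not_le.2 c3, not_le.2 (h4.trans c3)]

theorem pl_mono {u x y R : ℝ} (h1 : u < x) (h2 : x < R) (h3 : u < y) (h4 : y < R) :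
    StrictMono (pl u x y R) := by
  have a1 : 0 < x - u := by linarith
  have a2 : 0 < y - u := by linarith
  have a3 : 0 < R - x := by linarith
  have a4 : 0 < R - y := by linarith
  have b1 : 0 < (y-u)/(x-u) := div_pos a2 a1
  have b2 : 0 < (R-y)/(R-x) := div_pos a4 a3
  have c1 : (y-u)/(x-u) * (x-u) = y - u := by field_simp
  have c2 : (R-y)/(R-x) * (R-x) = R - y := by field_simp
  intro s t hst
  unfold pl
  split_ifs <;> nlinarith

/-- order iso version -/
noncomputable def plI {u x y R : ℝ} (h1 : u < x) (h2 : x < R) (h3 : u < y) (h4 : y < R) : ℝ ≃o ℝ :=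
  (pl_mono h1 h2 h3 h4).orderIsoOfSurjective _ (fun t => ⟨_, pl_inv h3 h4 h1 h2 t⟩)

theorem plI_apply {u x y R : ℝ} (h1 : u < x) (h2 : x < R) (h3 : u < y) (h4 : y < R) (t : ℝ) :
  plI h1 h2 h3 h4 t = pl u x y R t := rfl

variable {V : Type*} [NormedAddCommGroup V] [NormedSpace ℝ V]

/-- radial map -/
noncomputable def radF (m : ℝ ≃o ℝ) (z : V) : V := (m ‖z‖ / ‖z‖) • z

theorem radF_norm (m : ℝ ≃o ℝ) (h0 : m 0 = 0) (z : V) : ‖radF m z‖ = m ‖z‖ := by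
  by_cases hz : z = 0
  · simp [hz, radF, h0]
  have h1 : 0 < ‖z‖ := norm_pos_iff.2 hz
  have h2 : 0 < m ‖z‖ := by rw [← h0]; exact m.strictMono h1
  rw [radF, norm_smul, norm_div, norm_norm, Real.norm_of_nonneg h2.le]
  field_simp

theorem radF_inv (m : ℝ ≃o ℝ) (h0 : m 0 = 0) (z : V) : radF m.symm (radF m z) = z := by
  by_cases hz : z = 0
  · simp [hz, radF]
  have h1 : 0 < ‖z‖ := norm_pos_iff.2 hz
  have h2 : 0 < m ‖z‖ := by rw [← h0]; exact m.strictMono h1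
  rw [radF, radF_norm m h0, OrderIso.symm_apply_apply, radF, smul_smul]
  have : ‖z‖ / m ‖z‖ * (m ‖z‖ / ‖z‖) = 1 := by field_simp
  rw [this, one_smul]

theorem radF_cont (m : ℝ ≃o ℝ) (h0 : m 0 = 0) : Continuous (radF m : V → V) := by
  rw [continuous_iff_continuousAt]
  intro z
  by_cases hz : z = 0
  · subst hz
    have : radF m (0:V) = 0 := by simp [radF]
    rw [ContinuousAt, this, tendsto_zero_iff_norm_tendsto_zero]
    simp only [radF_norm m h0]
    have h2 : Continuous (fun z : V => m ‖z‖) := m.continuous.comp continuous_norm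
    simpa [h0] using h2.tendsto (0:V)
  · have h1 : ‖z‖ ≠ 0 := by simpa using hz
    unfold radF
    refine ContinuousAt.smul (ContinuousAt.div ?_ continuous_norm.continuousAt h1) continuousAt_id
    exact (m.continuous.comp continuous_norm).continuousAt

/-- radial homeomorphism -/
noncomputable def rad (m : ℝ ≃o ℝ) (h0 : m 0 = 0) : V ≃ₜ V :=
  mkHomeo (radF m) (radF m.symm) (radF_inv m h0)
    (fun y => by
      have := radF_inv (V := V) m.symm (by rw [OrderIso.symm_apply_eq, h0]) y
      simpa using this) (radF_cont m h0)
    (radF_cont m.symm (by rw [OrderIso.symm_apply_eq, h0]))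

theorem rad_apply (m : ℝ ≃o ℝ) (h0 : m 0 = 0) (z : V) : rad m h0 z = (m ‖z‖ / ‖z‖) • z := rfl

theorem rad_norm (m : ℝ ≃o ℝ) (h0 : m 0 = 0) (z : V) : ‖rad m h0 z‖ = m ‖z‖ := radF_norm m h0 z

theorem rad_fix (m : ℝ ≃o ℝ) (h0 : m 0 = 0) (z : V) (h : m ‖z‖ = ‖z‖) : rad m h0 z = z := by
  by_cases hz : z = 0
  · simp [hz, rad_apply]
  · have h1 : ‖z‖ ≠ 0 := by simpa using hz
    change (m ‖z‖ / ‖z‖) • z = z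
    rw [h, div_self h1, one_smul]

theorem rad_smul (m : ℝ ≃o ℝ) (h0 : m 0 = 0) (z : V) (c : ℝ) (h : m ‖z‖ = c * ‖z‖) :
    rad m h0 z = c • z := by
  by_cases hz : z = 0
  · simp [hz, rad_apply]
  · have h1 : ‖z‖ ≠ 0 := by simpa using hz
    change (m ‖z‖ / ‖z‖) • z = _
    rw [h, mul_div_assoc, div_self h1, mul_one]

/-- scaling homeo : multiplies by `c` on the ball of radius `x`, identity off ball of radius R -/
theorem exists_scale {c x R : ℝ} (hc : 0 < c) (hx : 0 < x) (hxR : x < R) (hcx : c * x < R) :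
    ∃ φ : V ≃ₜ V, (∀ z, ‖z‖ ≤ x → φ z = c • z) ∧ (∀ z, R ≤ ‖z‖ → φ z = z) := by
  have h1 := mul_pos hc hx
  refine ⟨rad (plI hx hxR h1 hcx) (by simp [plI_apply, pl]), ?_, ?_⟩
  · intro z hz
    refine rad_smul _ _ _ _ ?_
    rw [plI_apply, pl]
    by_cases h0 : ‖z‖ ≤ 0
    · have : ‖z‖ = 0 := le_antisymm h0 (norm_nonneg _)
      simp [this]
    · simp only [h0, hz, if_true, if_false]
      have hx0 : x ≠ 0 := hx.ne'
      simp only [sub_zero, zero_add]; field_simp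
  · intro z hz
    refine rad_fix _ _ _ ?_
    rw [plI_apply, pl]
    rcases hz.lt_or_eq with h | h
    · simp [not_le.2 h, not_le.2 (hxR.trans h), not_le.2 ((hx.trans hxR).trans h)]
    · rw [← h]; 
      have : R - x ≠ 0 := by linarith
      simp only [not_le.2 hxR, not_le.2 (hx.trans hxR), le_refl, if_true, if_false]
      field_simp; ring
end rad

theorem bij_homeo {V : Type*} [NormedAddCommGroup V] [ProperSpace V] (G : V → V)
    (hc : Continuous G) (hb : Function.Bijective G) {b : ℝ} (hG : ∀ z, ‖G z - z‖ ≤ b) :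
    ∃ F : V ≃ₜ V, ∀ z, F z = G z := by
  have hp : IsProperMap G := by
    rw [isProperMap_iff_tendsto_cocompact]
    refine ⟨hc, ?_⟩
    rw [← Metric.cobounded_eq_cocompact, ← tendsto_norm_atTop_iff_cobounded]
    refine Filter.tendsto_atTop_mono (f := fun z => ‖z‖ - b) (fun z => ?_) ?_
    · have := norm_sub_norm_le z (G z)
      rw [norm_sub_rev] at this
      have := hG z
      linarith
    · exact Filter.tendsto_atTop_add_const_right _ _ tendsto_norm_cobounded_atTop
  have : IsHomeomorph G := isHomeomorph_iff_continuous_isClosedMap_bijective.2 ⟨hc, hp.isClosedMap, hb⟩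
  exact ⟨this.homeomorph, fun z => rfl⟩

/-- open partial homeo from two partial inverses -/
noncomputable def mkOPH {X Y : Type*} [TopologicalSpace X] [TopologicalSpace Y] (f : X → Y) (g : Y → X)
    (S : Set X) (T : Set Y) (hS : IsOpen S) (hT : IsOpen T) (hf : ContinuousOn f S)
    (hg : ContinuousOn g T) (h1 : ∀ x ∈ S, f x ∈ T → g (f x) = x)
    (h2 : ∀ y ∈ T, g y ∈ S → f (g y) = y) : OpenPartialHomeomorph X Y where
  toFun := f
  invFun := g
  source := S ∩ f ⁻¹' T
  target := T ∩ g ⁻¹' S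
  map_source' x hx := ⟨hx.2, by simpa [h1 x hx.1 hx.2] using hx.1⟩
  map_target' y hy := ⟨hy.2, by simpa [h2 y hy.1 hy.2] using hy.1⟩
  left_inv' x hx := h1 x hx.1 hx.2
  right_inv' y hy := h2 y hy.1 hy.2
  open_source := hf.isOpen_inter_preimage hS hT
  open_target := hg.isOpen_inter_preimage hT hS
  continuousOn_toFun := hf.mono inter_subset_left
  continuousOn_invFun := hg.mono inter_subset_left

/-- near identity -/
def NI {V : Type*} [NormedAddCommGroup V] (a : OpenPartialHomeomorph V V) (A : Set V) (δ : ℝ) : Prop :=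
  ∀ z ∈ A, z ∈ a.source ∧ z ∈ a.target ∧ ‖a z - z‖ ≤ δ ∧ ‖a.symm z - z‖ ≤ δ

open Classical in
theorem loc_homeo {V : Type*} [NormedAddCommGroup V] (a : OpenPartialHomeomorph V V) (v : V)
    {r r' : ℝ} (hr : r < r') (hN : NI a {z | ‖z - v‖ ≤ r'} (r' - r))
    (hid : ∀ z, r ≤ ‖z - v‖ → ‖z - v‖ ≤ r' → a z = z) :
    ∃ f : V ≃ₜ V, (∀ z, ‖z - v‖ ≤ r → f z = a z) ∧ (∀ z, r ≤ ‖z - v‖ → f z = z) := by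
  have hid' : ∀ z, r ≤ ‖z - v‖ → ‖z - v‖ ≤ r' → a.symm z = z := by
    intro z h1 h2
    have := a.left_inv (hN z h2).1
    rwa [hid z h1 h2] at this
  have m1 : ∀ z, ‖z - v‖ ≤ r → ‖a z - v‖ ≤ r := by
    intro z hz
    by_contra hc
    push Not at hc
    have hzm := hN z (hz.trans hr.le)
    have h1 : ‖a z - v‖ ≤ r' := by
      have : a z - v = (a z - z) + (z - v) := by abel
      rw [this]; refine (norm_add_le _ _).trans ?_
      linarith [hzm.2.2.1]
    have h2 := hid _ hc.le h1
    have := a.injOn (hN _ h1).1 hzm.1 h2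
    rw [this] at hc; linarith
  have m2 : ∀ z, ‖z - v‖ ≤ r → ‖a.symm z - v‖ ≤ r := by
    intro z hz
    by_contra hc
    push Not at hc
    have hzm := hN z (hz.trans hr.le)
    have h1 : ‖a.symm z - v‖ ≤ r' := by
      have : a.symm z - v = (a.symm z - z) + (z - v) := by abel
      rw [this]; refine (norm_add_le _ _).trans ?_
      linarith [hzm.2.2.2]
    have h2 := hid' _ hc.le h1
    have := a.symm.injOn (hN _ h1).2.1 hzm.2.1 h2
    rw [this] at hc; linarith
  have cont : ∀ b : V → V, ContinuousOn b {z | ‖z - v‖ ≤ r'} →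
      (∀ z, r ≤ ‖z - v‖ → ‖z - v‖ ≤ r' → b z = z) →
      Continuous (fun z => if ‖z - v‖ ≤ r then b z else z) := by
    intro b hb hbid
    rw [continuous_iff_continuousAt]
    intro z
    by_cases hz : ‖z - v‖ < r'
    · have hopen : {z | ‖z - v‖ < r'} ∈ 𝓝 z :=
        (isOpen_lt (by fun_prop) continuous_const).mem_nhds hz
      have : ContinuousAt b z := hb.continuousAt (Filter.mem_of_superset hopen (fun y hy => (show ‖y - v‖ ≤ r' from le_of_lt hy)))
      refine this.congr ?_
      filter_upwards [hopen] with y hy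
      split_ifs with h
      · rfl
      · exact hbid y (not_le.1 h).le (le_of_lt hy)
    · have hz' : r < ‖z - v‖ := hr.trans_le (not_lt.1 hz)
      refine continuousAt_id.congr ?_
      filter_upwards [(isOpen_lt (f := fun _ => r) (g := fun z => ‖z - v‖) continuous_const (by fun_prop)).mem_nhds hz'] with y hy
      rw [if_neg (not_le.2 hy)]; rfl
  have k1 : ∀ z, (fun z => if ‖z - v‖ ≤ r then a.symm z else z)
      ((fun z => if ‖z - v‖ ≤ r then a z else z) z) = z := by
    intro z
    by_cases h : ‖z - v‖ ≤ r
    · simp only [h, m1 z h, if_true, a.left_inv (hN z (h.trans hr.le)).1]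
    · simp [h]
  have k2 : ∀ z, (fun z => if ‖z - v‖ ≤ r then a z else z)
      ((fun z => if ‖z - v‖ ≤ r then a.symm z else z) z) = z := by
    intro z
    by_cases h : ‖z - v‖ ≤ r
    · simp only [h, m2 z h, if_true, a.right_inv (hN z (h.trans hr.le)).2.1]
    · simp [h]
  obtain ⟨F, hF1, hF2⟩ := exists_homeo _ _ k1 k2
    (cont a (a.continuousOn.mono fun z hz => (hN z hz).1) hid)
    (cont a.symm (a.continuousOn_symm.mono fun z hz => (hN z hz).2.1) hid')
  refine ⟨F, ?_, ?_⟩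
  · intro z hz; simp [hF1, hz]
  · intro z hz
    rcases hz.lt_or_eq with h | h
    · simp [hF1, not_le.2 h]
    · simp [hF1, h.symm, hid z hz (by linarith)]

end HS

namespace HS
section fill
variable {V : Type*} [NormedAddCommGroup V] [NormedSpace ℝ V]

/-- affine homeo -/
noncomputable def aff (c : V) (s : ℝ) (hs : 0 < s) : V ≃ₜ V :=
  mkHomeo (fun z => c + s • z) (fun w => s⁻¹ • (w - c)) (fun z => by simp [smul_smul, hs.ne'])
    (fun w => by simp [smul_smul, hs.ne']) (by fun_prop) (by fun_prop)

theorem aff_apply (c : V) (s : ℝ) (hs : 0 < s) (z : V) : aff c s hs z = c + s • z := rfl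
theorem aff_symm_apply (c : V) (s : ℝ) (hs : 0 < s) (z : V) :
  (aff c s hs).symm z = s⁻¹ • (z - c) := rfl

/-- conjugate by affine homeo -/
noncomputable def conjA (a : OpenPartialHomeomorph V V) (c : V) (s : ℝ) (hs : 0 < s) :
    OpenPartialHomeomorph V V :=
  ((aff c s hs).transOpenPartialHomeomorph a).transHomeomorph (aff c s hs).symm

theorem conjA_apply (a : OpenPartialHomeomorph V V) (c : V) (s : ℝ) (hs : 0 < s) (z : V) :
    conjA a c s hs z = s⁻¹ • (a (c + s • z) - c) := rfl
theorem conjA_symm_apply (a : OpenPartialHomeomorph V V) (c : V) (s : ℝ) (hs : 0 < s) (z : V) :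
    (conjA a c s hs).symm z = s⁻¹ • (a.symm (c + s • z) - c) := rfl
theorem conjA_source (a : OpenPartialHomeomorph V V) (c : V) (s : ℝ) (hs : 0 < s) (z : V) :
    z ∈ (conjA a c s hs).source ↔ c + s • z ∈ a.source := Iff.rfl
theorem conjA_target (a : OpenPartialHomeomorph V V) (c : V) (s : ℝ) (hs : 0 < s) (z : V) :
    z ∈ (conjA a c s hs).target ↔ c + s • z ∈ a.target := Iff.rfl

theorem conj_disp (c : V) (s : ℝ) (hs : 0 < s) (z w : V) {δ : ℝ} (h : ‖w - (c + s • z)‖ ≤ s * δ) :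
    ‖s⁻¹ • (w - c) - z‖ ≤ δ := by
  have : s⁻¹ • (w - c) - z = s⁻¹ • (w - (c + s • z)) := by
    rw [← sub_sub, smul_sub _ (w - c), smul_smul, inv_mul_cancel₀ hs.ne', one_smul]
  rw [this, norm_smul, Real.norm_of_nonneg (by positivity), inv_mul_le_iff₀ hs]
  exact h

theorem conjA_NI (a : OpenPartialHomeomorph V V) (c : V) (s : ℝ) (hs : 0 < s) (A B : Set V) (δ : ℝ)
    (h : NI a A (s * δ)) (hB : ∀ z ∈ B, c + s • z ∈ A) : NI (conjA a c s hs) B δ := by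
  intro z hz
  obtain ⟨h1, h2, h3, h4⟩ := h _ (hB z hz)
  exact ⟨h1, h2, conj_disp c s hs z _ h3, conj_disp c s hs z _ h4⟩

/-- neighbourhoods of the core -/
def Nb (a : OpenPartialHomeomorph V V) (t : ℝ) : Set V :=
  {w | ‖w‖ < 1.2 ∨ (‖w‖ ≤ 3.5 ∧ ‖a.symm w‖ < 1.4 + t)}

theorem near_norm {x y : V} {δ : ℝ} (h : ‖x - y‖ ≤ δ) : ‖x‖ ≤ ‖y‖ + δ ∧ ‖y‖ ≤ ‖x‖ + δ := by
  have h1 := norm_sub_norm_le x y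
  have h2 := norm_sub_norm_le y x
  rw [norm_sub_rev] at h2
  constructor <;> linarith

theorem Nb_mono (a : OpenPartialHomeomorph V V) {s t : ℝ} (h : s ≤ t) : Nb a s ⊆ Nb a t := by
  rintro w (hw | ⟨h1, h2⟩)
  · exact Or.inl hw
  · exact Or.inr ⟨h1, by linarith⟩

theorem Nb_norm {a : OpenPartialHomeomorph V V} (hN : NI a {z | 1 ≤ ‖z‖ ∧ ‖z‖ ≤ 4} (1/100))
    {t : ℝ} {w : V} (hw : w ∈ Nb a t) : ‖w‖ ≤ 1.41 + max t 0 := by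
  rcases hw with hw | ⟨h1, h2⟩
  · have := le_max_right t 0
    linarith
  by_cases h : ‖w‖ < 1.2
  · have := le_max_right t 0
    linarith
  · push Not at h
    have := (near_norm (hN w ⟨by linarith, by linarith⟩).2.2.2).2
    have := le_max_left t 0
    linarith

theorem fill_k [ProperSpace V] (a : OpenPartialHomeomorph V V)
    (hN : NI a {z | 1 ≤ ‖z‖ ∧ ‖z‖ ≤ 4} (1/100)) {t : ℝ} (ht0 : 0 < t) (ht : t ≤ 0.4) :
    ∃ k : V ≃ₜ V, (∀ w, w ∉ Nb a t → k w = w) ∧ (∀ w ∈ Nb a (t/2), k w = (1/2 : ℝ) • w) := by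
  obtain ⟨θ, hθ1, hθ2⟩ := exists_scale (V := V) (c := 1/2) (x := 1.65) (R := 1.7)
    (by norm_num) (by norm_num) (by norm_num) (by norm_num)
  have h1 : 1.4 + t/2 < 1.8 := by linarith
  have h2 : (1.8:ℝ) < 3 := by norm_num
  have h3 : 1.4 + t/2 < 1.4 + t := by linarith
  have h4 : 1.4 + t < 3 := by linarith
  have h0 : plI h1 h2 h3 h4 0 = 0 := by
    rw [plI_apply, pl, if_pos (by positivity)]
  have f1 : ∀ x, x ≤ 1.4 + t/2 → plI h1 h2 h3 h4 x = x := by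
    intro x hx
    rw [plI_apply, pl, if_pos hx]
  have f2 : plI h1 h2 h3 h4 1.8 = 1.4 + t := by
    rw [plI_apply, pl, if_neg (not_le.2 h1), if_pos le_rfl]
    have : 1.8 - (1.4 + t/2) ≠ 0 := by linarith
    rw [div_mul_cancel₀ _ this]; ring
  have f3 : ∀ x, 3 ≤ x → plI h1 h2 h3 h4 x = x := by
    intro x hx
    rw [plI_apply, pl, if_neg (not_le.2 ((h1.trans h2).trans_le hx)), if_neg (not_le.2 (h2.trans_le hx))]
    split_ifs with h
    · have : x = 3 := le_antisymm h hx
      subst this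
      have : (3:ℝ) - 1.8 ≠ 0 := by norm_num
      rw [div_mul_cancel₀ _ this]; ring
    · rfl
  set m := plI h1 h2 h3 h4 with hm
  let ρ : V ≃ₜ V := rad m h0
  have hρn : ∀ z, ‖ρ z‖ = m ‖z‖ := rad_norm m h0
  set K : Set V := {z | 1.4 ≤ ‖z‖ ∧ ‖z‖ ≤ 3} with hKdef
  have hK : IsCompact K := by
    refine (isCompact_closedBall (0:V) 3).of_isClosed_subset ?_ ?_
    · exact (isClosed_le continuous_const continuous_norm).inter (isClosed_le continuous_norm continuous_const)
    · intro z hz; simpa using hz.2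
  have hKs : K ⊆ a.source := fun z hz => (hN z ⟨by have := hz.1; linarith, by linarith [hz.2]⟩).1
  have hρK : ∀ x, x ∉ K → ρ x = x := by
    intro x hx
    refine rad_fix _ _ _ ?_
    by_cases h : 1.4 ≤ ‖x‖
    · refine f3 _ ?_
      by_contra hc
      exact hx ⟨h, by linarith⟩
    · exact f1 _ (by linarith)
  obtain ⟨ψ, hψ1, hψ2, hψ3⟩ := ext_homeo a hK hKs ρ hρK
  have hψ4 : ∀ y, y ∉ a '' K → ψ.symm y = y := fun y hy => symm_supp hψ3 hy
  have hKim : ∀ y ∈ a '' K, 1.39 ≤ ‖y‖ ∧ ‖y‖ ≤ 3.01 := by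
    rintro _ ⟨z, ⟨hz1, hz2⟩, rfl⟩
    have := near_norm (hN z ⟨by linarith, by linarith⟩).2.2.1
    constructor <;> linarith
  refine ⟨(ψ.symm.trans θ).trans ψ, ?_, ?_⟩
  · intro w hw
    have key : 1.7 ≤ ‖ψ.symm w‖ := by
      simp only [Nb, Set.mem_ofPred_eq, not_or, not_and, not_lt] at hw
      obtain ⟨hw1, hw2⟩ := hw
      by_cases hw3 : ‖w‖ ≤ 3.5
      · have hw4 := hw2 hw3
        have hwN := hN w ⟨by linarith, by linarith⟩
        have hzs := a.map_target hwN.2.1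
        have e1 : ψ.symm w = a (ρ.symm (a.symm w)) := by
          rw [← hψ2 _ hzs, a.right_inv hwN.2.1]
        have e2 := hρn (ρ.symm (a.symm w))
        rw [Homeomorph.apply_symm_apply] at e2
        have e3 : 1.8 ≤ ‖ρ.symm (a.symm w)‖ := by
          rw [← m.le_iff_le, f2, ← e2]; exact hw4
        have e4 : ‖ρ.symm (a.symm w)‖ ≤ 4 := by
          rw [← m.le_iff_le, ← e2, f3 4 (by norm_num)]
          have := near_norm hwN.2.2.2
          linarith
        have := near_norm (hN _ ⟨by linarith, e4⟩).2.2.1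
        rw [e1]; linarith
      · rw [hψ4]
        · linarith
        · intro h; have := hKim _ h
          linarith
    change ψ (θ (ψ.symm w)) = w
    rw [hθ2 _ key, Homeomorph.apply_symm_apply]
  · intro w hw
    have hwn := Nb_norm hN hw
    rw [max_eq_left (by linarith)] at hwn
    have e1 : ψ.symm w = w := by
      by_cases h12 : ‖w‖ < 1.39
      · refine hψ4 _ ?_
        intro h; have := hKim _ h
        linarith
      · rcases hw with hw | ⟨hw1, hw2⟩
        · linarith
        · have hwN := hN w ⟨by linarith, by linarith⟩
          have hzs := a.map_target hwN.2.1
          have e1 : ψ.symm w = a (ρ.symm (a.symm w)) := by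
            rw [← hψ2 _ hzs, a.right_inv hwN.2.1]
          have e2 : ρ (a.symm w) = a.symm w := rad_fix _ _ _ (f1 _ hw2.le)
          rw [e1, ρ.symm_apply_eq.2 e2.symm, a.right_inv hwN.2.1]
    change ψ (θ (ψ.symm w)) = _
    rw [e1, hθ1 w (by linarith)]
    refine hψ3 _ ?_
    intro h; have := (hKim _ h).1
    rw [norm_smul, Real.norm_of_nonneg (by norm_num)] at this
    linarith

/-- iterated compositions -/
def Hit (k : ℕ → V ≃ₜ V) : ℕ → V ≃ₜ V
  | 0 => Homeomorph.refl V
  | n+1 => (k n).trans (Hit k n)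

theorem Hit_succ (k : ℕ → V ≃ₜ V) (n : ℕ) (w : V) : Hit k (n+1) w = Hit k n (k n w) := rfl

theorem fill_H [ProperSpace V] (a : OpenPartialHomeomorph V V)
    (hN : NI a {z | 1 ≤ ‖z‖ ∧ ‖z‖ ≤ 4} (1/100)) :
    ∃ H : V → V, Continuous H ∧ (∀ w, (∀ n : ℕ, w ∈ Nb a (0.4 * (1/2)^n)) → H w = 0) ∧
      (∀ n : ℕ, ∀ w ∈ Nb a (0.4 * (1/2)^n), ‖H w‖ ≤ 2 * (1/2)^n) ∧
      (∀ w, w ∉ Nb a 0.4 → H w = w) ∧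
      (∀ v, v ≠ 0 → ∃ n : ℕ, ∃ w, w ∉ Nb a (0.4 * (1/2)^n) ∧ H w = v) ∧
      (∀ w w' : V, ∀ n : ℕ, w ∉ Nb a (0.4 * (1/2)^n) → H w = H w' → w = w') := by
  have hex : ∀ n : ℕ, ∃ k : V ≃ₜ V, (∀ w, w ∉ Nb a (0.4 * (1/2)^n) → k w = w) ∧
      (∀ w ∈ Nb a (0.4 * (1/2)^(n+1)), k w = (1/2 : ℝ) • w) := by
    intro n
    have h1 : (0.4:ℝ) * (1/2)^n ≤ 0.4 := by
      have : ((1:ℝ)/2)^n ≤ 1 := pow_le_one₀ (by norm_num) (by norm_num)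
      linarith
    obtain ⟨k, h2, h3⟩ := fill_k a hN (t := 0.4 * (1/2)^n) (by positivity) h1
    refine ⟨k, h2, ?_⟩
    have : (0.4:ℝ) * (1/2)^(n+1) = 0.4 * (1/2)^n / 2 := by ring
    rwa [this]
  choose k hk1 hk2 using hex
  set T : ℕ → Set V := fun n => Nb a (0.4 * (1/2)^n) with hT
  have Tmono : ∀ m n, n ≤ m → T m ⊆ T n := by
    intro m n h
    refine Nb_mono a ?_
    have : ((1:ℝ)/2)^m ≤ (1/2)^n := pow_le_pow_of_le_one (by norm_num) (by norm_num) h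
    linarith
  have Tnorm : ∀ n, ∀ w ∈ T n, ‖w‖ ≤ 2 := by
    intro n w hw
    have := Nb_norm hN (by simpa using (show w ∈ Nb a (0.4 * (1/2)^0) from Tmono n 0 (Nat.zero_le _) hw))
    rw [max_eq_left (by norm_num)] at this
    linarith
  set H := Hit k with hH
  have Hsc : ∀ n, ∀ w ∈ T n, H n w = ((1/2:ℝ)^n) • w := by
    intro n
    induction n with
    | zero => intro w _; simp [hH, Hit]
    | succ n ih =>
      intro w hw
      rw [hH, Hit_succ, hk2 n w hw, ih, smul_smul, pow_succ]
      refine Or.inl ?_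
      have h1 := Tnorm _ w hw
      rw [norm_smul]; norm_num; linarith
  have Hbd : ∀ n m, ∀ w ∈ T n, ‖H (n+m) w‖ ≤ 2 * (1/2)^n := by
    intro n m
    induction m with
    | zero =>
      intro w hw
      rw [Nat.add_zero, Hsc n w hw, norm_smul, Real.norm_of_nonneg (by positivity), mul_comm]
      exact mul_le_mul_of_nonneg_right (Tnorm n w hw) (by positivity)
    | succ m ih =>
      intro w hw
      rw [hH, ← Nat.add_assoc, Hit_succ]
      refine ih _ ?_
      exact maps_supp (S := T n) (fun x hx => hk1 _ x (fun h => hx (Tmono _ _ (Nat.le_add_right _ _) h))) hw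
  have Hst : ∀ n m, ∀ w, w ∉ T n → H (n+m) w = H n w := by
    intro n m w hw
    induction m with
    | zero => rfl
    | succ m ih =>
      rw [← ih, hH, ← Nat.add_assoc, Hit_succ, hk1 _ _ (fun h => hw (Tmono _ _ (Nat.le_add_right _ _) h))]
  classical
  let L : V → V := fun w => if h : ∃ n, w ∉ T n then H (Nat.find h) w else 0
  have L1 : ∀ n w, w ∉ T n → L w = H n w := by
    intro n w hw
    have h : ∃ n, w ∉ T n := ⟨n, hw⟩
    have h1 := Nat.find_spec h
    have h2 : Nat.find h ≤ n := Nat.find_min' h hw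
    obtain ⟨m, hm⟩ := Nat.exists_eq_add_of_le h2
    simp only [L, dif_pos h]
    rw [hm, Hst _ _ _ h1]
  have L2 : ∀ w, (∀ n, w ∈ T n) → L w = 0 := by
    intro w hw
    simp [L, hw]
  have L3 : ∀ n, ∀ w ∈ T n, ‖L w‖ ≤ 2 * (1/2)^n := by
    intro n w hw
    by_cases h : ∃ n, w ∉ T n
    · obtain ⟨p, hp⟩ := h
      have hnp : n ≤ p := by
        by_contra hc
        exact hp (Tmono _ _ (not_le.1 hc).le hw)
      obtain ⟨m, rfl⟩ := Nat.exists_eq_add_of_le hnp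
      rw [L1 _ _ hp]; exact Hbd n m w hw
    · push Not at h
      rw [L2 w h]; simp
  have L5 : ∀ n, (0:V) ∈ T n := fun n => Or.inl (by simp; norm_num)
  have H0 : ∀ n, H n 0 = 0 := fun n => by rw [Hsc n 0 (L5 n), smul_zero]
  refine ⟨L, ?_, L2, L3, ?_, ?_, ?_⟩
  · refine unif_cont _ ?_
    intro ε hε
    obtain ⟨n, hn⟩ := exists_pow_lt_of_lt_one (show 0 < ε/4 by positivity) (show (1/2:ℝ) < 1 by norm_num)
    refine ⟨H n, (H n).continuous, fun w => ?_⟩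
    by_cases hw : w ∈ T n
    · have h1 := L3 n w hw
      have h2 := Hbd n 0 w hw
      rw [dist_eq_norm]
      refine (norm_sub_le _ _).trans ?_
      simp only [Nat.add_zero] at h2
      linarith
    · rw [L1 n w hw]; simpa using hε.le
  · intro w hw
    rw [L1 0 w (by simpa [hT] using hw)]; rfl
  · intro v hv
    obtain ⟨n, hn⟩ := exists_pow_lt_of_lt_one (show 0 < ‖v‖/2 from half_pos (norm_pos_iff.2 hv)) (show (1/2:ℝ) < 1 by norm_num)
    refine ⟨n, (H n).symm v, ?_⟩
    have : (H n).symm v ∉ T n := by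
      intro h
      have := Hbd n 0 _ h
      simp only [Nat.add_zero, Homeomorph.apply_symm_apply] at this
      linarith
    exact ⟨this, by rw [L1 n _ this, Homeomorph.apply_symm_apply]⟩
  · intro w w' n hw hww
    by_cases h : ∃ m, w' ∉ T m
    · obtain ⟨m, hm⟩ := h
      have a1 : w ∉ T (n+m) := fun h => hw (Tmono _ _ (by omega) h)
      have a2 : w' ∉ T (n+m) := fun h => hm (Tmono _ _ (by omega) h)
      rw [L1 _ _ a1, L1 _ _ a2] at hww
      exact (H (n+m)).injective hww
    · push Not at h
      rw [L2 w' h, L1 n w hw, ← H0 n] at hww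
      have := (H n).injective hww
      rw [this] at hw
      exact absurd (L5 n) hw


theorem fill_h [ProperSpace V] (a : OpenPartialHomeomorph V V)
    (hN : NI a {z | 1 ≤ ‖z‖ ∧ ‖z‖ ≤ 4} (1/100)) :
    ∃ h : V → V, ContinuousOn h {z | ‖z‖ ≤ 3} ∧
      (∀ z z', ‖z‖ ≤ 3 → ‖z'‖ ≤ 3 → h z = h z' → z = z') ∧
      (∀ z, 2 ≤ ‖z‖ → ‖z‖ ≤ 3 → h z = a z) ∧ (∀ z, ‖z‖ ≤ 2 → ‖h z‖ ≤ 2.1) ∧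
      (∀ v, ‖v‖ ≤ 2.8 → ∃ z, ‖z‖ ≤ 3 ∧ h z = v) := by
  classical
  obtain ⟨H, H1, H2, H3, H4, H5, H6⟩ := fill_H a hN
  set q : ℝ → ℝ := fun r => max r (1.4 + 2 * r / 9) with hq
  let Λ : V → V := fun z => (q ‖z‖ / ‖z‖) • z
  have qpos : ∀ z : V, 0 < q ‖z‖ := fun z => lt_max_of_lt_right (by positivity)
  have Λn : ∀ z : V, z ≠ 0 → ‖Λ z‖ = q ‖z‖ := by
    intro z hz
    have := norm_pos_iff.2 hz
    simp only [Λ, norm_smul, norm_div, norm_norm, Real.norm_of_nonneg (qpos z).le]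
    field_simp
  have ql : ∀ z : V, z ≠ 0 → 1.4 < q ‖z‖ := by
    intro z hz
    have := norm_pos_iff.2 hz
    exact lt_max_of_lt_right (by linarith)
  have qu : ∀ z : V, ‖z‖ ≤ 3 → q ‖z‖ ≤ 3 := fun z hz => max_le hz (by linarith)
  have ΛN : ∀ z : V, z ≠ 0 → ‖z‖ ≤ 3 → (1 ≤ ‖Λ z‖ ∧ ‖Λ z‖ ≤ 4) := by
    intro z hz hz3
    rw [Λn z hz]
    have := ql z hz; have := qu z hz3
    constructor <;> linarith
  have aΛ : ∀ z : V, z ≠ 0 → ‖z‖ ≤ 3 → a.symm (a (Λ z)) = Λ z := fun z hz hz3 =>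
    a.left_inv (hN _ (ΛN z hz hz3)).1
  -- membership in the neighbourhoods
  have nm : ∀ z : V, z ≠ 0 → ‖z‖ ≤ 3 → ∀ t, (a (Λ z) ∈ Nb a t ↔ q ‖z‖ < 1.4 + t) := by
    intro z hz hz3 t
    have h1 := near_norm (hN _ (ΛN z hz hz3)).2.2.1
    rw [Λn z hz] at h1
    have h2 := ql z hz; have h3 := qu z hz3
    simp only [Nb, Set.mem_ofPred_eq, aΛ z hz hz3, Λn z hz]
    constructor
    · rintro (h | h)
      · linarith
      · exact h.2
    · intro h; exact Or.inr ⟨by linarith, h⟩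
  have nX : ∀ z : V, z ≠ 0 → ‖z‖ ≤ 3 → ∃ n : ℕ, a (Λ z) ∉ Nb a (0.4 * (1/2)^n) := by
    intro z hz hz3
    have h2 := ql z hz
    obtain ⟨n, hn⟩ := exists_pow_lt_of_lt_one (show 0 < q ‖z‖ - 1.4 by linarith)
      (show (1/2:ℝ) < 1 by norm_num)
    refine ⟨n, ?_⟩
    rw [nm z hz hz3]
    have : (0:ℝ) ≤ (1/2)^n := by positivity
    linarith
  let h : V → V := fun z => if z = 0 then 0 else H (a (Λ z))
  have h0 : h 0 = 0 := by simp [h]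
  have hne : ∀ z, z ≠ 0 → h z = H (a (Λ z)) := fun z hz => by simp [h, hz]
  have H00 : H 0 = 0 := H2 0 (fun n => Or.inl (by simp; norm_num))
  have Λid : ∀ z : V, 1.8 ≤ ‖z‖ → Λ z = z := by
    intro z hz
    have : q ‖z‖ = ‖z‖ := max_eq_left (by linarith)
    simp only [Λ, this]
    rw [div_self (by linarith), one_smul]
  have Λinj : ∀ z z' : V, z ≠ 0 → z' ≠ 0 → Λ z = Λ z' → z = z' := by
    intro z z' hz hz' he
    have e1 : q ‖z‖ = q ‖z'‖ := by rw [← Λn z hz, ← Λn z' hz', he]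
    have e2 : ‖z‖ = ‖z'‖ := by
      have qm : StrictMono q := fun x y hxy => max_lt_max hxy (by linarith)
      exact qm.injective e1
    have h3 := norm_pos_iff.2 hz'
    simp only [Λ, e2] at he
    exact smul_right_injective V (div_pos (qpos z') h3).ne' he
  have Λsurj : ∀ y : V, 1.4 < ‖y‖ → ‖y‖ ≤ 3 → ∃ z, z ≠ 0 ∧ ‖z‖ ≤ 3 ∧ Λ z = y := by
    intro y hy1 hy2
    by_cases h18 : 1.8 ≤ ‖y‖
    · exact ⟨y, norm_pos_iff.1 (by linarith), hy2, Λid y h18⟩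
    · set r := (‖y‖ - 1.4) * 9 / 2 with hr
      have hr0 : 0 < r := by rw [hr]; linarith
      have hy0 : 0 < ‖y‖ := by linarith
      have hn : ‖(r/‖y‖) • y‖ = r := by
        rw [norm_smul, norm_div, norm_norm, Real.norm_of_nonneg hr0.le]; field_simp
      have hq' : q r = ‖y‖ := by
        have : q r = 1.4 + 2 * r / 9 := max_eq_right (by rw [hr]; linarith)
        rw [this, hr]; ring
      refine ⟨(r/‖y‖) • y, ?_, ?_, ?_⟩
      · rw [← norm_pos_iff, hn]; exact hr0
      · rw [hn, hr]; linarith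
      · simp only [Λ, hn, hq', smul_smul]
        have : ‖y‖ / r * (r / ‖y‖) = 1 := by field_simp
        rw [this, one_smul]
  refine ⟨h, ?_, ?_, ?_, ?_, ?_⟩
  · intro z hz
    by_cases hz0 : z = 0
    · subst hz0
      rw [Metric.continuousWithinAt_iff]
      intro ε hε
      obtain ⟨n, hn⟩ := exists_pow_lt_of_lt_one (show 0 < ε/2 by positivity)
        (show (1/2:ℝ) < 1 by norm_num)
      have tp : (0:ℝ) < (1/2)^n := by positivity
      refine ⟨min 1 (0.4 * (1/2)^n), by positivity, ?_⟩
      intro x hx3 hx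
      rw [dist_zero_right] at hx
      rw [h0, dist_zero_right]
      by_cases hx0 : x = 0
      · rw [hx0, h0, norm_zero]; exact hε
      · rw [hne x hx0]
        refine (H3 n _ ?_).trans_lt (by linarith)
        rw [nm x hx0 hx3]
        have h1 := hx.trans_le (min_le_left _ _)
        have h2 := hx.trans_le (min_le_right _ _)
        exact max_lt (by linarith) (by have := norm_nonneg x; linarith)
    · have hΛ : ContinuousAt Λ z := by
        have : ‖z‖ ≠ 0 := by simpa using hz0
        refine ContinuousAt.smul (ContinuousAt.div ?_ continuous_norm.continuousAt this) continuousAt_id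
        simp only [hq]; fun_prop
      have ha : ContinuousAt a (Λ z) := a.continuousAt (hN _ (ΛN z hz0 hz)).1
      have : ContinuousAt (fun z => H (a (Λ z))) z := 
        H1.continuousAt.comp (ContinuousAt.comp (f := Λ) (g := a) ha hΛ)
      refine (this.congr ?_).continuousWithinAt
      filter_upwards [isOpen_ne.mem_nhds hz0] with y hy
      exact (hne y hy).symm
  · intro z z' hz hz' he
    by_cases c1 : z = 0
    · by_cases c2 : z' = 0
      · rw [c1, c2]
      · obtain ⟨n, hn⟩ := nX z' c2 hz'
        rw [c1, h0, hne z' c2, ← H00] at he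
        have := H6 _ _ n hn he.symm
        rw [this] at hn
        exact absurd (Or.inl (by simp; norm_num)) hn
    · obtain ⟨n, hn⟩ := nX z c1 hz
      by_cases c2 : z' = 0
      · rw [c2, h0, hne z c1, ← H00] at he
        have := H6 _ _ n hn he
        rw [this] at hn
        exact absurd (Or.inl (by simp; norm_num)) hn
      · rw [hne z c1, hne z' c2] at he
        have e1 := H6 _ _ n hn he
        have e2 := a.injOn (hN _ (ΛN z c1 hz)).1 (hN _ (ΛN z' c2 hz')).1 e1
        exact Λinj z z' c1 c2 e2
  · intro z hz hz3
    have hz0 : z ≠ 0 := norm_pos_iff.1 (by linarith)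
    rw [hne z hz0, H4, Λid z (by linarith)]
    rw [nm z hz0 hz3]
    have : ‖z‖ ≤ q ‖z‖ := le_max_left _ _
    linarith
  · intro z hz
    by_cases hz0 : z = 0
    · rw [hz0, h0, norm_zero]; norm_num
    · rw [hne z hz0]
      by_cases hm : a (Λ z) ∈ Nb a 0.4
      · have := H3 0 (a (Λ z)) (by simpa using hm)
        norm_num at this ⊢; linarith
      · rw [H4 _ hm]
        have h1 := near_norm (hN _ (ΛN z hz0 (by linarith))).2.2.1
        rw [Λn z hz0] at h1
        have : q ‖z‖ ≤ 2 := max_le hz (by linarith)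
        linarith
  · intro v hv
    by_cases hv0 : v = 0
    · exact ⟨0, by simp, by rw [h0, hv0]⟩
    · obtain ⟨n, w, hw, hwv⟩ := H5 v hv0
      have hwn : ‖w‖ ≤ 2.8 := by
        by_cases hm : w ∈ Nb a 0.4
        · have := Nb_norm hN hm
          rw [max_eq_left (by norm_num)] at this
          linarith
        · rw [H4 w hm] at hwv; rw [hwv]; exact hv
      have tp : (0:ℝ) < (1/2)^n := by positivity
      simp only [Nb, Set.mem_ofPred_eq, not_or, not_and, not_lt] at hw
      have hwN := hN w ⟨by linarith [hw.1], by linarith⟩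
      have h1 := hw.2 (by linarith)
      have h2 := near_norm hwN.2.2.2
      obtain ⟨z, hz0, hz3, hz⟩ := Λsurj (a.symm w) (by linarith) (by linarith)
      refine ⟨z, hz3, ?_⟩
      rw [hne z hz0, hz, a.right_inv hwN.2.1, hwv]

end fill
end HS

namespace HS
section fillall
variable {V : Type*} [NormedAddCommGroup V] [NormedSpace ℝ V]

theorem fill_hs [ProperSpace V] (a : OpenPartialHomeomorph V V) (c : V) {s : ℝ} (hs : 0 < s)
    (hN : NI a {z | s ≤ ‖z - c‖ ∧ ‖z - c‖ ≤ 4 * s} (s/100)) :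
    ∃ h : V → V, ContinuousOn h {z | ‖z - c‖ ≤ 3 * s} ∧
      (∀ z z', ‖z - c‖ ≤ 3 * s → ‖z' - c‖ ≤ 3 * s → h z = h z' → z = z') ∧
      (∀ z, 2 * s ≤ ‖z - c‖ → ‖z - c‖ ≤ 3 * s → h z = a z) ∧
      (∀ z, ‖z - c‖ ≤ 2 * s → ‖h z - c‖ ≤ 2.1 * s) ∧
      (∀ v, ‖v - c‖ ≤ 2.8 * s → ∃ z, ‖z - c‖ ≤ 3 * s ∧ h z = v) := by
  have hN' : NI (conjA a c s hs) {z | 1 ≤ ‖z‖ ∧ ‖z‖ ≤ 4} (1/100) := by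
    refine conjA_NI a c s hs _ _ (1/100) (by rw [show s * (1/100) = s/100 by ring]; exact hN) ?_
    intro z hz
    have : ‖c + s • z - c‖ = s * ‖z‖ := by
      rw [add_sub_cancel_left, norm_smul, Real.norm_of_nonneg hs.le]
    change s ≤ ‖c + s • z - c‖ ∧ ‖c + s • z - c‖ ≤ 4 * s
    rw [this]
    constructor
    · have := hz.1; nlinarith
    · have := hz.2; nlinarith
  obtain ⟨h, h1, h2, h3, h4, h5⟩ := fill_h _ hN'
  have nrm : ∀ z, ‖s⁻¹ • (z - c)‖ = ‖z - c‖ / s := by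
    intro z
    rw [norm_smul, Real.norm_of_nonneg (by positivity)]; field_simp
  have le3 : ∀ z {k : ℝ}, ‖z - c‖ ≤ k * s → ‖s⁻¹ • (z - c)‖ ≤ k := by
    intro z k hz; rw [nrm, div_le_iff₀ hs]; exact hz
  refine ⟨fun z => c + s • h (s⁻¹ • (z - c)), ?_, ?_, ?_, ?_, ?_⟩
  · refine ContinuousOn.add continuousOn_const (ContinuousOn.const_smul ?_ s)
    refine h1.comp (by fun_prop) ?_
    intro z hz; exact le3 z hz
  · intro z z' hz hz' he
    have e1 : h (s⁻¹ • (z - c)) = h (s⁻¹ • (z' - c)) :=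
      smul_right_injective V hs.ne' (add_left_cancel he)
    have e2 := h2 _ _ (le3 z hz) (le3 z' hz') e1
    have e3 := smul_right_injective V (inv_ne_zero hs.ne') e2
    exact sub_left_injective e3
  · intro z hz hz3
    have : 2 ≤ ‖s⁻¹ • (z - c)‖ := by rw [nrm, le_div_iff₀ hs]; exact hz
    simp only [h3 _ this (le3 z hz3), conjA_apply]
    simp [smul_smul, hs.ne']
  · intro z hz
    have := h4 _ (le3 z hz)
    simp only [add_sub_cancel_left, norm_smul, Real.norm_of_nonneg hs.le]
    nlinarith
  · intro v hv
    obtain ⟨z, hz, hzv⟩ := h5 _ (le3 v hv)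
    refine ⟨c + s • z, ?_, ?_⟩
    · simp only [add_sub_cancel_left, norm_smul, Real.norm_of_nonneg hs.le]
      nlinarith
    · simp [smul_smul, hs.ne', hzv]

theorem fill_all [ProperSpace V] (a : OpenPartialHomeomorph V V) (C : Set V) {s : ℝ} (hs : 0 < s)
    (hC : ∀ c ∈ C, ∀ c' ∈ C, c ≠ c' → 8 * s ≤ ‖c - c'‖)
    (hN : NI a {z | ∀ c ∈ C, s ≤ ‖z - c‖} (s/100)) :
    ∃ G : V ≃ₜ V, (∀ z, (∀ c ∈ C, 2 * s ≤ ‖z - c‖) → G z = a z) ∧ ∀ z, ‖G z - z‖ ≤ 5 * s := by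
  classical
  have tri : ∀ x y z : V, ‖x - z‖ ≤ ‖x - y‖ + ‖y - z‖ := fun x y z => by
    have := norm_add_le (x - y) (y - z); simpa using this
  have hsep : ∀ z : V, ∀ c ∈ C, ∀ c' ∈ C, c ≠ c' → ‖z - c‖ ≤ 4 * s → 4 * s ≤ ‖z - c'‖ := by
    intro z c hc c' hc' hne hz
    have h1 := hC c hc c' hc' hne
    have h2 := tri c z c'
    rw [norm_sub_rev c z] at h2
    linarith
  have hex : ∀ c : V, ∃ h : V → V, c ∈ C → (ContinuousOn h {z | ‖z - c‖ ≤ 3 * s} ∧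
      (∀ z z', ‖z - c‖ ≤ 3 * s → ‖z' - c‖ ≤ 3 * s → h z = h z' → z = z') ∧
      (∀ z, 2 * s ≤ ‖z - c‖ → ‖z - c‖ ≤ 3 * s → h z = a z) ∧
      (∀ z, ‖z - c‖ ≤ 2 * s → ‖h z - c‖ ≤ 2.1 * s) ∧
      (∀ v, ‖v - c‖ ≤ 2.8 * s → ∃ z, ‖z - c‖ ≤ 3 * s ∧ h z = v)) := by
    intro c
    by_cases hc : c ∈ C
    · obtain ⟨h, hh⟩ := fill_hs a c hs (by
        intro z hz
        refine hN z ?_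
        intro c' hc'
        by_cases hcc : c' = c
        · rw [hcc]; exact hz.1
        · have := hsep z c hc c' hc' (Ne.symm hcc) hz.2
          linarith)
      exact ⟨h, fun _ => hh⟩
    · exact ⟨id, fun h => absurd h hc⟩
  choose h hh using hex
  let G : V → V := fun z => if hz : ∃ c ∈ C, ‖z - c‖ < 2 * s then h hz.choose z else a z
  have G1 : ∀ c ∈ C, ∀ z, ‖z - c‖ ≤ 3 * s → G z = h c z := by
    intro c hc z hz
    by_cases hz2 : ∃ c ∈ C, ‖z - c‖ < 2 * s
    · have : hz2.choose = c := by
        by_contra hne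
        have := hsep z c hc _ hz2.choose_spec.1 (Ne.symm hne) (by linarith)
        have := hz2.choose_spec.2
        linarith
      simp only [G, dif_pos hz2, this]
    · simp only [G, dif_neg hz2]
      push Not at hz2
      exact ((hh c hc).2.2.1 z (hz2 c hc) hz).symm
  have G2 : ∀ z, (∀ c ∈ C, 2 * s ≤ ‖z - c‖) → G z = a z := by
    intro z hz
    have : ¬ ∃ c ∈ C, ‖z - c‖ < 2 * s := by push Not; exact hz
    simp only [G, dif_neg this]
  have Gd : ∀ z, ‖G z - z‖ ≤ 5 * s := by
    intro z
    by_cases hz : ∃ c ∈ C, ‖z - c‖ < 2 * s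
    · obtain ⟨c, hc, hz⟩ := hz
      rw [G1 c hc z (by linarith)]
      have h1 := (hh c hc).2.2.2.1 z hz.le
      have h2 := tri (h c z) c z
      rw [norm_sub_rev c z] at h2
      linarith
    · push Not at hz
      rw [G2 z hz]
      have := (hN z (fun c hc => by linarith [hz c hc])).2.2.1
      linarith
  have Gc : Continuous G := by
    rw [continuous_iff_continuousAt]
    intro z
    by_cases hz : ∃ c ∈ C, ‖z - c‖ < 3 * s
    · obtain ⟨c, hc, hz⟩ := hz
      have hopen : {z | ‖z - c‖ < 3 * s} ∈ 𝓝 z :=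
        (isOpen_lt (by fun_prop) continuous_const).mem_nhds hz
      have h1 : ContinuousAt (h c) z := (hh c hc).1.continuousAt (Filter.mem_of_superset hopen
        (fun y hy => (show ‖y - c‖ ≤ 3 * s from le_of_lt hy)))
      refine h1.congr ?_
      filter_upwards [hopen] with y hy
      exact (G1 c hc y (le_of_lt hy)).symm
    · push Not at hz
      have h1 : ContinuousAt a z := a.continuousAt (hN z (fun c hc => by linarith [hz c hc])).1
      refine h1.congr ?_
      filter_upwards [Metric.ball_mem_nhds z hs] with y hy
      refine (G2 y ?_).symm
      intro c hc
      have h1 := hz c hc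
      have h2 := tri z y c
      rw [Metric.mem_ball, dist_eq_norm, norm_sub_rev] at hy
      linarith
  -- mixed injectivity
  have mix : ∀ z z', (∃ c ∈ C, ‖z - c‖ < 2 * s) → G z = G z' → z = z' := by
    rintro z z' ⟨c, hc, hz⟩ he
    by_cases hz' : ‖z' - c‖ ≤ 3 * s
    · rw [G1 c hc z (by linarith), G1 c hc z' hz'] at he
      exact (hh c hc).2.1 z z' (by linarith) hz' he
    · exfalso
      push Not at hz'
      rw [G1 c hc z (by linarith)] at he
      have h1 := (hh c hc).2.2.2.1 z hz.le
      rw [he] at h1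
      by_cases h3 : ∃ c' ∈ C, ‖z' - c'‖ < 2 * s
      · obtain ⟨c', hc', h3⟩ := h3
        have hne : c' ≠ c := by rintro rfl; linarith
        have h4 := hC c' hc' c hc hne
        rw [G1 c' hc' z' (by linarith)] at h1
        have h5 := (hh c' hc').2.2.2.1 z' h3.le
        have h6 := tri c' (h c' z') c
        rw [norm_sub_rev c' (h c' z')] at h6
        linarith
      · push Not at h3
        rw [G2 z' h3] at h1
        have h4 := (hN z' (fun c hc => by linarith [h3 c hc])).2.2.1
        have h5 := tri z' (a z') c
        rw [norm_sub_rev z' (a z')] at h5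
        linarith
  have Ginj : Function.Injective G := by
    intro z z' he
    by_cases hz : ∃ c ∈ C, ‖z - c‖ < 2 * s
    · exact mix z z' hz he
    by_cases hz' : ∃ c ∈ C, ‖z' - c‖ < 2 * s
    · exact (mix z' z hz' he.symm).symm
    push Not at hz hz'
    rw [G2 z hz, G2 z' hz'] at he
    exact a.injOn (hN z (fun c hc => by linarith [hz c hc])).1
      (hN z' (fun c hc => by linarith [hz' c hc])).1 he
  have Gsurj : Function.Surjective G := by
    intro w
    by_cases hw : ∃ c ∈ C, ‖w - c‖ ≤ 2.8 * s
    · obtain ⟨c, hc, hw⟩ := hw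
      obtain ⟨z, hz, hzw⟩ := (hh c hc).2.2.2.2 w hw
      exact ⟨z, by rw [G1 c hc z hz, hzw]⟩
    · push Not at hw
      have hwN := hN w (fun c hc => by linarith [hw c hc])
      refine ⟨a.symm w, ?_⟩
      rw [G2, a.right_inv hwN.2.1]
      intro c hc
      have h1 := hw c hc
      have h2 := tri w (a.symm w) c
      rw [norm_sub_rev w (a.symm w)] at h2
      linarith [hwN.2.2.2]
  obtain ⟨F, hF⟩ := bij_homeo G Gc ⟨Ginj, Gsurj⟩ Gd
  exact ⟨F, fun z hz => by rw [hF, G2 z hz], fun z => by rw [hF]; exact Gd z⟩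

end fillall
end HS

namespace HS
section sq
variable {V : Type*} [NormedAddCommGroup V] [NormedSpace ℝ V]

/-- max of one and the norm -/
noncomputable def mx (z : V) : ℝ := max 1 ‖z‖
theorem mx_cont : Continuous (mx : V → ℝ) := by unfold mx; fun_prop
theorem one_le_mx (z : V) : 1 ≤ mx z := le_max_left _ _
theorem le_mx (z : V) : ‖z‖ ≤ mx z := le_max_right _ _
theorem mx_lip (z w : V) : |mx w - mx z| ≤ ‖z - w‖ := by
  have h1 := norm_sub_norm_le z w
  have h2 := norm_sub_norm_le w z
  rw [norm_sub_rev w z] at h2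
  rw [abs_le]
  unfold mx
  constructor
  · have : max 1 ‖z‖ ≤ max 1 ‖w‖ + ‖z - w‖ := max_le (by have := le_max_left 1 ‖w‖; have := norm_nonneg (z-w); linarith) (by have := le_max_right 1 ‖w‖; linarith)
    linarith
  · have : max 1 ‖w‖ ≤ max 1 ‖z‖ + ‖z - w‖ := max_le (by have := le_max_left 1 ‖z‖; have := norm_nonneg (z-w); linarith) (by have := le_max_right 1 ‖z‖; linarith)
    linarith

/-- compression to ball of radius 2 -/
noncomputable def gam (z : V) : V := ((2 * mx z - 1) / (mx z)^2) • z
/-- inverse of compression -/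
noncomputable def gami (w : V) : V := (1 / ((2 - mx w) * mx w)) • w

theorem gam_cont : Continuous (gam : V → V) := by
  unfold gam
  refine Continuous.smul (Continuous.div ?_ ?_ ?_) continuous_id
  · exact (continuous_const.mul mx_cont).sub continuous_const
  · exact mx_cont.pow 2
  · intro z; have := one_le_mx z; positivity

theorem gam_one {z : V} (hz : ‖z‖ ≤ 1) : gam z = z := by
  have : mx z = 1 := max_eq_left hz
  rw [gam, this]; norm_num

theorem gami_one {z : V} (hz : ‖z‖ ≤ 1) : gami z = z := by
  have : mx z = 1 := max_eq_left hz
  rw [gami, this]; norm_num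

theorem mx_gam (z : V) : mx (gam z) = 2 - 1 / mx z := by
  by_cases hz : ‖z‖ ≤ 1
  · have : mx z = 1 := max_eq_left hz
    rw [gam_one hz, this]; norm_num
  · push Not at hz
    have h : mx z = ‖z‖ := max_eq_right hz.le
    have : ‖gam z‖ = 2 - 1 / mx z := by
      rw [gam, norm_smul, h, Real.norm_of_nonneg (div_nonneg (by linarith) (by positivity))]
      field_simp
    rw [mx, this]
    refine max_eq_right ?_
    have : 1 / mx z ≤ 1 := by rw [div_le_one (by linarith [one_le_mx z])]; exact one_le_mx z
    linarith

theorem gam_lt (z : V) : ‖gam z‖ < 2 := by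
  have h1 := le_mx (gam z)
  rw [mx_gam] at h1
  have : 0 < 1 / mx z := by have := one_le_mx z; positivity
  linarith

theorem gami_gam (z : V) : gami (gam z) = z := by
  rw [gami, mx_gam, gam, smul_smul]
  have h1 := one_le_mx z
  have h2 : 2 * mx z - 1 ≠ 0 := by linarith
  have : 1 / ((2 - (2 - 1 / mx z)) * (2 - 1 / mx z)) * ((2 * mx z - 1) / mx z ^ 2) = 1 := by
    have h3 : (2 - (2 - 1 / mx z)) * (2 - 1 / mx z) = (2 * mx z - 1) / mx z ^ 2 := by
      field_simp; ring
    rw [h3]; field_simp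
  rw [this, one_smul]

theorem mx_gami {w : V} (hw : ‖w‖ < 2) : mx (gami w) = 1 / (2 - mx w) := by
  by_cases hz : ‖w‖ ≤ 1
  · have : mx w = 1 := max_eq_left hz
    rw [gami_one hz, this]; norm_num
  · push Not at hz
    have h : mx w = ‖w‖ := max_eq_right hz.le
    have h2 : 0 < 2 - ‖w‖ := by linarith
    have : ‖gami w‖ = 1 / (2 - mx w) := by
      rw [gami, norm_smul, h, Real.norm_of_nonneg (by positivity)]
      field_simp
    rw [mx, this]
    refine max_eq_right ?_
    rw [h, le_div_iff₀ h2]; linarith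

theorem gam_gami {w : V} (hw : ‖w‖ < 2) : gam (gami w) = w := by
  rw [gam, mx_gami hw, gami, smul_smul]
  have h1 := one_le_mx w
  have h2 : 0 < 2 - mx w := by
    have : mx w < 2 := max_lt (by norm_num) hw
    linarith
  have : (2 * (1 / (2 - mx w)) - 1) / (1 / (2 - mx w)) ^ 2 * (1 / ((2 - mx w) * mx w)) = 1 := by
    field_simp; ring
  rw [this, one_smul]

theorem gam_lip (x y : V) : ‖gam x - gam y‖ ≤ 4 * ‖x - y‖ / mx x := by
  have h1 := one_le_mx x
  have h2 := one_le_mx y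
  set p := mx x with hp
  set q := mx y with hq
  have hpq : |q - p| ≤ ‖x - y‖ := mx_lip x y
  have e : gam x - gam y = ((2*p-1)/p^2) • (x - y) + ((2*p-1)/p^2 - (2*q-1)/q^2) • y := by
    rw [gam, gam, ← hp, ← hq, smul_sub, sub_smul]; abel
  have e2 : (2*p-1)/p^2 - (2*q-1)/q^2 = (q - p) * ((2*p*q-p-q)/(p^2*q^2)) := by
    field_simp; ring
  have e3 : 0 ≤ (2*p*q-p-q)/(p^2*q^2) := div_nonneg (by nlinarith) (by positivity)
  have e4 : (2*p*q-p-q)/(p^2*q^2) * q ≤ 2 / p := by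
    rw [div_mul_eq_mul_div, div_le_div_iff₀ (by positivity) (by positivity)]
    have : 0 ≤ p * q * (p + q) := by positivity
    nlinarith
  have e5 : (2*p-1)/p^2 ≤ 2 / p := by
    rw [div_le_div_iff₀ (by positivity) (by positivity)]; nlinarith
  have e6 : 0 ≤ (2*p-1)/p^2 := div_nonneg (by linarith) (by positivity)
  rw [e]
  refine (norm_add_le _ _).trans ?_
  rw [norm_smul, norm_smul, Real.norm_of_nonneg e6, e2, norm_mul, Real.norm_of_nonneg e3, Real.norm_eq_abs]
  have n0 := norm_nonneg (x - y)
  have t1 : (2*p-1)/p^2 * ‖x - y‖ ≤ 2 / p * ‖x - y‖ := mul_le_mul_of_nonneg_right e5 n0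
  have t2 : |q - p| * ((2*p*q-p-q)/(p^2*q^2)) * ‖y‖ ≤ ‖x - y‖ * (2 / p) := by
    rw [mul_assoc]
    refine mul_le_mul hpq ?_ (mul_nonneg e3 (norm_nonneg _)) n0
    exact (mul_le_mul_of_nonneg_left (le_mx y) e3).trans e4
  have : 4 * ‖x - y‖ / p = 2 / p * ‖x - y‖ + ‖x - y‖ * (2 / p) := by ring
  rw [this]; linarith

open Classical in
/-- squeezed map -/
noncomputable def sqF (G : V → V) (w : V) : V := if ‖w‖ < 2 then gam (G (gami w)) else w

theorem sqF_disp {G : V → V} {b : ℝ} (hG : ∀ z, ‖G z - z‖ ≤ b) (w : V) :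
    ‖sqF G w - w‖ ≤ 4 * b * max 0 (2 - mx w) := by
  have hb : 0 ≤ b := (norm_nonneg _).trans (hG 0)
  unfold sqF
  split_ifs with h
  · have h2 : 0 < 2 - mx w := by
      have : mx w < 2 := max_lt (by norm_num) h
      linarith
    rw [max_eq_right h2.le]
    have e := gam_lip (gami w) (G (gami w))
    rw [gam_gami h, mx_gami h, norm_sub_rev] at e
    refine e.trans ?_
    rw [div_div_eq_mul_div, div_one]
    refine mul_le_mul_of_nonneg_right ?_ h2.le
    rw [norm_sub_rev]
    linarith [hG (gami w)]
  · rw [sub_self, norm_zero]; positivity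

theorem sqF_inv {G G' : V → V} (h : ∀ z, G' (G z) = z) (w : V) : sqF G' (sqF G w) = w := by
  by_cases hw : ‖w‖ < 2
  · have e1 : sqF G w = gam (G (gami w)) := if_pos hw
    rw [e1, sqF, if_pos (gam_lt _), gami_gam, h, gam_gami hw]
  · have e1 : sqF G w = w := if_neg hw
    rw [e1, sqF, if_neg hw]

theorem sqF_cont {G : V → V} (hc : Continuous G) {b : ℝ} (hG : ∀ z, ‖G z - z‖ ≤ b) :
    Continuous (sqF G) := by
  rw [continuous_iff_continuousAt]
  intro w
  by_cases hw : ‖w‖ < 2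
  · have hopen : {z : V | ‖z‖ < 2} ∈ 𝓝 w :=
      (isOpen_lt continuous_norm continuous_const).mem_nhds hw
    have h2 : 0 < 2 - mx w := by
      have : mx w < 2 := max_lt (by norm_num) hw
      linarith
    have h3 := one_le_mx w
    have hi : ContinuousAt (gami : V → V) w := by
      unfold gami
      refine ContinuousAt.smul (ContinuousAt.div continuousAt_const ?_ (by positivity)) continuousAt_id
      exact ((continuous_const.sub mx_cont).mul mx_cont).continuousAt
    have : ContinuousAt (fun w => gam (G (gami w))) w :=
      (gam_cont.comp hc).continuousAt.comp hi
    refine this.congr ?_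
    filter_upwards [hopen] with y hy
    exact (if_pos hy).symm
  · have e1 : sqF G w = w := if_neg hw
    have : Filter.Tendsto (fun y => sqF G y - y) (𝓝 w) (𝓝 0) := by
      refine squeeze_zero_norm (sqF_disp hG) ?_
      have hcn : Continuous (fun y : V => 4 * b * max 0 (2 - mx y)) :=
        continuous_const.mul (continuous_const.max (continuous_const.sub mx_cont))
      have := hcn.tendsto w
      have hz : max 0 (2 - mx w) = 0 := max_eq_left (by have := le_mx w; linarith)
      rwa [hz, mul_zero] at this
    have h2 := this.add (continuous_id.tendsto w)
    rw [ContinuousAt, e1]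
    simpa using h2

theorem squeeze (G : V ≃ₜ V) {b : ℝ} (hG : ∀ z, ‖G z - z‖ ≤ b) :
    ∃ f : V ≃ₜ V, (∀ z, 2 ≤ ‖z‖ → f z = z) ∧ (∀ z, ‖z‖ ≤ 1 → ‖G z‖ ≤ 1 → f z = G z) ∧
      ∀ z, ‖f z - z‖ ≤ 4 * b := by
  have hG' : ∀ z, ‖G.symm z - z‖ ≤ b := by
    intro z
    have := hG (G.symm z)
    rwa [Homeomorph.apply_symm_apply, norm_sub_rev] at this
  obtain ⟨F, hF, -⟩ := exists_homeo (sqF G) (sqF G.symm) (sqF_inv G.symm_apply_apply)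
    (sqF_inv G.apply_symm_apply) (sqF_cont G.continuous hG) (sqF_cont G.symm.continuous hG')
  have hb : 0 ≤ b := (norm_nonneg _).trans (hG 0)
  refine ⟨F, ?_, ?_, ?_⟩
  · intro z hz; rw [hF, sqF, if_neg (not_lt.2 hz)]
  · intro z hz hz'
    rw [hF, sqF, if_pos (by linarith), gami_one hz, gam_one hz']
  · intro z
    rw [hF]
    refine (sqF_disp hG z).trans ?_
    have : max 0 (2 - mx z) ≤ 1 := max_le zero_le_one (by linarith [one_le_mx z])
    nlinarith [le_max_left 0 (2 - mx z)]

end sq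
end HS

namespace HS
section lift
variable {V : Type*} [NormedAddCommGroup V] [NormedSpace ℝ V]

/-- quantitative local homeomorphism property at `u` with constant `r` -/
def PP (β : V → V) (u : V) (r : ℝ) : Prop :=
  (∀ x y, ‖x - u‖ ≤ r → ‖y - u‖ ≤ r → r * ‖x - y‖ ≤ ‖β x - β y‖) ∧
  ∀ η, 0 < η → η ≤ r → ∀ w, ‖w - β u‖ ≤ r * η → ∃ x, ‖x - u‖ ≤ η ∧ β x = w

theorem PP_mono {β : V → V} {u : V} {r r' : ℝ} (hr : r' ≤ r) (h : PP β u r) : PP β u r' := by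
  refine ⟨fun x y hx hy => ?_, fun η h0 h1 w hw => ?_⟩
  · exact (mul_le_mul_of_nonneg_right hr (norm_nonneg _)).trans
      (h.1 x y (hx.trans hr) (hy.trans hr))
  · exact h.2 η h0 (h1.trans hr) w (hw.trans (mul_le_mul_of_nonneg_right hr h0.le))

theorem lift_cont {β : V → V} (hβ : Continuous β) {S : Set V} (hS : IsOpen S) {r η : ℝ} (hr : 0 < r)
    (hη : 0 < η) (hηr : 2 * η ≤ r) (hP : ∀ u ∈ S, PP β u r) {a : V → V} {L : V → V}
    (ha : ∀ u ∈ S, ContinuousAt a (β u)) (hL : ∀ u ∈ S, ‖L u - u‖ ≤ η ∧ β (L u) = a (β u)) :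
    ContinuousOn L S := by
  intro u hu
  refine ContinuousAt.continuousWithinAt ?_
  rw [ContinuousAt, tendsto_iff_norm_sub_tendsto_zero]
  have hc : ContinuousAt (fun x => a (β x)) u :=
    ContinuousAt.comp (f := β) (g := a) (ha u hu) hβ.continuousAt
  have h1 : Filter.Tendsto (fun x => r⁻¹ * ‖a (β x) - a (β u)‖) (𝓝 u) (𝓝 0) := by
    have := (tendsto_iff_norm_sub_tendsto_zero.1 hc).const_mul r⁻¹
    simpa using this
  refine squeeze_zero' (Filter.Eventually.of_forall fun x => norm_nonneg _) ?_ h1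
  filter_upwards [hS.mem_nhds hu, Metric.ball_mem_nhds u hη] with x hx hxu
  rw [Metric.mem_ball, dist_eq_norm] at hxu
  have e1 := hL x hx
  have e2 := hL u hu
  have e3 : ‖L x - u‖ ≤ r := by
    have : L x - u = (L x - x) + (x - u) := by abel
    rw [this]; refine (norm_add_le _ _).trans ?_
    linarith
  have := (hP u hu).1 (L x) (L u) e3 (by linarith [e2.1])
  rw [e1.2, e2.2] at this
  rw [le_inv_mul_iff₀ hr]; exact this

theorem lift_fill [ProperSpace V] (β : V → V) (hβ : Continuous β) (C : Set V) (hCn : C.Nonempty)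
    {s : ℝ} (hs : 0 < s) (hC : ∀ c ∈ C, ∀ c' ∈ C, c ≠ c' → 8 * s ≤ ‖c - c'‖)
    {r : ℝ} (hr : 0 < r) (hP : ∀ u, (∀ c ∈ C, s / 2 ≤ ‖u - c‖) → PP β u r)
    {R : ℝ} (hR : ∀ u, ‖β u‖ ≤ R) :
    ∃ δ > 0, ∀ a : OpenPartialHomeomorph V V, NI a {z | ‖z‖ ≤ R} δ →
      ∃ G : V ≃ₜ V, (∀ z, ‖G z - z‖ ≤ 5 * s) ∧
        ∀ u, (∀ c ∈ C, 2 * s ≤ ‖u - c‖) → β (G u) = a (β u) ∧ ‖G u - u‖ ≤ s / 100 := by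
  classical
  set η := min (r/2) (s/100) with hηd
  have hη : 0 < η := by positivity
  have hη1 : 2 * η ≤ r := by have := min_le_left (r/2) (s/100); linarith
  have hη2 : η ≤ s/100 := min_le_right _ _
  refine ⟨r * η, by positivity, ?_⟩
  intro a ha
  set S : Set V := {u | s / 2 < Metric.infDist u C} with hSd
  have hSo : IsOpen S := isOpen_lt continuous_const (Metric.continuous_infDist_pt C)
  have hSP : ∀ u ∈ S, PP β u r := by
    intro u hu
    refine hP u fun c hc => ?_
    rw [← dist_eq_norm]
    exact (le_of_lt hu).trans (Metric.infDist_le_dist_of_mem hc)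
  have ex1 : ∀ u, ∃ x, u ∈ S → (‖x - u‖ ≤ η ∧ β x = a (β u)) := by
    intro u
    by_cases hu : u ∈ S
    · obtain ⟨x, hx⟩ := (hSP u hu).2 η hη (by linarith) (a (β u)) (ha _ (hR u)).2.2.1
      exact ⟨x, fun _ => hx⟩
    · exact ⟨0, fun h => absurd h hu⟩
  have ex2 : ∀ u, ∃ x, u ∈ S → (‖x - u‖ ≤ η ∧ β x = a.symm (β u)) := by
    intro u
    by_cases hu : u ∈ S
    · obtain ⟨x, hx⟩ := (hSP u hu).2 η hη (by linarith) (a.symm (β u)) (ha _ (hR u)).2.2.2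
      exact ⟨x, fun _ => hx⟩
    · exact ⟨0, fun h => absurd h hu⟩
  choose L hL using ex1
  choose L' hL' using ex2
  have inv1 : ∀ x ∈ S, L x ∈ S → L' (L x) = x := by
    intro x hx hLx
    have e1 := hL x hx
    have e2 := hL' (L x) hLx
    have e3 : β (L' (L x)) = β x := by
      rw [e2.2, e1.2, a.left_inv (ha _ (hR x)).1]
    have e4 : ‖L' (L x) - x‖ ≤ r := by
      have : L' (L x) - x = (L' (L x) - L x) + (L x - x) := by abel
      rw [this]; refine (norm_add_le _ _).trans ?_
      linarith [e1.1, e2.1]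
    have := (hSP x hx).1 _ x e4 (by simp [hr.le])
    rw [e3, sub_self, norm_zero] at this
    have h0 : ‖L' (L x) - x‖ ≤ 0 := by
      by_contra hc; push Not at hc; nlinarith
    exact sub_eq_zero.1 (norm_le_zero_iff.1 h0)
  have inv2 : ∀ x ∈ S, L' x ∈ S → L (L' x) = x := by
    intro x hx hLx
    have e1 := hL' x hx
    have e2 := hL (L' x) hLx
    have e3 : β (L (L' x)) = β x := by
      rw [e2.2, e1.2, a.right_inv (ha _ (hR x)).2.1]
    have e4 : ‖L (L' x) - x‖ ≤ r := by
      have : L (L' x) - x = (L (L' x) - L' x) + (L' x - x) := by abel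
      rw [this]; refine (norm_add_le _ _).trans ?_
      linarith [e1.1, e2.1]
    have := (hSP x hx).1 _ x e4 (by simp [hr.le])
    rw [e3, sub_self, norm_zero] at this
    have h0 : ‖L (L' x) - x‖ ≤ 0 := by
      by_contra hc; push Not at hc; nlinarith
    exact sub_eq_zero.1 (norm_le_zero_iff.1 h0)
  have c1 : ContinuousOn L S := lift_cont hβ hSo hr hη hη1 hSP
    (fun u _ => a.continuousAt (ha _ (hR u)).1) hL
  have c2 : ContinuousOn L' S := lift_cont hβ hSo hr hη hη1 hSP
    (fun u _ => a.symm.continuousAt (ha _ (hR u)).2.1) hL'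
  have big : ∀ u x, (∀ c ∈ C, s ≤ ‖u - c‖) → ‖x - u‖ ≤ η → x ∈ S := by
    intro u x hu hx
    have h1 : s ≤ Metric.infDist u C := by
      rw [Metric.le_infDist hCn]; intro c hc; rw [dist_eq_norm]; exact hu c hc
    have h2 := Metric.infDist_le_infDist_add_dist (s := C) (x := u) (y := x)
    rw [dist_comm, dist_eq_norm] at h2
    change s / 2 < Metric.infDist x C
    linarith
  have NIb : NI (mkOPH L L' S S hSo hSo c1 c2 inv1 inv2) {z | ∀ c ∈ C, s ≤ ‖z - c‖} (s/100) := by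
    intro z hz
    have hzS := big z z hz (by simp [hη.le])
    exact ⟨⟨hzS, big z _ hz (hL z hzS).1⟩, ⟨hzS, big z _ hz (hL' z hzS).1⟩,
      (hL z hzS).1.trans hη2, (hL' z hzS).1.trans hη2⟩
  obtain ⟨G, hG1, hG2⟩ := fill_all _ C hs hC NIb
  refine ⟨G, hG2, fun u hu => ?_⟩
  have huS := big u u (fun c hc => by linarith [hu c hc]) (by simp [hη.le])
  have : G u = L u := hG1 u hu
  rw [this]
  exact ⟨(hL u huS).2, (hL u huS).1.trans hη2⟩

theorem compact_unif {X : Type*} [TopologicalSpace X] {Q : Set X} (hQ : IsCompact Q)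
    (P : X → ℝ → Prop) (hm : ∀ u r r', r' ≤ r → P u r → P u r')
    (h : ∀ u ∈ Q, ∃ r > 0, ∀ᶠ v in 𝓝 u, P v r) : ∃ r > 0, ∀ u ∈ Q, P u r := by
  refine hQ.induction_on (p := fun s => ∃ r > 0, ∀ u ∈ s, P u r) ⟨1, one_pos, by simp⟩ ?_ ?_ ?_
  · rintro s t hst ⟨r, hr, ht⟩
    exact ⟨r, hr, fun u hu => ht u (hst hu)⟩
  · rintro s t ⟨r, hr, hs⟩ ⟨r', hr', ht⟩
    refine ⟨min r r', lt_min hr hr', ?_⟩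
    rintro u (hu | hu)
    · exact hm _ _ _ (min_le_left _ _) (hs u hu)
    · exact hm _ _ _ (min_le_right _ _) (ht u hu)
  · intro u hu
    obtain ⟨r, hr, hP⟩ := h u hu
    exact ⟨_, mem_nhdsWithin_of_mem_nhds hP, r, hr, fun v hv => hv⟩

theorem PP_of_strict [CompleteSpace V] {β : V → V} {f' : V ≃L[ℝ] V} {u : V}
    (h : HasStrictFDerivAt β (f' : V →L[ℝ] V) u) : ∃ r > 0, ∀ᶠ v in 𝓝 u, PP β v r := by
  rcases subsingleton_or_nontrivial V with hV | hV
  · refine ⟨1, one_pos, Filter.Eventually.of_forall fun v => ⟨fun x y _ _ => ?_, fun η h0 _ w _ => ?_⟩⟩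
    · rw [Subsingleton.elim x y]; simp
    · exact ⟨v, by simp [h0.le], Subsingleton.elim _ _⟩
  set N : NNReal := ‖(f'.symm : V →L[ℝ] V)‖₊ with hN
  have hNp : 0 < N := f'.nnnorm_symm_pos
  obtain ⟨s, hs, hsA⟩ := h.approximates_deriv_on_nhds (c := N⁻¹ / 2) (Or.inr (by positivity))
  obtain ⟨ε, hε, hball⟩ := Metric.mem_nhds_iff.1 hs
  have hN' : (0:ℝ) < N := hNp
  set r := min (ε/3) ((N:ℝ)⁻¹/2) with hr
  refine ⟨r, by positivity, ?_⟩
  filter_upwards [Metric.ball_mem_nhds u (show 0 < ε/3 by positivity)] with v hv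
  rw [Metric.mem_ball, dist_eq_norm] at hv
  have hr1 : r ≤ ε/3 := min_le_left _ _
  have hr2 : r ≤ (N:ℝ)⁻¹/2 := min_le_right _ _
  have hsub : ∀ x, ‖x - v‖ ≤ r → x ∈ s := by
    intro x hx
    refine hball ?_
    rw [Metric.mem_ball, dist_eq_norm]
    have : x - u = (x - v) + (v - u) := by abel
    rw [this]; refine (norm_add_le _ _).trans_lt ?_
    linarith
  refine ⟨fun x y hx hy => ?_, fun η h0 h1 w hw => ?_⟩
  · have e1 := hsA x (hsub x hx) y (hsub y hy)
    have e2 : ‖x - y‖ ≤ N * ‖f' (x - y)‖ := by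
      have := (f'.symm : V →L[ℝ] V).le_opNorm (f' (x - y))
      have k : (f'.symm : V →L[ℝ] V) (f' (x - y)) = x - y := f'.symm_apply_apply _
      rw [k] at this
      exact this
    have e3 : ‖f' (x - y)‖ ≤ ‖β x - β y‖ + ‖β x - β y - f' (x - y)‖ := by
      have := norm_sub_le (β x - β y) (β x - β y - f' (x - y))
      simpa using this
    have e4 : ‖β x - β y - f' (x - y)‖ ≤ (N:ℝ)⁻¹ / 2 * ‖x - y‖ := by simpa using e1
    have e5 : (N:ℝ)⁻¹ * ‖x - y‖ ≤ ‖f' (x - y)‖ := by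
      rw [inv_mul_le_iff₀ hN']; exact e2
    have := mul_le_mul_of_nonneg_right hr2 (norm_nonneg (x - y))
    linarith
  · have e := hsA.surjOn_closedBall_of_nonlinearRightInverse f'.toNonlinearRightInverse h0.le
      (b := v) (fun x hx => hsub x (by
        rw [Metric.mem_closedBall, dist_eq_norm] at hx; linarith))
    have hw' : w ∈ Metric.closedBall (β v) (((f'.toNonlinearRightInverse.nnnorm : ℝ)⁻¹ - (N⁻¹/2 : NNReal)) * η) := by
      rw [Metric.mem_closedBall, dist_eq_norm]
      refine hw.trans (mul_le_mul_of_nonneg_right ?_ h0.le)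
      have : (f'.toNonlinearRightInverse.nnnorm : ℝ) = N := rfl
      rw [this]; push_cast; linarith
    obtain ⟨x, hx, hxw⟩ := e hw'
    rw [Metric.mem_closedBall, dist_eq_norm] at hx
    exact ⟨x, hx, hxw⟩

end lift
end HS

namespace HS

/-- the plane with the sup norm -/
abbrev E2 := ℝ × ℝ

noncomputable def mat (a b c d : ℝ) : E2 →L[ℝ] E2 :=
  (a • ContinuousLinearMap.fst ℝ ℝ ℝ + b • ContinuousLinearMap.snd ℝ ℝ ℝ).prod
    (c • ContinuousLinearMap.fst ℝ ℝ ℝ + d • ContinuousLinearMap.snd ℝ ℝ ℝ)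

theorem mat_apply (a b c d : ℝ) (z : E2) :
    mat a b c d z = (a * z.1 + b * z.2, c * z.1 + d * z.2) := by
  simp [mat]

theorem mat_equiv {a b c d : ℝ} (h : a * d - b * c ≠ 0) :
    ∃ f : E2 ≃L[ℝ] E2, (f : E2 →L[ℝ] E2) = mat a b c d := by
  set D := a * d - b * c with hD
  refine ⟨ContinuousLinearEquiv.equivOfInverse (mat a b c d) (mat (d/D) (-b/D) (-c/D) (a/D)) ?_ ?_, ?_⟩
  · intro z
    rw [mat_apply, mat_apply]
    ext
    · field_simp; rw [hD]; ring
    · field_simp; rw [hD]; ring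
  · intro z
    rw [mat_apply, mat_apply]
    ext
    · field_simp; rw [hD]; ring
    · field_simp; rw [hD]; ring
  · ext <;> rfl

noncomputable def alA (x y : ℝ) : ℝ :=
  Real.sin x * Real.sin y * (Real.cos x - 1) + Real.cos y - 1
    + Real.sin x * (Real.cos y + Real.sin y * Real.sin y)
noncomputable def alB (x y : ℝ) : ℝ :=
  1 - Real.cos x + Real.sin y * (Real.cos x + Real.sin x * Real.sin x)
    + Real.sin x * Real.sin y * (1 - Real.cos y)
noncomputable def Ax (x y : ℝ) : ℝ :=
  Real.sin y * (Real.cos x * (Real.cos x - 1) - Real.sin x * Real.sin x)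
    + Real.cos x * (Real.cos y + Real.sin y * Real.sin y)
noncomputable def Ay (x y : ℝ) : ℝ :=
  Real.sin x * Real.cos y * (Real.cos x - 1) - Real.sin y
    + Real.sin x * (- Real.sin y + 2 * Real.sin y * Real.cos y)
noncomputable def Bx (x y : ℝ) : ℝ :=
  Real.sin x + Real.sin y * (- Real.sin x + 2 * Real.sin x * Real.cos x)
    + Real.cos x * Real.sin y * (1 - Real.cos y)
noncomputable def By (x y : ℝ) : ℝ :=
  Real.cos y * (Real.cos x + Real.sin x * Real.sin x)
    + Real.sin x * (Real.cos y * (1 - Real.cos y) + Real.sin y * Real.sin y)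
noncomputable def al (z : E2) : E2 := (alA z.1 z.2, alB z.1 z.2)
noncomputable def Jac (z : E2) : ℝ :=
  Ax z.1 z.2 * By z.1 z.2 - Ay z.1 z.2 * Bx z.1 z.2

theorem al_strict {X Y : E2 → ℝ} {p q : ℝ} {z : E2}
    (hX : HasStrictFDerivAt X (p • ContinuousLinearMap.fst ℝ ℝ ℝ) z)
    (hY : HasStrictFDerivAt Y (q • ContinuousLinearMap.snd ℝ ℝ ℝ) z) :
    HasStrictFDerivAt (fun z => al (X z, Y z))
      (mat (Ax (X z) (Y z) * p) (Ay (X z) (Y z) * q) (Bx (X z) (Y z) * p) (By (X z) (Y z) * q)) z := by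
  have sx := hX.sin
  have cx := hX.cos
  have sy := hY.sin
  have cy := hY.cos
  have hA := ((((sx.mul sy).mul (cx.sub_const 1)).add cy).sub_const 1).add
    (sx.mul (cy.add (sy.mul sy)))
  have hB := ((cx.const_sub 1).add (sy.mul (cx.add (sx.mul sx)))).add
    ((sx.mul sy).mul (cy.const_sub 1))
  refine (hA.prodMk hB).congr_fderiv ?_
  refine ContinuousLinearMap.ext fun w => ?_
  rw [mat_apply]
  ext
  · simp [Ax, Ay, smul_eq_mul]; ring
  · simp [Bx, By, smul_eq_mul]; ring

theorem Jac_axis (z : E2) (h : z.1 = 0 ∨ z.2 = 0) : Jac z = 1 := by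
  rcases h with h | h
  · have := Real.sin_sq_add_cos_sq z.2
    simp [Jac, Ax, Ay, Bx, By, h]; linarith
  · have := Real.sin_sq_add_cos_sq z.1
    simp [Jac, Ax, Ay, Bx, By, h]; linarith

theorem Jac_cont : Continuous Jac := by
  unfold Jac Ax Ay Bx By; fun_prop

theorem al_cont : Continuous al := by
  unfold al alA alB; fun_prop

theorem al_bound (z : E2) : ‖al z‖ ≤ 6 := by
  have a1 := Real.abs_sin_le_one z.1
  have a2 := Real.abs_cos_le_one z.1
  have a3 := Real.abs_sin_le_one z.2
  have a4 := Real.abs_cos_le_one z.2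
  have m : ∀ {x y a b : ℝ}, |x| ≤ a → |y| ≤ b → |x * y| ≤ a * b := by
    intro x y a b hx hy
    rw [abs_mul]; exact mul_le_mul hx hy (abs_nonneg _) ((abs_nonneg _).trans hx)
  have p : ∀ {x y a b : ℝ}, |x| ≤ a → |y| ≤ b → |x + y| ≤ a + b :=
    fun hx hy => (abs_add_le _ _).trans (add_le_add hx hy)
  have q : ∀ {x y a b : ℝ}, |x| ≤ a → |y| ≤ b → |x - y| ≤ a + b :=
    fun hx hy => (abs_sub _ _).trans (add_le_add hx hy)
  have o : |(1:ℝ)| ≤ 1 := by simp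
  rw [Prod.norm_def]
  refine max_le ?_ ?_
  · have := p (q (p (m (m a1 a3) (q a2 o)) a4) o) (m a1 (p a4 (m a3 a3)))
    simp only [al, alA, Real.norm_eq_abs]; linarith
  · have := p (p (q o a2) (m a3 (p a2 (m a1 a1)))) (m (m a1 a3) (q o a4))
    simp only [al, alB, Real.norm_eq_abs]; linarith

theorem Jac_near : ∃ w > 0, ∀ z : E2, |z.1| ≤ Real.pi → |z.2| ≤ Real.pi →
    (|z.1| ≤ w ∨ |z.2| ≤ w) → Jac z ≠ 0 := by
  have hU : IsOpen {z : E2 | Jac z ≠ 0} := isOpen_ne_fun Jac_cont continuous_const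
  obtain ⟨u, v, hu, -, hu0, hv, huv⟩ := generalized_tube_lemma (isCompact_singleton (x := (0:ℝ)))
    (isCompact_Icc (a := -Real.pi) (b := Real.pi)) hU (by
      rintro ⟨x, y⟩ ⟨hx, -⟩
      have : Jac (x, y) = 1 := Jac_axis _ (Or.inl hx)
      show Jac (x, y) ≠ 0
      rw [this]; exact one_ne_zero)
  obtain ⟨u', v', hu', -, hu0', hv', huv'⟩ := generalized_tube_lemma
    (isCompact_singleton (x := (0:ℝ))) (isCompact_Icc (a := -Real.pi) (b := Real.pi))
    (hU.preimage continuous_swap) (by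
      rintro ⟨x, y⟩ ⟨hx, -⟩
      have : Jac (y, x) = 1 := Jac_axis _ (Or.inr hx)
      show Jac (y, x) ≠ 0
      rw [this]; exact one_ne_zero)
  obtain ⟨e, he, hb⟩ := Metric.isOpen_iff.1 hu 0 (hu0 rfl)
  obtain ⟨e', he', hb'⟩ := Metric.isOpen_iff.1 hu' 0 (hu0' rfl)
  refine ⟨min (e/2) (e'/2), by positivity, ?_⟩
  rintro ⟨x, y⟩ hx hy (h | h)
  · exact huv (show (x,y) ∈ u ×ˢ v from ⟨hb (by
      rw [Metric.mem_ball, Real.dist_eq, sub_zero]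
      have := min_le_left (e/2) (e'/2); simp only at h; linarith), hv (abs_le.1 hy)⟩)
  · have hm : (y, x) ∈ u' ×ˢ v' := Set.mk_mem_prod (hb' (by
      rw [Metric.mem_ball, Real.dist_eq, sub_zero]
      have := min_le_right (e/2) (e'/2); simp only at h; linarith)) (hv' (abs_le.1 hx))
    have := huv' hm
    rw [Set.mem_preimage] at this
    exact this

theorem al_zero : al 0 = 0 := by simp [al, alA, alB]

theorem al_period (z : E2) (m n : ℤ) :
    al (z.1 + m * (2 * Real.pi), z.2 + n * (2 * Real.pi)) = al z := by
  simp [al, alA, alB, Real.sin_add_int_mul_two_pi, Real.cos_add_int_mul_two_pi]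

theorem al_approx : ∃ w > 0, ApproximatesLinearOn al (ContinuousLinearMap.id ℝ E2)
    (Metric.ball 0 w) (1/2) := by
  have h := al_strict (X := Prod.fst) (Y := Prod.snd) (p := 1) (q := 1) (z := 0)
    (by simpa using hasStrictFDerivAt_fst) (by simpa using hasStrictFDerivAt_snd)
  have h' : HasStrictFDerivAt al (ContinuousLinearMap.id ℝ E2) 0 := by
    refine HasStrictFDerivAt.congr_fderiv h ?_
    refine ContinuousLinearMap.ext fun w => ?_
    rw [mat_apply]; simp [Ax, Ay, Bx, By]
  obtain ⟨s, hs, hA⟩ := h'.approximates_deriv_on_nhds (c := 1/2) (Or.inr (by positivity))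
  obtain ⟨w, hw, hb⟩ := Metric.mem_nhds_iff.1 hs
  exact ⟨w, hw, hA.mono_set hb⟩

/-- the reparametrisation of the circle -/
theorem exists_k {ε σ : ℝ} (hε : 0 < ε) (hε1 : ε < 1) (hσ : 0 < σ) (hσ1 : σ < 1) :
    ∃ k m : ℝ → ℝ, (∀ u, HasStrictDerivAt k (m u) u) ∧ (∀ u, 0 < m u) ∧
      (∀ u (n : ℤ), k (u + n * (2 * Real.pi)) = k u + n * (2 * Real.pi)) ∧
      (∀ u, |u| ≤ Real.pi - σ → k u = ε * u) ∧ (∀ u, |u| ≤ Real.pi → |k u| ≤ Real.pi) := by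
  have hpi := Real.pi_gt_three
  set b : ℝ → ℝ := fun t => max 0 (-Real.cos t - Real.cos σ) with hb
  have hbc : Continuous b := by fun_prop
  have hb0 : ∀ t, 0 ≤ b t := fun t => le_max_left _ _
  set I := ∫ t in (0:ℝ)..(2 * Real.pi), b t with hI
  have hbper : Function.Periodic b (2 * Real.pi) := fun t => by simp [hb]
  have hbev : ∀ t, b (-t) = b t := fun t => by simp [hb]
  have hIpos : 0 < I := by
    rw [hI]
    refine intervalIntegral.integral_pos (by positivity) hbc.continuousOn (fun t _ => hb0 t)
      ⟨Real.pi, ⟨Real.pi_pos.le, by linarith⟩, ?_⟩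
    simp only [hb, Real.cos_pi]
    have : Real.cos σ < 1 := by
      have := Real.cos_lt_cos_of_nonneg_of_le_pi le_rfl (by linarith : σ ≤ Real.pi) hσ
      simpa using this
    exact lt_max_of_lt_right (by linarith)
  have hII : ∀ x y, IntervalIntegrable b MeasureTheory.volume x y :=
    fun x y => hbc.intervalIntegrable x y
  set F : ℝ → ℝ := fun u => ∫ t in (0:ℝ)..u, b t with hF
  have hFd : ∀ u, HasStrictDerivAt F (b u) u := fun u =>
    intervalIntegral.integral_hasStrictDerivAt_right (hII _ _)
      (hbc.stronglyMeasurableAtFilter _ _) hbc.continuousAt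
  have hFper : ∀ u (n : ℤ), F (u + n * (2 * Real.pi)) = F u + n * I := by
    intro u n
    have h1 := hbper.intervalIntegral_add_zsmul_eq n u (fun x y => hII x y)
    have h2 : ∫ t in u..(u + 2 * Real.pi), b t = I := by
      have := hbper.intervalIntegral_add_eq u 0
      rw [this, hI, zero_add]
    have h3 := intervalIntegral.integral_add_adjacent_intervals (hII 0 u) (hII u (u + n • (2 * Real.pi)))
    rw [h1, h2] at h3
    simp only [zsmul_eq_mul] at h3
    exact h3.symm
  have hFodd : ∀ u, F (-u) = - F u := by
    intro u
    have h1 := intervalIntegral.integral_comp_neg (a := 0) (b := u) b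
    simp only [hbev, neg_zero] at h1
    show ∫ t in (0:ℝ)..(-u), b t = -∫ t in (0:ℝ)..u, b t
    rw [h1, intervalIntegral.integral_symm]
  have hFmono : Monotone F := by
    refine monotone_of_deriv_nonneg (fun u => (hFd u).hasDerivAt.differentiableAt) fun u => ?_
    rw [(hFd u).hasDerivAt.deriv]; exact hb0 u
  have hFpi : F Real.pi = I / 2 := by
    have h1 := hFper (-Real.pi) 1
    have h2 := hFodd Real.pi
    have : -Real.pi + ((1:ℤ):ℝ) * (2 * Real.pi) = Real.pi := by push_cast; ring
    rw [this] at h1; push_cast at h1; linarith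
  have hF0 : ∀ u, 0 ≤ u → u ≤ Real.pi - σ → F u = 0 := by
    intro u h0 h1
    have : ∀ t ∈ Set.uIcc 0 u, b t = 0 := by
      intro t ht
      rw [Set.uIcc_of_le h0] at ht
      simp only [hb]
      refine max_eq_left ?_
      have h3 := Real.cos_le_cos_of_nonneg_of_le_pi ht.1 (by linarith : Real.pi - σ ≤ Real.pi)
        (ht.2.trans h1)
      rw [Real.cos_pi_sub] at h3; linarith
    show ∫ t in (0:ℝ)..u, b t = 0
    rw [intervalIntegral.integral_congr (g := fun _ => 0) (fun t ht => this t ht)]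
    simp
  set A₀ := (1 - ε) * (2 * Real.pi) / I with hA
  have hA0 : 0 < A₀ := by
    have : 0 < 1 - ε := by linarith
    positivity
  have hAI : A₀ * I = (1 - ε) * (2 * Real.pi) := by rw [hA]; field_simp
  refine ⟨fun u => ε * u + A₀ * F u, fun u => ε * 1 + A₀ * b u, ?_, ?_, ?_, ?_, ?_⟩
  · intro u
    exact ((hasStrictDerivAt_id u).const_mul ε).add ((hFd u).const_mul A₀)
  · intro u
    have := mul_nonneg hA0.le (hb0 u); linarith
  · intro u n
    simp only [hFper]
    have : A₀ * (F u + n * I) = A₀ * F u + n * (A₀ * I) := by ring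
    rw [this, hAI]; ring
  · intro u hu
    have : F u = 0 := by
      rcases le_total 0 u with h | h
      · exact hF0 u h (by rwa [abs_of_nonneg h] at hu)
      · have := hF0 (-u) (by linarith) (by rwa [abs_of_nonpos h] at hu)
        rw [hFodd] at this; linarith
    simp [this]
  · intro u hu
    rw [abs_le] at hu
    have h1 := hFmono hu.1
    have h2 := hFmono hu.2
    rw [hFodd, hFpi] at h1
    rw [hFpi] at h2
    have h3 := mul_le_mul_of_nonneg_left h1 hA0.le
    have h4 := mul_le_mul_of_nonneg_left h2 hA0.le
    have h5 := mul_le_mul_of_nonneg_left hu.1 hε.le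
    have h6 := mul_le_mul_of_nonneg_left hu.2 hε.le
    have h7 : A₀ * (I / 2) = (1 - ε) * Real.pi := by linarith
    have h8 : A₀ * (-(I / 2)) = - ((1 - ε) * Real.pi) := by linarith
    rw [abs_le]
    constructor <;> linarith
end HS

namespace HS

theorem PP_translate {β : E2 → E2} {t : E2} (ht : ∀ x, β (x + t) = β x) {u : E2} {r : ℝ}
    (h : PP β u r) : PP β (u + t) r := by
  have ht' : ∀ x, β (x - t) = β x := fun x => by
    have := ht (x - t); rw [sub_add_cancel] at this; exact this.symm
  refine ⟨fun x y hx hy => ?_, fun η h0 h1 w hw => ?_⟩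
  · have := h.1 (x - t) (y - t) (by rwa [sub_sub, add_comm t u]) (by rwa [sub_sub, add_comm t u])
    rwa [ht', ht', sub_sub_sub_cancel_right] at this
  · rw [ht] at hw
    obtain ⟨x, hx, hxw⟩ := h.2 η h0 h1 w hw
    exact ⟨x + t, by rwa [add_sub_add_right_eq_sub], by rw [ht, hxw]⟩

theorem e2_norm_le {z : E2} {r : ℝ} : ‖z‖ ≤ r ↔ |z.1| ≤ r ∧ |z.2| ≤ r := by
  rw [Prod.norm_def, max_le_iff]; rfl

theorem e2_norm_lt {z : E2} {r : ℝ} : ‖z‖ < r ↔ |z.1| < r ∧ |z.2| < r := by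
  rw [Prod.norm_def, max_lt_iff]; rfl

theorem e2_le_norm {z : E2} {r : ℝ} : r ≤ ‖z‖ ↔ r ≤ |z.1| ∨ r ≤ |z.2| := by
  rw [Prod.norm_def, le_max_iff]; rfl

/-- puncture lattice -/
def lat : Set E2 := {c | ∃ m n : ℤ, c = (Real.pi + m * (2 * Real.pi), Real.pi + n * (2 * Real.pi))}

theorem lat_sep : ∀ c ∈ lat, ∀ c' ∈ lat, c ≠ c' → 6 ≤ ‖c - c'‖ := by
  have hpi := Real.pi_gt_three
  have key : ∀ m m' : ℤ, m ≠ m' → 6 ≤ |Real.pi + m * (2 * Real.pi) - (Real.pi + m' * (2 * Real.pi))| := by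
    intro m m' h
    have h1 : (1:ℝ) ≤ |((m - m' : ℤ) : ℝ)| := by
      rw [← Int.cast_abs]; exact_mod_cast Int.one_le_abs (sub_ne_zero.2 h)
    have : Real.pi + m * (2 * Real.pi) - (Real.pi + m' * (2 * Real.pi)) = ((m - m' : ℤ) : ℝ) * (2 * Real.pi) := by
      push_cast; ring
    rw [this, abs_mul, abs_of_pos (by positivity : 0 < 2 * Real.pi)]
    nlinarith
  rintro c ⟨m, n, rfl⟩ c' ⟨m', n', rfl⟩ h
  rw [e2_le_norm]
  by_cases hm : m = m'
  · right
    refine key n n' ?_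
    rintro rfl; exact h (by rw [hm])
  · left; exact key m m' hm

theorem lat_far {c : E2} (hc : c ∈ lat) : 3 ≤ |c.1| := by
  have hpi := Real.pi_gt_three
  obtain ⟨m, n, rfl⟩ := hc
  have h1 : (1:ℝ) ≤ |((1 + 2 * m : ℤ) : ℝ)| := by
    rw [← Int.cast_abs]; exact_mod_cast Int.one_le_abs (by omega)
  have : Real.pi + m * (2 * Real.pi) = ((1 + 2 * m : ℤ) : ℝ) * Real.pi := by push_cast; ring
  simp only
  rw [this, abs_mul, abs_of_pos (by positivity : 0 < Real.pi)]
  nlinarith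

theorem lat_trans {c : E2} (hc : c ∈ lat) (m n : ℤ) :
    c + ((m * (2 * Real.pi), n * (2 * Real.pi)) : E2) ∈ lat := by
  obtain ⟨a, b, rfl⟩ := hc
  refine ⟨a + m, b + n, ?_⟩
  ext <;> simp <;> ring

theorem lat_good {u : E2} {σ : ℝ} (hσ : 0 < σ) (h1 : |u.1| ≤ Real.pi) (h2 : |u.2| ≤ Real.pi)
    (h : ∀ c ∈ lat, σ ≤ ‖u - c‖) : |u.1| ≤ Real.pi - σ ∨ |u.2| ≤ Real.pi - σ := by
  by_contra hc
  push Not at hc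
  have key : ∀ x : ℝ, |x| ≤ Real.pi → Real.pi - σ < |x| →
      ∃ m : ℤ, |x - (Real.pi + m * (2 * Real.pi))| < σ := by
    intro x hx hx'
    rcases le_total 0 x with h | h
    · refine ⟨0, ?_⟩
      rw [abs_of_nonneg h] at hx hx'
      rw [abs_lt]; push_cast; constructor <;> linarith
    · refine ⟨-1, ?_⟩
      rw [abs_of_nonpos h] at hx hx'
      rw [abs_lt]; push_cast; constructor <;> linarith
  obtain ⟨m, hm⟩ := key _ h1 hc.1
  obtain ⟨n, hn⟩ := key _ h2 hc.2
  have := h _ ⟨m, n, rfl⟩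
  have h3 : ‖u - (Real.pi + m * (2 * Real.pi), Real.pi + n * (2 * Real.pi))‖ < σ :=
    e2_norm_lt.2 ⟨hm, hn⟩
  linarith

theorem red_pi (x : ℝ) : ∃ n : ℤ, |x - n * (2 * Real.pi)| ≤ Real.pi := by
  have hpi := Real.pi_pos
  refine ⟨round (x / (2 * Real.pi)), ?_⟩
  have h := abs_sub_round (x / (2 * Real.pi))
  have : x - (round (x / (2 * Real.pi)) : ℝ) * (2 * Real.pi)
      = (x / (2 * Real.pi) - round (x / (2 * Real.pi))) * (2 * Real.pi) := by
    field_simp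
  rw [this, abs_mul, abs_of_pos (by positivity : 0 < 2 * Real.pi)]
  nlinarith

/-- the immersed punctured torus with large flat part -/
theorem exists_beta {w : ℝ} (hw : ∀ z : E2, |z.1| ≤ Real.pi → |z.2| ≤ Real.pi →
    (|z.1| ≤ w ∨ |z.2| ≤ w) → Jac z ≠ 0) {ε σ : ℝ} (hε : 0 < ε) (hε1 : ε < 1) (hεw : 4 * ε ≤ w)
    (hσ : 0 < σ) (hσ1 : σ < 1) :
    ∃ (β : E2 → E2) (r : ℝ), Continuous β ∧ 0 < r ∧ (∀ u, (∀ c ∈ lat, σ ≤ ‖u - c‖) → PP β u r) ∧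
      (∀ u, ‖β u‖ ≤ 6) ∧ ∀ u, ‖u‖ ≤ 2 → β u = al (ε • u) := by
  obtain ⟨k, m, hk, hm, hper, hlin, hpi⟩ := exists_k hε hε1 hσ hσ1
  have h3 := Real.pi_gt_three
  have h4 := Real.pi_lt_four
  have hkc : Continuous k := continuous_iff_continuousAt.2 fun u => (hk u).hasDerivAt.continuousAt
  set β : E2 → E2 := fun u => al (k u.1, k u.2) with hβ
  have hβper : ∀ (m n : ℤ) (u : E2), β (u + ((m * (2 * Real.pi), n * (2 * Real.pi)) : E2)) = β u := by
    intro m n u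
    have := al_period (k u.1, k u.2) m n
    simp only [hβ, Prod.fst_add, Prod.snd_add, hper]
    exact this
  have hw' : ∀ x, |x| ≤ Real.pi - σ → |k x| ≤ w := by
    intro x hx
    rw [hlin x hx, abs_mul, abs_of_pos hε]
    nlinarith [abs_nonneg x]
  set Q : Set E2 := {u | (|u.1| ≤ Real.pi ∧ |u.2| ≤ Real.pi) ∧ (|u.1| ≤ Real.pi - σ ∨ |u.2| ≤ Real.pi - σ)} with hQ
  have hQc : IsCompact Q := by
    refine Metric.isCompact_of_isClosed_isBounded ?_ ?_
    · have c1 : ∀ t : ℝ, IsClosed {u : E2 | |u.1| ≤ t} := fun t =>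
        isClosed_le (by fun_prop) (by fun_prop)
      have c2 : ∀ t : ℝ, IsClosed {u : E2 | |u.2| ≤ t} := fun t =>
        isClosed_le (by fun_prop) (by fun_prop)
      exact ((c1 _).inter (c2 _)).inter ((c1 _).union (c2 _))
    · refine (Metric.isBounded_closedBall (x := (0:E2)) (r := 4)).subset ?_
      intro u hu
      rw [mem_closedBall_zero_iff, e2_norm_le]
      exact ⟨by linarith [hu.1.1], by linarith [hu.1.2]⟩
  obtain ⟨r, hr, hPP⟩ := compact_unif hQc (PP β) (fun u r r' h hp => PP_mono h hp) (by
    intro u hu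
    have hJ := hw (k u.1, k u.2) (hpi _ hu.1.1) (hpi _ hu.1.2) (hu.2.imp (hw' _) (hw' _))
    have hX : HasStrictFDerivAt (fun z : E2 => k z.1) (m u.1 • ContinuousLinearMap.fst ℝ ℝ ℝ) u :=
      (hk u.1).comp_hasStrictFDerivAt u hasStrictFDerivAt_fst
    have hY : HasStrictFDerivAt (fun z : E2 => k z.2) (m u.2 • ContinuousLinearMap.snd ℝ ℝ ℝ) u :=
      (hk u.2).comp_hasStrictFDerivAt u hasStrictFDerivAt_snd
    have hd := al_strict hX hY
    have hm1 := hm u.1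
    have hm2 := hm u.2
    obtain ⟨f, hf⟩ := mat_equiv (a := Ax (k u.1) (k u.2) * m u.1) (b := Ay (k u.1) (k u.2) * m u.2)
      (c := Bx (k u.1) (k u.2) * m u.1) (d := By (k u.1) (k u.2) * m u.2) (by
        have : Ax (k u.1) (k u.2) * m u.1 * (By (k u.1) (k u.2) * m u.2)
          - Ay (k u.1) (k u.2) * m u.2 * (Bx (k u.1) (k u.2) * m u.1)
          = Jac (k u.1, k u.2) * (m u.1 * m u.2) := by simp only [Jac]; ring
        rw [this]; exact mul_ne_zero hJ (by positivity))
    rw [← hf] at hd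
    exact PP_of_strict hd)
  refine ⟨β, r, al_cont.comp (by fun_prop), hr, ?_, fun u => al_bound _, ?_⟩
  · intro u hu
    obtain ⟨a, ha⟩ := red_pi u.1
    obtain ⟨b, hb⟩ := red_pi u.2
    set t : E2 := (a * (2 * Real.pi), b * (2 * Real.pi)) with ht
    have e : u = (u - t) + t := by abel
    rw [e]
    refine PP_translate (hβper a b) (hPP _ ⟨⟨ha, hb⟩, lat_good hσ ha hb fun c hc => ?_⟩)
    have := hu _ (lat_trans hc a b)
    rwa [sub_sub, add_comm t c]
  · intro u hu
    rw [e2_norm_le] at hu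
    simp only [hβ]
    rw [hlin _ (by linarith [hu.1]), hlin _ (by linarith [hu.2])]
    rfl

theorem torus_T2 : ∃ ε : ℝ, 0 < ε ∧ ε ≤ 1/3 ∧ ∀ s : ℝ, 0 < s → ∃ δ > 0,
    ∀ a : OpenPartialHomeomorph E2 E2, NI a {z | ‖z‖ ≤ 6} δ →
    ∃ ψ : E2 ≃ₜ E2, (∀ z, 1 ≤ ‖z‖ → ψ z = z) ∧ (∀ z, ‖z‖ ≤ 2/5 * ε → ψ z = a z) ∧
      ∀ z, ‖ψ z - z‖ ≤ s := by
  obtain ⟨w, hw0, hw⟩ := Jac_near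
  obtain ⟨w0, hw00, hA⟩ := al_approx
  set ε := min (w/4) (min (w0/6) (1/3)) with hε
  have hε0 : 0 < ε := by positivity
  have hε1 : ε ≤ w/4 := min_le_left _ _
  have hε2 : ε ≤ w0/6 := (min_le_right _ _).trans (min_le_left _ _)
  have hε3 : ε ≤ 1/3 := (min_le_right _ _).trans (min_le_right _ _)
  refine ⟨ε, hε0, hε3, fun s0 hs0 => ?_⟩
  set s := min (1/2) (s0/30) with hs
  have hs1 : 0 < s := by positivity
  have hs2 : s ≤ 1/2 := min_le_left _ _
  have hs3 : s ≤ s0/30 := min_le_right _ _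
  obtain ⟨β, r, hβc, hr, hPP, hβ6, hβl⟩ := exists_beta hw hε0 (by linarith) (by linarith)
    (σ := s/2) (by linarith) (by linarith)
  obtain ⟨δ, hδ, hlift⟩ := lift_fill β hβc lat ⟨_, 0, 0, rfl⟩ hs1
    (fun c hc c' hc' h => by have := lat_sep c hc c' hc' h; linarith) hr hPP hβ6
  refine ⟨δ, hδ, fun a ha => ?_⟩
  obtain ⟨G, hG1, hG2⟩ := hlift a ha
  obtain ⟨f, hf1, hf2, hf3⟩ := squeeze G hG1
  -- scaled map
  have hAl : ∀ x ∈ Metric.ball (0:E2) w0, ∀ y ∈ Metric.ball (0:E2) w0,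
      ‖al x - al y - (x - y)‖ ≤ 1/2 * ‖x - y‖ := by
    intro x hx y hy
    have := hA x hx y hy
    simpa using this
  have hA' : ApproximatesLinearOn al ((ContinuousLinearEquiv.refl ℝ E2 : E2 ≃L[ℝ] E2) : E2 →L[ℝ] E2)
    (Metric.ball 0 w0) (1/2) := hA
  have hN1 : ‖((ContinuousLinearEquiv.refl ℝ E2).symm : E2 →L[ℝ] E2)‖₊ = 1 := by
    have : ((ContinuousLinearEquiv.refl ℝ E2).symm : E2 →L[ℝ] E2) = ContinuousLinearMap.id ℝ E2 := rfl
    rw [this]; exact ContinuousLinearMap.nnnorm_id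
  set e := hA'.toOpenPartialHomeomorph al (Metric.ball 0 w0) (Or.inr (by
    rw [hN1, inv_one, ← NNReal.coe_lt_coe]; norm_num)) Metric.isOpen_ball with he
  have hes : e.source = Metric.ball 0 w0 := rfl
  have hea : ∀ z, e z = al z := fun z => rfl
  set A := aff (0:E2) ε hε0 with hAff
  set ρ : E2 ≃ₜ E2 := (A.symm.trans f).trans A with hρ
  have hρa : ∀ z, ρ z = ε • f (ε⁻¹ • z) := by
    intro z
    simp [hρ, hAff, aff_apply, aff_symm_apply]
  have hnorm : ∀ z : E2, ‖ε⁻¹ • z‖ = ε⁻¹ * ‖z‖ := fun z => by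
    rw [norm_smul, Real.norm_eq_abs, abs_of_pos (by positivity)]
  have hρ1 : ∀ z, z ∉ Metric.closedBall (0:E2) (2 * ε) → ρ z = z := by
    intro z hz
    rw [mem_closedBall_zero_iff, not_le] at hz
    rw [hρa, hf1, smul_inv_smul₀ hε0.ne']
    rw [hnorm, le_inv_mul_iff₀ hε0]; linarith
  have hρ2 : ∀ z, ‖ρ z - z‖ ≤ ε * (20 * s) := by
    intro z
    have : ρ z - z = ε • (f (ε⁻¹ • z) - ε⁻¹ • z) := by
      rw [hρa, smul_sub, smul_inv_smul₀ hε0.ne']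
    rw [this, norm_smul, Real.norm_eq_abs, abs_of_pos hε0]
    exact mul_le_mul_of_nonneg_left ((hf3 _).trans (by linarith)) hε0.le
  have hKs : Metric.closedBall (0:E2) (2 * ε) ⊆ e.source := by
    rw [hes]; exact Metric.closedBall_subset_ball (by linarith)
  obtain ⟨ψ, hψ1, -, hψ2⟩ := ext_homeo e (isCompact_closedBall (0:E2) (2 * ε)) hKs ρ hρ1
  have hsmall : ∀ z : E2, ‖z‖ ≤ 2 * ε → ‖al z‖ ≤ 3 * ε := by
    intro z hz
    have h1 := hAl z (by rw [mem_ball_zero_iff]; linarith) 0 (by simpa using hw00)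
    rw [al_zero] at h1; simp only [sub_zero] at h1
    have := (near_norm h1).1
    linarith
  refine ⟨ψ, ?_, ?_, ?_⟩
  · intro z hz
    by_cases h : z ∈ e '' Metric.closedBall (0:E2) (2 * ε)
    · obtain ⟨x, hx, rfl⟩ := h
      have h1 : ‖x‖ ≤ 2 * ε := by simpa using hx
      by_cases h2 : ‖x‖ = 2 * ε
      · rw [hψ1 x (hKs hx)]
        congr 1
        rw [hρa, hf1, smul_inv_smul₀ hε0.ne']
        rw [hnorm, le_inv_mul_iff₀ hε0]; linarith
      · have h3 : ‖x‖ < 2 * ε := lt_of_le_of_ne h1 h2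
        have h4 := hAl x (by rw [mem_ball_zero_iff]; linarith) 0 (by simpa using hw00)
        rw [al_zero] at h4; simp only [sub_zero] at h4
        have := (near_norm h4).1
        rw [hea] at hz
        linarith
    · exact hψ2 z h
  · intro z hz
    have hsur := hA'.surjOn_closedBall_of_nonlinearRightInverse
      (ContinuousLinearEquiv.refl ℝ E2).toNonlinearRightInverse (ε := 4/5 * ε) (by positivity) (b := 0)
      (Metric.closedBall_subset_ball (by linarith))
    obtain ⟨x, hx, hxz⟩ := hsur (a := z) (by
      rw [al_zero, mem_closedBall_zero_iff]
      have : ((ContinuousLinearEquiv.refl ℝ E2).toNonlinearRightInverse.nnnorm : ℝ) = 1 := by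
        have : (ContinuousLinearEquiv.refl ℝ E2).toNonlinearRightInverse.nnnorm = 1 := hN1
        rw [this]; rfl
      rw [this]; push_cast
      linarith)
    have hx' : ‖x‖ ≤ 4/5 * ε := by simpa using hx
    rw [← hxz]
    have h1 := hψ1 x (by rw [hes, mem_ball_zero_iff]; linarith)
    rw [hea, hea] at h1
    rw [h1]
    set u := ε⁻¹ • x with hu
    have hxu : x = ε • u := by rw [hu, smul_inv_smul₀ hε0.ne']
    have hun : ‖u‖ ≤ 4/5 := by
      rw [hu, hnorm, inv_mul_le_iff₀ hε0]; linarith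
    obtain ⟨g1, g2⟩ := hG2 u (fun c hc => by
      have h3 := lat_far hc
      have h4 := (e2_norm_le.1 hun).1
      have h5 : |c.1| ≤ |u.1 - c.1| + |u.1| := by
        have := abs_sub (u.1) (u.1 - c.1)
        rw [sub_sub_cancel] at this; linarith
      have h6 : |u.1 - c.1| ≤ ‖u - c‖ := (e2_norm_le (z := u - c).1 le_rfl).1
      linarith)
    have hGn : ‖G u‖ ≤ 1 := by
      have := (near_norm g2).1; linarith
    rw [hρa, ← hu, hf2 u (by linarith) hGn, ← hβl (G u) (by linarith), g1, hβl u (by linarith), ← hxu]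
  · intro z
    by_cases h : z ∈ e '' Metric.closedBall (0:E2) (2 * ε)
    · obtain ⟨x, hx, rfl⟩ := h
      have h1 : ‖x‖ ≤ 2 * ε := by simpa using hx
      have hρx : ρ x ∈ Metric.closedBall (0:E2) (2 * ε) := maps_supp hρ1 hx
      rw [hψ1 x (hKs hx), hea, hea]
      have h4 := hAl (ρ x) (by have := hKs hρx; rwa [hes] at this) x (by have := hKs hx; rwa [hes] at this)
      have h5 := (near_norm h4).1
      have h6 := hρ2 x
      have h7 : ε * (20 * s) ≤ 1/3 * (20 * s) := mul_le_mul_of_nonneg_right hε3 (by positivity)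
      linarith
    · rw [hψ2 z h]; simpa using hs0.le
end HS

namespace HS

theorem supp_uc {V : Type*} [NormedAddCommGroup V] [ProperSpace V] (φ : V ≃ₜ V) {R : ℝ}
    (h : ∀ z, R ≤ ‖z‖ → φ z = z) {ε : ℝ} (hε : 0 < ε) :
    ∃ δ > 0, ∀ x y, ‖x - y‖ ≤ δ → ‖φ x - φ y‖ ≤ ε := by
  have hc : Continuous fun z => φ z - z := φ.continuous.sub continuous_id
  have hs : HasCompactSupport fun z => φ z - z := by
    refine HasCompactSupport.intro (isCompact_closedBall (0:V) R) fun z hz => ?_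
    rw [mem_closedBall_zero_iff, not_le] at hz
    rw [h z hz.le, sub_self]
  have hu : UniformContinuous fun z => φ z - z :=
    hc.uniformContinuous_of_tendsto_cocompact (x := 0)
      (by simpa using hs.is_zero_at_infty)
  obtain ⟨δ, hδ, hd⟩ := Metric.uniformContinuous_iff.1 hu (ε/2) (by positivity)
  refine ⟨min (δ/2) (ε/2), by positivity, fun x y hxy => ?_⟩
  have h1 := hd (a := x) (b := y) (by
    rw [dist_eq_norm]; have := min_le_left (δ/2) (ε/2); linarith)
  rw [dist_eq_norm] at h1
  have h2 := min_le_right (δ/2) (ε/2)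
  have : φ x - φ y = (φ x - x - (φ y - y)) + (x - y) := by abel
  rw [this]
  refine (norm_add_le _ _).trans ?_
  linarith

theorem H0_aux {s : ℝ} (hs : 0 < s) : ∃ δ > 0, ∀ a : OpenPartialHomeomorph E2 E2,
    NI a {z | ‖z‖ ≤ 1} δ → ∃ f : E2 ≃ₜ E2, (∀ z, 1 ≤ ‖z‖ → f z = z) ∧
      (∀ z, ‖z‖ ≤ 0.97 → f z = a z) ∧ ∀ z, ‖f z - z‖ ≤ s := by
  obtain ⟨ε, hε0, hε1, hT⟩ := torus_T2
  obtain ⟨φ, hφ1, hφ2⟩ := exists_scale (V := E2) (c := ε/15/0.97) (x := 0.97) (R := 1)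
    (by positivity) (by norm_num) (by norm_num) (by
      have : ε / 15 / 0.97 * 0.97 = ε / 15 := by ring
      rw [this]; linarith)
  set χ : E2 ≃ₜ E2 := φ.trans (aff 0 6 (by norm_num)) with hχ
  have hχa : ∀ z, χ z = (6:ℝ) • φ z := fun z => by simp [hχ, aff_apply]
  have hφs : ∀ z, 1 ≤ ‖z‖ → φ.symm z = z := fun z hz => by
    rw [Homeomorph.symm_apply_eq, hφ2 z hz]
  have hφn : ∀ z, ‖z‖ ≤ 1 → ‖φ z‖ ≤ 1 := by
    intro z hz
    by_contra hcon
    push Not at hcon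
    have h1 := hφ2 _ hcon.le
    have := φ.injective h1
    rw [this] at hcon; linarith
  have hφn' : ∀ z, ‖z‖ ≤ 1 → ‖φ.symm z‖ ≤ 1 := by
    intro z hz
    by_contra hcon
    push Not at hcon
    have h1 := hφ2 _ hcon.le
    rw [φ.apply_symm_apply] at h1
    rw [← h1] at hcon; linarith
  obtain ⟨t, ht0, ht⟩ := supp_uc φ.symm hφs hs
  obtain ⟨δ, hδ, hT⟩ := hT (6 * t) (by positivity)
  obtain ⟨δ', hδ', hd⟩ := supp_uc φ hφ2 (show 0 < δ/6 by positivity)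
  refine ⟨δ', hδ', fun a ha => ?_⟩
  have hχs : ∀ z, χ.symm z = φ.symm ((6:ℝ)⁻¹ • z) := fun z => by
    rw [Homeomorph.symm_apply_eq, hχa, φ.apply_symm_apply, smul_inv_smul₀ (by norm_num)]
  have n6 : ∀ z : E2, ‖(6:ℝ)⁻¹ • z‖ = ‖z‖ / 6 := fun z => by
    rw [norm_smul]; norm_num; ring
  have hm : ∀ x y, ‖x - y‖ ≤ δ' → ‖χ x - χ y‖ ≤ δ := by
    intro x y h
    rw [hχa, hχa, ← smul_sub, norm_smul]
    have := hd x y h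
    norm_num; linarith
  obtain ⟨ψ, hψ1, hψ2, hψ3⟩ := hT ((χ.symm.transOpenPartialHomeomorph a).transHomeomorph χ) (by
    intro z hz
    have hz' : ‖z‖ ≤ 6 := hz
    have h1 : ‖χ.symm z‖ ≤ 1 := by
      rw [hχs]; refine hφn' _ ?_
      rw [n6]; linarith
    obtain ⟨k1, k2, k3, k4⟩ := ha (χ.symm z) h1
    refine ⟨k1, k2, ?_, ?_⟩
    · have := hm _ _ k3
      rw [χ.apply_symm_apply] at this; exact this
    · have := hm _ _ k4
      rw [χ.apply_symm_apply] at this; exact this)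
  have hχ1 : ∀ z, 1 ≤ ‖z‖ → 1 ≤ ‖χ z‖ := by
    intro z hz
    rw [hχa, hφ2 z hz, norm_smul]; norm_num; linarith
  refine ⟨(χ.trans ψ).trans χ.symm, ?_, ?_, ?_⟩
  · intro z hz
    show χ.symm (ψ (χ z)) = z
    rw [hψ1 _ (hχ1 z hz), χ.symm_apply_apply]
  · intro z hz
    show χ.symm (ψ (χ z)) = a z
    rw [hψ2]
    · show χ.symm (χ (a (χ.symm (χ z)))) = a z
      rw [χ.symm_apply_apply, χ.symm_apply_apply]
    · rw [hχa, hφ1 z hz, smul_smul, norm_smul, Real.norm_of_nonneg (by positivity)]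
      calc 6 * (ε / 15 / 0.97) * ‖z‖ ≤ 6 * (ε / 15 / 0.97) * 0.97 :=
            mul_le_mul_of_nonneg_left hz (by positivity)
        _ = 2/5 * ε := by ring
  · intro z
    show ‖χ.symm (ψ (χ z)) - z‖ ≤ s
    have h1 := hψ3 (χ z)
    have h2 : χ.symm (ψ (χ z)) - z = φ.symm ((6:ℝ)⁻¹ • ψ (χ z)) - φ.symm ((6:ℝ)⁻¹ • χ z) := by
      rw [← hχs, ← hχs, χ.symm_apply_apply]
    rw [h2]
    refine ht _ _ ?_
    rw [← smul_sub, n6]; linarith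

/-- local straightening in a square, scaled -/
theorem H0 {s : ℝ} (hs : 0 < s) : ∃ δ > 0, ∀ (a : OpenPartialHomeomorph E2 E2) (p : E2),
    NI a {z | ‖z - p‖ ≤ 1/2} δ → ∃ f : E2 ≃ₜ E2, (∀ z, 1/2 ≤ ‖z - p‖ → f z = z) ∧
      (∀ z, ‖z - p‖ ≤ 0.485 → f z = a z) ∧ (∀ z, ‖f z - z‖ ≤ s) ∧
      ((∀ z, ‖z - p‖ ≤ 1/2 → a z = z) → ∀ z, f z = z) := by
  obtain ⟨δ, hδ, h⟩ := H0_aux (s := 2 * s) (by positivity)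
  refine ⟨1/2 * δ, by positivity, fun a p ha => ?_⟩
  by_cases hid : ∀ z, ‖z - p‖ ≤ 1/2 → a z = z
  · exact ⟨Homeomorph.refl _, fun _ _ => rfl, fun z hz => (hid z (by linarith)).symm,
      fun z => by simpa using hs.le, fun _ _ => rfl⟩
  have h12 : (0:ℝ) < 1/2 := by norm_num
  obtain ⟨f, hf1, hf2, hf3⟩ := h (conjA a p (1/2) h12) (conjA_NI a p _ h12 _ _ _ ha (by
    intro z hz
    have hz' : ‖z‖ ≤ 1 := hz
    show ‖p + (1/2 : ℝ) • z - p‖ ≤ 1/2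
    rw [add_sub_cancel_left, norm_smul]; norm_num; linarith))
  set A := aff p (1/2) h12 with hA
  have hn : ∀ z, ‖A.symm z‖ = 2 * ‖z - p‖ := by
    intro z
    rw [hA, aff_symm_apply, norm_smul]; norm_num
  refine ⟨(A.symm.trans f).trans A, ?_, ?_, ?_, fun h => absurd h hid⟩
  · intro z hz
    show A (f (A.symm z)) = z
    rw [hf1 _ (by rw [hn]; linarith), A.apply_symm_apply]
  · intro z hz
    show A (f (A.symm z)) = a z
    rw [hf2 _ (by rw [hn]; linarith)]
    show A (A.symm (a (A (A.symm z)))) = a z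
    rw [A.apply_symm_apply, A.apply_symm_apply]
  · intro z
    show ‖A (f (A.symm z)) - z‖ ≤ s
    have h1 := hf3 (A.symm z)
    have h2 : A (f (A.symm z)) - z = (1/2 : ℝ) • (f (A.symm z) - A.symm z) := by
      conv_lhs => rw [← A.apply_symm_apply z]
      rw [A.symm_apply_apply]
      rw [hA, aff_apply, aff_apply, smul_sub, add_sub_add_left_eq_sub]
    rw [h2, norm_smul]; norm_num; linarith

/-- coordinates along a direction -/
def lo (d : Bool) (z : E2) : ℝ := if d then z.1 else z.2
def tr (d : Bool) (z : E2) : ℝ := if d then z.2 else z.1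
def mk (d : Bool) (x y : ℝ) : E2 := if d then (x, y) else (y, x)

@[simp] theorem lo_mk (d : Bool) (x y : ℝ) : lo d (mk d x y) = x := by cases d <;> rfl
@[simp] theorem tr_mk (d : Bool) (x y : ℝ) : tr d (mk d x y) = y := by cases d <;> rfl
theorem lo_sub (d : Bool) (x y : E2) : lo d (x - y) = lo d x - lo d y := by cases d <;> rfl
theorem tr_sub (d : Bool) (x y : E2) : tr d (x - y) = tr d x - tr d y := by cases d <;> rfl
theorem lo_add (d : Bool) (x y : E2) : lo d (x + y) = lo d x + lo d y := by cases d <;> rfl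
theorem tr_add (d : Bool) (x y : E2) : tr d (x + y) = tr d x + tr d y := by cases d <;> rfl
theorem lo_smul (d : Bool) (c : ℝ) (y : E2) : lo d (c • y) = c * lo d y := by cases d <;> rfl
theorem tr_smul (d : Bool) (c : ℝ) (y : E2) : tr d (c • y) = c * tr d y := by cases d <;> rfl
theorem lo_cont (d : Bool) : Continuous (lo d) := by
  cases d
  · exact continuous_snd
  · exact continuous_fst
theorem tr_cont (d : Bool) : Continuous (tr d) := by
  cases d
  · exact continuous_fst
  · exact continuous_snd
theorem lt_norm_le (d : Bool) {z : E2} {r : ℝ} : ‖z‖ ≤ r ↔ |lo d z| ≤ r ∧ |tr d z| ≤ r := by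
  cases d
  · rw [e2_norm_le, and_comm]; rfl
  · exact e2_norm_le
theorem lt_le_norm (d : Bool) {z : E2} {r : ℝ} : r ≤ ‖z‖ ↔ r ≤ |lo d z| ∨ r ≤ |tr d z| := by
  cases d
  · rw [e2_le_norm, or_comm]; rfl
  · exact e2_le_norm

open Classical in
theorem H1_data (d : Bool) (a : OpenPartialHomeomorph E2 E2) (ha : NI a {z | ‖z‖ ≤ 10} (6/1000))
    (hid : ∀ z, ‖z‖ ≤ 10 → 1/2 ≤ |tr d z| → a z = z) :
    ∃ g : OpenPartialHomeomorph E2 E2, NI g {z | ∀ c ∈ ({mk d 7 0, mk d (-7) 0} : Set E2), 6/10 ≤ ‖z - c‖} (6/1000) ∧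
      ∀ z, g z = if |lo d z| ≤ 7 ∧ |tr d z| ≤ 5 then a z else z := by
  have hid' : ∀ z, ‖z‖ ≤ 10 → 1/2 ≤ |tr d z| → a.symm z = z := by
    intro z h1 h2
    have := a.left_inv (ha z h1).1
    rwa [hid z h1 h2] at this
  set S : Set E2 := {z | ∀ c ∈ ({mk d 7 0, mk d (-7) 0} : Set E2), 55/100 < ‖z - c‖} with hS
  have hSo : IsOpen S := by
    have : S = {z | 55/100 < ‖z - mk d 7 0‖} ∩ {z | 55/100 < ‖z - mk d (-7) 0‖} := by
      ext z; simp [hS]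
    rw [this]
    exact (isOpen_lt continuous_const (by fun_prop)).inter (isOpen_lt continuous_const (by fun_prop))
  have hS1 : ∀ z ∈ S, |lo d z| ≤ 6.45 ∨ 7.55 ≤ |lo d z| ∨ 0.55 < |tr d z| := by
    intro z hz
    by_contra hcon
    push Not at hcon
    obtain ⟨h1, h2, h3⟩ := hcon
    rcases le_total 0 (lo d z) with h | h
    · have := hz (mk d 7 0) (by simp)
      rw [← not_le, lt_norm_le d, lo_sub, tr_sub, lo_mk, tr_mk] at this
      rw [abs_of_nonneg h] at h1 h2
      refine this ⟨by rw [abs_le]; constructor <;> linarith, by rw [sub_zero]; linarith⟩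
    · have := hz (mk d (-7) 0) (by simp)
      rw [← not_le, lt_norm_le d, lo_sub, tr_sub, lo_mk, tr_mk] at this
      rw [abs_of_nonpos h] at h1 h2
      refine this ⟨by rw [abs_le]; constructor <;> linarith, by rw [sub_zero]; linarith⟩
  have h10 : ∀ z, |lo d z| ≤ 7 → |tr d z| ≤ 5 → ‖z‖ ≤ 10 := fun z h1 h2 =>
    (lt_norm_le d).2 ⟨by linarith, by linarith⟩
  set O1 : Set E2 := {z | |lo d z| < 7 ∧ |tr d z| < 5} with hO1
  have hO1o : IsOpen O1 := (isOpen_lt (lo_cont d).abs continuous_const).inter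
    (isOpen_lt (tr_cont d).abs continuous_const)
  set O2 : Set E2 := {z | 6.45 < |lo d z| ∨ 0.55 < |tr d z|} with hO2
  have hO2o : IsOpen O2 := (isOpen_lt continuous_const (lo_cont d).abs).union
    (isOpen_lt continuous_const (tr_cont d).abs)
  have hgen : ∀ b : E2 → E2, (∀ z, ‖z‖ ≤ 10 → ContinuousAt b z) →
      (∀ z, ‖z‖ ≤ 10 → 1/2 ≤ |tr d z| → b z = z) →
      ContinuousOn (fun z => if |lo d z| ≤ 7 ∧ |tr d z| ≤ 5 then b z else z) S := by
    intro b hb hbid z hz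
    refine ContinuousAt.continuousWithinAt ?_
    by_cases h1 : z ∈ O1
    · refine (hb z (h10 z h1.1.le h1.2.le)).congr ?_
      filter_upwards [hO1o.mem_nhds h1] with y hy
      rw [if_pos ⟨hy.1.le, hy.2.le⟩]
    · have h2 : z ∈ O2 := by
        by_contra h2
        rw [hO2, Set.mem_ofPred_eq, not_or, not_lt, not_lt] at h2
        exact h1 ⟨by linarith [h2.1], by linarith [h2.2]⟩
      refine continuousAt_id.congr ?_
      filter_upwards [(hO2o.inter hSo).mem_nhds ⟨h2, hz⟩] with y hy
      split_ifs with h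
      · rw [hbid y (h10 y h.1 h.2)]; · rfl
        rcases hS1 y hy.2 with h3 | h3 | h3
        · rcases hy.1 with h4 | h4 <;> linarith
        · linarith [h.1]
        · linarith
      · rfl
  have hinv : ∀ b b' : E2 → E2, (∀ z, ‖z‖ ≤ 10 → ‖b z - z‖ ≤ 6/1000) →
      (∀ z, ‖z‖ ≤ 10 → 1/2 ≤ |tr d z| → b z = z) →
      (∀ z, ‖z‖ ≤ 10 → b' (b z) = z) → ∀ x ∈ S,
      (fun z => if |lo d z| ≤ 7 ∧ |tr d z| ≤ 5 then b' z else z)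
      ((fun z => if |lo d z| ≤ 7 ∧ |tr d z| ≤ 5 then b z else z) x) = x := by
    intro b b' hb hbid hbb x hx
    simp only
    by_cases h : |lo d x| ≤ 7 ∧ |tr d x| ≤ 5
    · rw [if_pos h]
      have hx10 := h10 x h.1 h.2
      by_cases h2 : 1/2 ≤ |tr d x|
      · have e := hbb x hx10
        rw [hbid x hx10 h2] at e ⊢
        rw [if_pos h, e]
      · have h3 := (lt_norm_le d).1 (hb x hx10)
        rw [lo_sub, tr_sub] at h3
        have h4 : |lo d x| ≤ 6.45 := by
          rcases hS1 x hx with h5 | h5 | h5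
          · exact h5
          · linarith [h.1]
          · linarith
        rw [if_pos, hbb x hx10]
        have e1 := abs_sub_abs_le_abs_sub (lo d (b x)) (lo d x)
        have e2 := abs_sub_abs_le_abs_sub (tr d (b x)) (tr d x)
        constructor <;> linarith [h3.1, h3.2]
    · rw [if_neg h, if_neg h]
  have hdisp : ∀ b : E2 → E2, (∀ z, ‖z‖ ≤ 10 → ‖b z - z‖ ≤ 6/1000) → ∀ z,
      ‖(if |lo d z| ≤ 7 ∧ |tr d z| ≤ 5 then b z else z) - z‖ ≤ 6/1000 := by
    intro b hb z
    split_ifs with h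
    · exact hb z (h10 z h.1 h.2)
    · simp; norm_num
  have hstay : ∀ z w : E2, (∀ c ∈ ({mk d 7 0, mk d (-7) 0} : Set E2), 6/10 ≤ ‖z - c‖) →
      ‖w - z‖ ≤ 6/1000 → w ∈ S := by
    intro z w hz hw c hc
    have h1 := hz c hc
    have : ‖(w - c) - (z - c)‖ ≤ 6/1000 := by rwa [sub_sub_sub_cancel_right]
    have := (near_norm this).2
    linarith
  have a1 : ∀ z, ‖z‖ ≤ 10 → ‖a z - z‖ ≤ 6/1000 := fun z h => (ha z h).2.2.1
  have a2 : ∀ z, ‖z‖ ≤ 10 → ‖a.symm z - z‖ ≤ 6/1000 := fun z h => (ha z h).2.2.2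
  refine ⟨mkOPH (fun z => if |lo d z| ≤ 7 ∧ |tr d z| ≤ 5 then a z else z)
    (fun z => if |lo d z| ≤ 7 ∧ |tr d z| ≤ 5 then a.symm z else z) S S hSo hSo
    (hgen a (fun z h => a.continuousAt (ha z h).1) hid)
    (hgen a.symm (fun z h => a.symm.continuousAt (ha z h).2.1) hid')
    (fun x hx _ => hinv a a.symm a1 hid (fun z h => a.left_inv (ha z h).1) x hx)
    (fun x hx _ => hinv a.symm a a2 hid' (fun z h => a.right_inv (ha z h).2.1) x hx), ?_, fun z => rfl⟩
  intro z hz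
  have k1 := hdisp a a1 z
  have k2 := hdisp a.symm a2 z
  have hzS : z ∈ S := hstay z z hz (by simp; norm_num)
  exact ⟨⟨hzS, hstay z _ hz k1⟩, ⟨hzS, hstay z _ hz k2⟩, k1, k2⟩

theorem H1_aux (d : Bool) (a : OpenPartialHomeomorph E2 E2) (ha : NI a {z | ‖z‖ ≤ 10} (6/1000))
    (hid : ∀ z, ‖z‖ ≤ 10 → 1/2 ≤ |tr d z| → a z = z) :
    ∃ f : E2 ≃ₜ E2, (∀ z, |lo d z| ≤ 5 → ‖z‖ ≤ 10 → f z = a z) ∧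
      (∀ z, 9 ≤ |lo d z| ∨ 2 ≤ |tr d z| → f z = z) ∧ ∀ z, ‖f z - z‖ ≤ 3 := by
  classical
  obtain ⟨g, hg1, hg2⟩ := H1_data d a ha hid
  obtain ⟨G, hG1, hG2⟩ := fill_all g ({mk d 7 0, mk d (-7) 0} : Set E2) (s := 6/10) (by norm_num) (by
    have : (14:ℝ) ≤ ‖mk d 7 0 - mk d (-7) 0‖ := by
      rw [lt_le_norm d, lo_sub, lo_mk, lo_mk]; left; norm_num
    have h2 : (14:ℝ) ≤ ‖mk d (-7) 0 - mk d 7 0‖ := by rwa [norm_sub_rev]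
    intro c hc c' hc' hne
    rcases hc with rfl | rfl <;> rcases hc' with rfl | rfl
    · exact absurd rfl hne
    · linarith
    · linarith
    · exact absurd rfl hne) (by norm_num; norm_num at hg1; exact hg1)
  refine ⟨G, ?_, ?_, fun z => (hG2 z).trans (by norm_num)⟩
  · intro z h1 h2
    have h3 := (lt_norm_le d).1 h2
    rw [hG1, hg2]
    · split_ifs with h
      · rfl
      · rw [hid z h2]
        by_contra hcon
        exact h ⟨by linarith, by linarith⟩
    · rw [abs_le] at h1
      rintro c (rfl | rfl)
      · rw [lt_le_norm d, lo_sub, lo_mk]; left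
        rw [le_abs]; right; linarith
      · rw [lt_le_norm d, lo_sub, lo_mk]; left
        rw [le_abs]; left; linarith
  · intro z hz
    rw [hG1, hg2]
    · split_ifs with h
      · rcases hz with h1 | h1
        · linarith [h.1]
        · exact hid z ((lt_norm_le d).2 ⟨by linarith [h.1], by linarith [h.2]⟩) (by linarith)
      · rfl
    · rcases hz with h1 | h1
      · rw [le_abs] at h1
        rintro c (rfl | rfl)
        · rw [lt_le_norm d, lo_sub, lo_mk]; left
          rw [le_abs]
          rcases h1 with h1 | h1
          · left; linarith
          · right; linarith
        · rw [lt_le_norm d, lo_sub, lo_mk]; left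
          rw [le_abs]
          rcases h1 with h1 | h1
          · left; linarith
          · right; linarith
      · rintro c (rfl | rfl)
        · rw [lt_le_norm d, tr_sub, tr_mk, sub_zero]; right; linarith
        · rw [lt_le_norm d, tr_sub, tr_mk, sub_zero]; right; linarith

/-- edge straightening, scaled -/
theorem H1 (d : Bool) (a : OpenPartialHomeomorph E2 E2) (c : E2)
    (ha : NI a {z | ‖z - c‖ ≤ 0.4} (24/100000))
    (hid : ∀ z, ‖z - c‖ ≤ 0.4 → 0.02 ≤ |tr d (z - c)| → a z = z) :
    ∃ f : E2 ≃ₜ E2, (∀ z, |lo d (z - c)| ≤ 0.2 → ‖z - c‖ ≤ 0.4 → f z = a z) ∧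
      (∀ z, 0.36 ≤ |lo d (z - c)| ∨ 0.08 ≤ |tr d (z - c)| → f z = z) ∧ (∀ z, ‖f z - z‖ ≤ 0.12) ∧
      ((∀ z, ‖z - c‖ ≤ 0.4 → a z = z) → ∀ z, f z = z) := by
  by_cases hid2 : ∀ z, ‖z - c‖ ≤ 0.4 → a z = z
  · exact ⟨Homeomorph.refl _, fun z _ hz => (hid2 z hz).symm, fun _ _ => rfl, 
      fun z => by simp; norm_num, fun _ _ => rfl⟩
  have h4 : (0:ℝ) < 4/100 := by norm_num
  have hn1 : ∀ z : E2, ‖c + (4/100 : ℝ) • z - c‖ = 4/100 * ‖z‖ := by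
    intro z; rw [add_sub_cancel_left, norm_smul]; norm_num
  obtain ⟨f, hf1, hf2, hf3⟩ := H1_aux d (conjA a c (4/100) h4)
    (conjA_NI a c _ h4 {z | ‖z - c‖ ≤ 0.4} _ _ (by norm_num; norm_num at ha; exact ha) (by
      intro z hz
      have hz' : ‖z‖ ≤ 10 := hz
      show ‖c + (4/100 : ℝ) • z - c‖ ≤ 0.4
      rw [hn1]; linarith)) (by
      intro z hz hz2
      rw [conjA_apply, hid]
      · rw [add_sub_cancel_left, inv_smul_smul₀ h4.ne']
      · rw [hn1]; linarith
      · rw [add_sub_cancel_left, tr_smul, abs_mul, abs_of_pos h4]; linarith)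
  set A := aff c (4/100) h4 with hA
  have hAs : ∀ z, z - c = (4/100 : ℝ) • A.symm z := by
    intro z; rw [hA, aff_symm_apply, smul_inv_smul₀ h4.ne']
  have hn : ∀ z, ‖z - c‖ = 4/100 * ‖A.symm z‖ := by
    intro z
    rw [hAs, norm_smul]; norm_num
  have hl : ∀ z, |lo d (z - c)| = 4/100 * |lo d (A.symm z)| := by
    intro z; rw [hAs, lo_smul, abs_mul, abs_of_pos h4]
  have ht : ∀ z, |tr d (z - c)| = 4/100 * |tr d (A.symm z)| := by
    intro z; rw [hAs, tr_smul, abs_mul, abs_of_pos h4]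
  refine ⟨(A.symm.trans f).trans A, ?_, ?_, ?_, fun h => absurd h hid2⟩
  · intro z hz hz2
    rw [hl] at hz
    rw [hn] at hz2
    show A (f (A.symm z)) = a z
    rw [hf1 _ (by linarith) (by linarith)]
    show A (A.symm (a (A (A.symm z)))) = a z
    rw [A.apply_symm_apply, A.apply_symm_apply]
  · intro z hz
    rw [hl, ht] at hz
    show A (f (A.symm z)) = z
    rw [hf2, A.apply_symm_apply]
    exact hz.imp (fun h => by linarith) (fun h => by linarith)
  · intro z
    show ‖A (f (A.symm z)) - z‖ ≤ 0.12
    have h1 := hf3 (A.symm z)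
    have h2 : A (f (A.symm z)) - z = (4/100 : ℝ) • (f (A.symm z) - A.symm z) := by
      conv_lhs => rw [← A.apply_symm_apply z]
      rw [A.symm_apply_apply]
      rw [hA, aff_apply, aff_apply, smul_sub, add_sub_add_left_eq_sub]
    rw [h2, norm_smul]; norm_num; linarith
end HS

namespace HS

def ip (p : ℤ × ℤ) : E2 := ((p.1 : ℝ), (p.2 : ℝ))
noncomputable def ec (q : Bool × ℤ × ℤ) : E2 := ip q.2 + mk q.1 0 (1/2)
noncomputable def vc (p : ℤ × ℤ) : E2 := ip p + (1/2, 1/2)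

theorem ip_fin (R : ℝ) : {p : ℤ × ℤ | ‖ip p‖ ≤ R}.Finite := by
  refine (Set.finite_Icc (-(⌈R⌉, ⌈R⌉) : ℤ × ℤ) (⌈R⌉, ⌈R⌉)).subset ?_
  intro p hp
  have h : |(p.1:ℝ)| ≤ R ∧ |(p.2:ℝ)| ≤ R := e2_norm_le.1 hp
  rw [abs_le, abs_le] at h
  have hc := Int.le_ceil R
  obtain ⟨⟨h1, h2⟩, h3, h4⟩ := h
  refine ⟨⟨?_, ?_⟩, ⟨?_, ?_⟩⟩
  · show -⌈R⌉ ≤ p.1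
    have : -((⌈R⌉:ℤ):ℝ) ≤ p.1 := by linarith
    exact_mod_cast this
  · show -⌈R⌉ ≤ p.2
    have : -((⌈R⌉:ℤ):ℝ) ≤ p.2 := by linarith
    exact_mod_cast this
  · have : (p.1:ℝ) ≤ ((⌈R⌉:ℤ):ℝ) := by linarith
    exact_mod_cast this
  · have : (p.2:ℝ) ≤ ((⌈R⌉:ℤ):ℝ) := by linarith
    exact_mod_cast this

theorem mk_half_norm (d : Bool) : ‖mk d 0 (1/2)‖ ≤ 1/2 := by
  rw [lt_norm_le d, lo_mk, tr_mk]; norm_num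

theorem ec_fin (R : ℝ) : {q | ‖ec q‖ ≤ R}.Finite := by
  refine (Set.finite_univ.prod (ip_fin (R + 1/2))).subset ?_
  rintro ⟨d, p⟩ hq
  refine ⟨trivial, ?_⟩
  have h1 : ‖ip p + mk d 0 (1/2)‖ ≤ R := hq
  have h2 := norm_sub_le (ip p + mk d 0 (1/2)) (mk d 0 (1/2))
  rw [add_sub_cancel_right] at h2
  have := mk_half_norm d
  show ‖ip p‖ ≤ R + 1/2
  linarith

theorem vc_fin (R : ℝ) : {q | ‖vc q‖ ≤ R}.Finite := by
  refine (ip_fin (R + 1/2)).subset ?_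
  intro p hq
  have h1 : ‖ip p + (1/2, 1/2)‖ ≤ R := hq
  have h2 := norm_sub_le (ip p + (1/2, 1/2)) (1/2, 1/2)
  rw [add_sub_cancel_right] at h2
  have : ‖((1/2, 1/2) : E2)‖ ≤ 1/2 := e2_norm_le.2 (by norm_num)
  show ‖ip p‖ ≤ R + 1/2
  linarith

theorem int_uniq {x : ℝ} {m n : ℤ} {s t : ℝ} (h1 : |x - m| ≤ s) (h2 : |x - n| ≤ t) (h : s + t < 1) :
    m = n := by
  rw [abs_le] at h1 h2
  have h3 : (m:ℝ) < n + 1 := by linarith [h1.1, h2.2]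
  have h4 : (n:ℝ) < m + 1 := by linarith [h1.2, h2.1]
  have h3' : m < n + 1 := by exact_mod_cast h3
  have h4' : n < m + 1 := by exact_mod_cast h4
  omega

theorem int_half {x : ℝ} {m n : ℤ} {s t : ℝ} (h1 : |x - m| ≤ s) (h2 : |x - (n + 1/2)| < t)
    (h : s + t ≤ 1/2) : False := by
  rw [abs_le] at h1
  rw [abs_lt] at h2
  have h3 : (m:ℝ) < n + 1 := by linarith [h1.1, h2.2]
  have h4 : (n:ℝ) < m := by linarith [h1.2, h2.1]
  have h3' : m < n + 1 := by exact_mod_cast h3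
  have h4' : n < m := by exact_mod_cast h4
  omega

theorem ip_lo (d : Bool) (p : ℤ × ℤ) : ∃ n : ℤ, lo d (ip p) = n := by
  cases d
  · exact ⟨p.2, rfl⟩
  · exact ⟨p.1, rfl⟩
theorem ip_tr (d : Bool) (p : ℤ × ℤ) : ∃ n : ℤ, tr d (ip p) = n := by
  cases d
  · exact ⟨p.1, rfl⟩
  · exact ⟨p.2, rfl⟩
theorem ip_ext (d : Bool) {p q : ℤ × ℤ} (h1 : lo d (ip p) = lo d (ip q))
    (h2 : tr d (ip p) = tr d (ip q)) : p = q := by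
  cases d
  · have h1 : (p.2:ℝ) = q.2 := h1
    have h2 : (p.1:ℝ) = q.1 := h2
    exact Prod.ext (by exact_mod_cast h2) (by exact_mod_cast h1)
  · have h1 : (p.1:ℝ) = q.1 := h1
    have h2 : (p.2:ℝ) = q.2 := h2
    exact Prod.ext (by exact_mod_cast h1) (by exact_mod_cast h2)

theorem ip_uniq {z : E2} {p q : ℤ × ℤ} {s t : ℝ} (h1 : ‖z - ip p‖ ≤ s) (h2 : ‖z - ip q‖ ≤ t)
    (h : s + t < 1) : p = q := by
  rw [e2_norm_le] at h1 h2
  exact Prod.ext (int_uniq h1.1 h2.1 h) (int_uniq h1.2 h2.2 h)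

theorem lo_ec (q : Bool × ℤ × ℤ) : lo q.1 (ec q) = lo q.1 (ip q.2) := by
  rw [ec, lo_add, lo_mk, add_zero]
theorem tr_ec (q : Bool × ℤ × ℤ) : tr q.1 (ec q) = tr q.1 (ip q.2) + 1/2 := by
  rw [ec, tr_add, tr_mk]
theorem lo_not (d : Bool) (z : E2) : lo (!d) z = tr d z := by cases d <;> rfl
theorem tr_not (d : Bool) (z : E2) : tr (!d) z = lo d z := by cases d <;> rfl

/-- support of an edge homeo -/
def es (q : Bool × ℤ × ℤ) : Set E2 := {z | |lo q.1 (z - ec q)| < 0.36 ∧ |tr q.1 (z - ec q)| < 0.08}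

theorem es_norm {q : Bool × ℤ × ℤ} {z : E2} (h : z ∈ es q) : ‖z - ec q‖ ≤ 0.36 := by
  rw [lt_norm_le q.1]; exact ⟨h.1.le, by linarith [h.2]⟩

theorem es_disj {q q' : Bool × ℤ × ℤ} (h : q ≠ q') : Disjoint (es q) (es q') := by
  rw [Set.disjoint_left]
  rintro z ⟨h1, h2⟩ ⟨h3, h4⟩
  rw [lo_sub, lo_ec] at h1 h3
  rw [tr_sub, tr_ec] at h2 h4
  obtain ⟨d, p⟩ := q
  obtain ⟨d', p'⟩ := q'
  simp only at h1 h2 h3 h4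
  obtain ⟨m, hm⟩ := ip_lo d p
  obtain ⟨n, hn⟩ := ip_tr d p
  obtain ⟨m', hm'⟩ := ip_lo d' p'
  obtain ⟨n', hn'⟩ := ip_tr d' p'
  rw [hm] at h1; rw [hn] at h2; rw [hm'] at h3; rw [hn'] at h4
  by_cases hd : d = d'
  · subst hd
    refine h ?_
    have e1 := int_uniq h1.le h3.le (by norm_num)
    have h2' : |(tr d z - 1/2) - n| ≤ 0.08 := by rw [sub_sub, add_comm (1/2:ℝ)]; exact h2.le
    have h4' : |(tr d z - 1/2) - n'| ≤ 0.08 := by rw [sub_sub, add_comm (1/2:ℝ)]; exact h4.le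
    have e2 := int_uniq h2' h4' (by norm_num)
    have e3 : p = p' := ip_ext d (by rw [hm, hm', e1]) (by rw [hn, hn', e2])
    rw [e3]
  · have : d' = !d := by cases d <;> cases d' <;> simp_all
    subst this
    rw [tr_not] at h4
    exact int_half h1.le h4 (by norm_num)

theorem NI_trans {a : OpenPartialHomeomorph E2 E2} {A B : Set E2} {δ t : ℝ} (ha : NI a A δ)
    (F : E2 ≃ₜ E2) (hF : ∀ z, ‖F z - z‖ ≤ t) (hB : ∀ z ∈ B, z ∈ A ∧ F z ∈ A) :
    NI (a.transHomeomorph F.symm) B (δ + t) := by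
  intro z hz
  obtain ⟨h1, h2⟩ := hB z hz
  refine ⟨(ha z h1).1, (ha _ h2).2.1, ?_, ?_⟩
  · show ‖F.symm (a z) - z‖ ≤ δ + t
    have e1 := hF (F.symm (a z))
    rw [F.apply_symm_apply] at e1
    have e2 := (ha z h1).2.2.1
    have : F.symm (a z) - z = (a z - z) - (a z - F.symm (a z)) := by abel
    rw [this]; exact (norm_sub_le _ _).trans (add_le_add e2 e1)
  · show ‖a.symm (F z) - z‖ ≤ δ + t
    have e1 := hF z
    have e2 := (ha _ h2).2.2.2
    have : a.symm (F z) - z = (a.symm (F z) - F z) + (F z - z) := by abel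
    rw [this]; exact (norm_add_le _ _).trans (add_le_add e2 e1)

/-- points away from the vertices: in a square core or along an edge -/
theorem trichotomy (z : E2) : (∃ v : ℤ × ℤ, ‖z - vc v‖ ≤ 0.3) ∨
    (∃ p, ‖z - ip p‖ ≤ 0.485 ∧ ∀ q, z ∉ es q) ∨
    (∃ q : Bool × ℤ × ℤ, |lo q.1 (z - ec q)| ≤ 0.2 ∧ |tr q.1 (z - ec q)| < 0.08) := by
  have key : ∀ x : ℝ, (∃ n : ℤ, |x - (n + 1/2)| ≤ 0.3) ∨ ∃ n : ℤ, |x - n| ≤ 0.2 := by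
    intro x
    have h := abs_sub_round x
    by_cases h2 : |x - round x| ≤ 0.2
    · exact Or.inr ⟨_, h2⟩
    · left
      rcases le_total 0 (x - round x) with h0 | h0
      · rw [abs_of_nonneg h0] at h h2
        exact ⟨round x, by rw [abs_le]; constructor <;> linarith⟩
      · rw [abs_of_nonpos h0] at h h2
        exact ⟨round x - 1, by rw [abs_le]; push_cast; constructor <;> linarith⟩
  have main : ∀ d : Bool, (∃ n : ℤ, |lo d z - n| ≤ 0.2) → 
    (∃ p, ‖z - ip p‖ ≤ 0.485 ∧ ∀ q, z ∉ es q) ∨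
    (∃ q : Bool × ℤ × ℤ, |lo q.1 (z - ec q)| ≤ 0.2 ∧ |tr q.1 (z - ec q)| < 0.08) := by
    rintro d ⟨m, hm⟩
    set t := tr d z with ht
    have h := abs_sub_round t
    have pk : ∀ n : ℤ, ∃ p : ℤ × ℤ, lo d (ip p) = m ∧ tr d (ip p) = n := by
      intro n
      cases d
      · exact ⟨(n, m), rfl, rfl⟩
      · exact ⟨(m, n), rfl, rfl⟩
    by_cases h2 : |t - round t| ≤ 0.42
    · left
      obtain ⟨p, hp1, hp2⟩ := pk (round t)
      refine ⟨p, ?_, ?_⟩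
      · rw [lt_norm_le d, lo_sub, tr_sub, hp1, hp2]
        exact ⟨by linarith, by linarith⟩
      · rintro ⟨d', p'⟩ ⟨-, h4⟩
        rw [tr_sub, tr_ec] at h4
        obtain ⟨n', hn'⟩ := ip_tr d' p'
        simp only at h4
        rw [hn'] at h4
        by_cases hd : d = d'
        · subst hd
          exact int_half h2 h4 (by norm_num)
        · have : d' = !d := by cases d <;> cases d' <;> simp_all
          subst this
          rw [tr_not] at h4
          exact int_half hm h4 (by norm_num)
    · right
      rcases le_total 0 (t - round t) with h0 | h0
      · rw [abs_of_nonneg h0] at h h2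
        obtain ⟨p, hp1, hp2⟩ := pk (round t)
        refine ⟨(d, p), ?_, ?_⟩
        · rw [lo_sub, lo_ec]; simp only; rw [hp1]; exact hm
        · rw [tr_sub, tr_ec]; simp only; rw [hp2, ← ht, abs_lt]; constructor <;> linarith
      · rw [abs_of_nonpos h0] at h h2
        obtain ⟨p, hp1, hp2⟩ := pk (round t - 1)
        refine ⟨(d, p), ?_, ?_⟩
        · rw [lo_sub, lo_ec]; simp only; rw [hp1]; exact hm
        · rw [tr_sub, tr_ec]; simp only; rw [hp2, ← ht, abs_lt]; push_cast; constructor <;> linarith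
  rcases key z.1 with ⟨m, hm⟩ | h1
  · rcases key z.2 with ⟨n, hn⟩ | h2
    · left
      exact ⟨(m, n), e2_norm_le.2 ⟨hm, hn⟩⟩
    · exact Or.inr (main false h2)
  · exact Or.inr (main true h1)

theorem vc_uniq {z : E2} {p q : ℤ × ℤ} {s t : ℝ} (h1 : ‖z - vc p‖ ≤ s) (h2 : ‖z - vc q‖ ≤ t)
    (h : s + t < 1) : p = q := by
  rw [vc, add_comm, ← sub_sub] at h1 h2
  exact ip_uniq h1 h2 h

/-- an edge neighbourhood point is either near the edge line or in an adjacent square core -/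
theorem edge_adj (q : Bool × ℤ × ℤ) (z : E2) (h : ‖z - ec q‖ ≤ 0.4) (h2 : 0.02 ≤ |tr q.1 (z - ec q)|) :
    ∃ p, ‖z - ip p‖ ≤ 0.485 := by
  obtain ⟨d, p⟩ := q
  rw [lt_norm_le d] at h
  rw [lo_sub, tr_sub] at h
  rw [tr_sub] at h2
  have e1 := lo_ec (d, p)
  have e2 := tr_ec (d, p)
  simp only at e1 e2 h2
  rw [e1, e2] at h
  rw [e2] at h2
  obtain ⟨h, h'⟩ := h
  rw [abs_le] at h h'
  rcases le_total 0 (tr d z - (tr d (ip p) + 1/2)) with h0 | h0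
  · rw [abs_of_nonneg h0] at h2
    obtain ⟨p', hp1, hp2⟩ : ∃ p' : ℤ × ℤ, lo d (ip p') = lo d (ip p) ∧ tr d (ip p') = tr d (ip p) + 1 := by
      cases d
      · exact ⟨(p.1 + 1, p.2), rfl, by simp [tr, ip]⟩
      · exact ⟨(p.1, p.2 + 1), rfl, by simp [tr, ip]⟩
    refine ⟨p', ?_⟩
    rw [lt_norm_le d, lo_sub, tr_sub, hp1, hp2, abs_le, abs_le]
    refine ⟨⟨?_, ?_⟩, ?_, ?_⟩ <;> linarith
  · rw [abs_of_nonpos h0] at h2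
    refine ⟨p, ?_⟩
    rw [lt_norm_le d, lo_sub, tr_sub, abs_le, abs_le]
    refine ⟨⟨?_, ?_⟩, ?_, ?_⟩ <;> linarith

theorem tri {x y : E2} {t : ℝ} (h : ‖x - y‖ ≤ t) : ‖x‖ ≤ ‖y‖ + t := (near_norm h).1
theorem tri' {x y : E2} {t : ℝ} (h : ‖x - y‖ ≤ t) : ‖y‖ ≤ ‖x‖ + t := (near_norm h).2

theorem EK1 : ∃ δ > 0, ∀ (R : ℝ) (a : OpenPartialHomeomorph E2 E2), NI a {z | ‖z‖ ≤ R + 3} δ →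
    ∃ f : E2 ≃ₜ E2, (∀ z, R + 3 ≤ ‖z‖ → f z = z) ∧ (∀ z, ‖z‖ ≤ R → f z = a z) ∧
      (∀ z, ‖f z - z‖ ≤ 1) ∧
      ∀ b, (∀ z, ‖z - b‖ ≤ 5 → ‖z‖ ≤ R + 3 → a z = z) → f b = b := by
  obtain ⟨δ0, hδ0, h0⟩ := H0 (s := 1/10000) (by norm_num)
  refine ⟨min δ0 (1/10000), by positivity, fun R a ha => ?_⟩
  have ha' : NI a {z | ‖z‖ ≤ R + 3} (1/10000) := fun z hz => by
    obtain ⟨h1, h2, h3, h4⟩ := ha z hz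
    exact ⟨h1, h2, h3.trans (min_le_right _ _), h4.trans (min_le_right _ _)⟩
  -- squares
  have hsq : ∀ p : {p : ℤ × ℤ | ‖ip p‖ ≤ R + 2}, ∃ f : E2 ≃ₜ E2, (∀ z, 1/2 ≤ ‖z - ip p‖ → f z = z) ∧
      (∀ z, ‖z - ip p‖ ≤ 0.485 → f z = a z) ∧ (∀ z, ‖f z - z‖ ≤ 1/10000) ∧
      ((∀ z, ‖z - ip p‖ ≤ 1/2 → a z = z) → ∀ z, f z = z) := by
    rintro ⟨p, hp⟩
    have hp' : ‖ip p‖ ≤ R + 2 := hp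
    refine h0 a (ip p) fun z hz => ?_
    have hz' : ‖z - ip p‖ ≤ 1/2 := hz
    obtain ⟨h1, h2, h3, h4⟩ := ha z (show ‖z‖ ≤ R + 3 by linarith [tri hz'])
    exact ⟨h1, h2, h3.trans (min_le_left _ _), h4.trans (min_le_left _ _)⟩
  choose f1 f1a f1b f1c f1d using hsq
  have : Finite {p : ℤ × ℤ | ‖ip p‖ ≤ R + 2} := (ip_fin _).to_subtype
  obtain ⟨F1, F1a, F1b⟩ := glue_finite f1 (fun p => {z | ‖z - ip p‖ < 1/2}) (by
    intro i j hij
    rw [Set.disjoint_left]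
    intro z h1 h2
    have h1 : ‖z - ip i‖ < 1/2 := h1
    have h2 : ‖z - ip j‖ < 1/2 := h2
    refine hij (Subtype.ext (ip_uniq (s := ‖z - ip i‖) (t := ‖z - ip j‖) le_rfl le_rfl (by linarith)))) (by
    intro i z hz
    exact f1a i z (not_lt.1 hz))
  have F1c : ∀ z, ‖F1 z - z‖ ≤ 1/10000 := by
    intro z
    by_cases h : ∃ p : {p : ℤ × ℤ | ‖ip p‖ ≤ R + 2}, ‖z - ip p‖ < 1/2
    · obtain ⟨p, hp⟩ := h
      rw [F1a p z hp]; exact f1c p z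
    · rw [F1b z (fun p hp => h ⟨p, hp⟩)]; simp
  have F1out : ∀ z, R + 2.5 ≤ ‖z‖ → F1 z = z := by
    intro z hz
    refine F1b z fun p hp => ?_
    have hp : ‖z - ip p‖ < 1/2 := hp
    have hp2 : ‖ip p‖ ≤ R + 2 := p.2
    have := tri (le_refl ‖z - ip p‖)
    linarith
  set g1 := a.transHomeomorph F1.symm with hg1
  have g1a : ∀ z, F1 (g1 z) = a z := fun z => F1.apply_symm_apply _
  have g1N : NI g1 {z | ‖z‖ ≤ R + 2.5} (2/10000) := by
    have := NI_trans (B := {z | ‖z‖ ≤ R + 2.5}) ha' F1 F1c (by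
      intro z hz
      have hz : ‖z‖ ≤ R + 2.5 := hz
      refine ⟨show ‖z‖ ≤ R + 3 by linarith, show ‖F1 z‖ ≤ R + 3 from ?_⟩
      have := tri (F1c z); linarith)
    norm_num at this ⊢; exact this
  have g1id : ∀ z p, ‖ip p‖ ≤ R + 2 → ‖z - ip p‖ ≤ 0.485 → g1 z = z := by
    intro z p hp hz
    refine F1.injective ?_
    rw [g1a, F1a ⟨p, hp⟩ z (show ‖z - ip p‖ < 1/2 by linarith)]
    exact (f1b ⟨p, hp⟩ z hz).symm
  -- edges
  have hed : ∀ q : {q | ‖ec q‖ ≤ R + 1.1}, ∃ f : E2 ≃ₜ E2,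
      (∀ z, |lo q.1.1 (z - ec q)| ≤ 0.2 → ‖z - ec q‖ ≤ 0.4 → f z = g1 z) ∧
      (∀ z, 0.36 ≤ |lo q.1.1 (z - ec q)| ∨ 0.08 ≤ |tr q.1.1 (z - ec q)| → f z = z) ∧
      (∀ z, ‖f z - z‖ ≤ 0.12) ∧ ((∀ z, ‖z - ec q‖ ≤ 0.4 → g1 z = z) → ∀ z, f z = z) := by
    rintro ⟨q, hq⟩
    have hq' : ‖ec q‖ ≤ R + 1.1 := hq
    refine H1 q.1 g1 (ec q) ?_ ?_
    · intro z hz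
      have hz' : ‖z - ec q‖ ≤ 0.4 := hz
      obtain ⟨h1, h2, h3, h4⟩ := g1N z (show ‖z‖ ≤ R + 2.5 by linarith [tri hz'])
      exact ⟨h1, h2, by linarith, by linarith⟩
    · intro z hz h2
      obtain ⟨p, hp⟩ := edge_adj q z hz h2
      exact g1id z p (by linarith [tri hz, tri' hp]) hp
  choose f2 f2a f2b f2c f2d using hed
  have : Finite {q | ‖ec q‖ ≤ R + 1.1} := (ec_fin _).to_subtype
  have hes : ∀ (q : Bool × ℤ × ℤ) (z : E2), z ∉ es q →
      0.36 ≤ |lo q.1 (z - ec q)| ∨ 0.08 ≤ |tr q.1 (z - ec q)| := by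
    intro q z hz
    by_contra hcon
    rw [not_or, not_le, not_le] at hcon
    exact hz hcon
  obtain ⟨F2, F2a, F2b⟩ := glue_finite f2 (fun q => es q) (by
    intro i j hij
    exact es_disj (fun h => hij (Subtype.ext h))) (by
    intro i z hz
    exact f2b i z (hes _ _ hz))
  have F2c : ∀ z, ‖F2 z - z‖ ≤ 0.12 := by
    intro z
    by_cases h : ∃ q : {q | ‖ec q‖ ≤ R + 1.1}, z ∈ es q
    · obtain ⟨q, hq⟩ := h
      rw [F2a q z hq]; exact f2c q z
    · rw [F2b z (fun p hp => h ⟨p, hp⟩)]; simp; norm_num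
  have F2out : ∀ z, R + 1.5 ≤ ‖z‖ → F2 z = z := by
    intro z hz
    refine F2b z fun q hq => ?_
    have hq2 : ‖ec q‖ ≤ R + 1.1 := q.2
    have := tri (es_norm hq)
    linarith
  set g2 := g1.transHomeomorph F2.symm with hg2
  have g2a : ∀ z, F2 (g2 z) = g1 z := fun z => F2.apply_symm_apply _
  have g2N : NI g2 {z | ‖z‖ ≤ R + 2} 0.13 := by
    have := NI_trans (B := {z | ‖z‖ ≤ R + 2}) g1N F2 F2c (by
      intro z hz
      have hz : ‖z‖ ≤ R + 2 := hz
      refine ⟨show ‖z‖ ≤ R + 2.5 by linarith, show ‖F2 z‖ ≤ R + 2.5 from ?_⟩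
      have := tri (F2c z); linarith)
    intro z hz
    obtain ⟨h1, h2, h3, h4⟩ := this z hz
    exact ⟨h1, h2, by linarith, by linarith⟩
  have g2id : ∀ z, ‖z‖ ≤ R + 0.8 → (∀ v, ¬ ‖z - vc v‖ ≤ 0.3) → g2 z = z := by
    intro z hz hv
    refine F2.injective ?_
    rw [g2a]
    rcases trichotomy z with ⟨v, h⟩ | ⟨p, hp, hq⟩ | ⟨q, hq1, hq2⟩
    · exact absurd h (hv v)
    · rw [F2b z (fun q => hq q)]
      exact g1id z p (by linarith [tri' hp]) hp
    · have hn : ‖z - ec q‖ ≤ 0.2 := (lt_norm_le q.1).2 ⟨hq1, by linarith⟩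
      have hq3 : ‖ec q‖ ≤ R + 1.1 := by linarith [tri' hn]
      rw [F2a ⟨q, hq3⟩ z ⟨by linarith, hq2⟩]
      exact (f2a ⟨q, hq3⟩ z hq1 (by linarith)).symm
  -- vertices
  have hve : ∀ v : {v | ‖vc v‖ ≤ R + 0.3}, ∃ f : E2 ≃ₜ E2,
      (∀ z, ‖z - vc v‖ ≤ 0.3 → f z = g2 z) ∧ (∀ z, 0.3 ≤ ‖z - vc v‖ → f z = z) := by
    rintro ⟨v, hv⟩
    have hv' : ‖vc v‖ ≤ R + 0.3 := hv
    have hcl : ∀ z, ‖z - vc v‖ ≤ 0.49 → ‖z‖ ≤ R + 0.8 := fun z hz => by linarith [tri hz]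
    have hid : ∀ z, 0.3 < ‖z - vc v‖ → ‖z - vc v‖ ≤ 0.49 → g2 z = z := by
      intro z h1 h2
      refine g2id z (hcl z h2) fun v' h3 => ?_
      have := vc_uniq h2 h3 (by norm_num)
      subst this; linarith
    refine loc_homeo g2 (vc v) (r := 0.3) (r' := 0.49) (by norm_num) ?_ ?_
    · intro z hz
      obtain ⟨h1, h2, h3, h4⟩ := g2N z (show ‖z‖ ≤ R + 2 by linarith [hcl z hz])
      exact ⟨h1, h2, by linarith, by linarith⟩
    · intro z h1 h2
      -- boundary by continuity
      rcases h1.lt_or_eq with h3 | h3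
      · exact hid z h3 h2
      · have hcont : ContinuousAt g2 z :=
          g2.continuousAt (g2N z (show ‖z‖ ≤ R + 2 by linarith [hcl z h2])).1
        have hw : Filter.Tendsto (fun n : ℕ => vc v + (1 + 1/((n:ℝ)+2)) • (z - vc v)) Filter.atTop (𝓝 z) := by
          have h4 : Filter.Tendsto (fun n : ℕ => (1:ℝ)/((n:ℝ)+2)) Filter.atTop (𝓝 0) := by
            have := (tendsto_one_div_add_atTop_nhds_zero_nat (𝕜 := ℝ)).comp (Filter.tendsto_add_atTop_nat 1)
            refine this.congr fun n => ?_
            simp [Function.comp]; ring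
          have h5 := ((h4.const_add 1).smul_const (z - vc v)).const_add (vc v)
          simpa using h5
        have h6 := hcont.tendsto.comp hw
        refine tendsto_nhds_unique h6 (hw.congr fun n => ?_)
        have hp : (0:ℝ) < 1/((n:ℝ)+2) := by positivity
        have hp2 : 1/((n:ℝ)+2) ≤ 1/2 := by
          apply one_div_le_one_div_of_le <;> [norm_num; linarith [Nat.cast_nonneg (α := ℝ) n]]
        have hno : ‖vc v + (1 + 1/((n:ℝ)+2)) • (z - vc v) - vc v‖ = (1 + 1/((n:ℝ)+2)) * 0.3 := by
          rw [add_sub_cancel_left, norm_smul, ← h3, Real.norm_of_nonneg (by positivity)]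
        exact (hid _ (by rw [hno]; linarith) (by rw [hno]; linarith)).symm
  choose f3 f3a f3b using hve
  have : Finite {v | ‖vc v‖ ≤ R + 0.3} := (vc_fin _).to_subtype
  obtain ⟨F3, F3a, F3b⟩ := glue_finite f3 (fun v => {z | ‖z - vc v‖ ≤ 0.3}) (by
    intro i j hij
    rw [Set.disjoint_left]
    intro z h1 h2
    have h1 : ‖z - vc i‖ ≤ 0.3 := h1
    have h2 : ‖z - vc j‖ ≤ 0.3 := h2
    exact hij (Subtype.ext (vc_uniq h1 h2 (by norm_num)))) (by
    intro i z hz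
    exact f3b i z (not_le.1 hz).le)
  have F3c : ∀ z, ‖F3 z - z‖ ≤ 0.6 := by
    intro z
    by_cases h : ∃ q : {v | ‖vc v‖ ≤ R + 0.3}, ‖z - vc q‖ ≤ 0.3
    · obtain ⟨q, hq⟩ := h
      rw [F3a q z hq]
      have h2 : f3 q z ∈ {z | ‖z - vc q‖ ≤ 0.3} := maps_supp (fun z hz => f3b q z (not_le.1 hz).le) hq
      have h2 : ‖f3 q z - vc q‖ ≤ 0.3 := h2
      have : f3 q z - z = (f3 q z - vc q) - (z - vc q) := by abel
      rw [this]; refine (norm_sub_le _ _).trans ?_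
      linarith
    · rw [F3b z (fun p hp => h ⟨p, hp⟩)]; simp; norm_num
  have F3out : ∀ z, R + 0.7 ≤ ‖z‖ → F3 z = z := by
    intro z hz
    refine F3b z fun v hv => ?_
    have hv : ‖z - vc v‖ ≤ 0.3 := hv
    have hv2 : ‖vc v‖ ≤ R + 0.3 := v.2
    have := tri hv
    linarith
  refine ⟨(F3.trans F2).trans F1, ?_, ?_, ?_, ?_⟩
  · intro z hz
    show F1 (F2 (F3 z)) = z
    rw [F3out z (by linarith), F2out z (by linarith), F1out z (by linarith)]
  · intro z hz
    show F1 (F2 (F3 z)) = a z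
    have : F3 z = g2 z := by
      by_cases h : ∃ v, ‖z - vc v‖ ≤ 0.3
      · obtain ⟨v, hv⟩ := h
        have hv2 : ‖vc v‖ ≤ R + 0.3 := by linarith [tri' hv]
        rw [F3a ⟨v, hv2⟩ z hv]; exact f3a ⟨v, hv2⟩ z hv
      · rw [F3b z (fun v hv => h ⟨v, hv⟩), g2id z (by linarith) (fun v hv => h ⟨v, hv⟩)]
    rw [this, g2a, g1a]
  · intro z
    show ‖F1 (F2 (F3 z)) - z‖ ≤ 1
    have e : F1 (F2 (F3 z)) - z = (F1 (F2 (F3 z)) - F2 (F3 z)) + (F2 (F3 z) - F3 z) + (F3 z - z) := by abel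
    rw [e]
    refine (norm_add₃_le).trans ?_
    linarith [F1c (F2 (F3 z)), F2c (F3 z), F3c z]
  · intro b hb
    show F1 (F2 (F3 b)) = b
    have k1 : ∀ z, ‖z - b‖ ≤ 3 → F1 z = z := by
      intro z hz
      by_cases h : ∃ p : {p : ℤ × ℤ | ‖ip p‖ ≤ R + 2}, ‖z - ip p‖ < 1/2
      · obtain ⟨p, hp⟩ := h
        rw [F1a p z hp]
        refine f1d p (fun y hy => hb y ?_ ?_) z
        · have : y - b = (y - ip p) - (z - ip p) + (z - b) := by abel
          rw [this]; refine (norm_add_le _ _).trans ?_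
          have := norm_sub_le (y - ip p) (z - ip p)
          linarith
        · have hp2 : ‖ip p‖ ≤ R + 2 := p.2
          linarith [tri hy]
      · exact F1b z (fun p hp => h ⟨p, hp⟩)
    have k2 : F2 b = b := by
      by_cases h : ∃ q : {q | ‖ec q‖ ≤ R + 1.1}, b ∈ es q
      · obtain ⟨q, hq⟩ := h
        rw [F2a q b hq]
        refine f2d q (fun y hy => F1.injective ?_) b
        have hn := es_norm hq
        have hq2 : ‖ec q‖ ≤ R + 1.1 := q.2
        have hyb : ‖y - b‖ ≤ 1 := by
          have : y - b = (y - ec q) - (b - ec q) := by abel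
          rw [this]; refine (norm_sub_le _ _).trans ?_
          linarith
        rw [g1a, k1 y (by linarith)]
        exact hb y (by linarith) (by linarith [tri hy])
      · exact F2b b (fun p hp => h ⟨p, hp⟩)
    have k3 : F3 b = b := by
      by_cases h : ∃ v : {v | ‖vc v‖ ≤ R + 0.3}, ‖b - vc v‖ ≤ 0.3
      · obtain ⟨v, hv⟩ := h
        rw [F3a v b hv, f3a v b hv]
        refine F2.injective (F1.injective ?_)
        have hv2 : ‖vc v‖ ≤ R + 0.3 := v.2
        rw [g2a, g1a, k2, k1 b (by simp)]
        exact hb b (by simp) (by linarith [tri hv])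
      · exact F3b b (fun p hp => h ⟨p, hp⟩)
    rw [k3, k2, k1 b (by simp)]

/-- relative straightening -/
theorem EK {η s : ℝ} (hη : 0 < η) (hs : 0 < s) : ∃ δ > 0, ∀ (B : Set E2) (a : OpenPartialHomeomorph E2 E2),
    NI a {z | ‖z‖ ≤ 3} δ → (∀ b ∈ B, ∀ z, ‖z - b‖ ≤ η → ‖z‖ ≤ 3 → a z = z) →
    ∃ f : E2 ≃ₜ E2, (∀ z, 2 ≤ ‖z‖ → f z = z) ∧ (∀ z, ‖z‖ ≤ 1 → f z = a z) ∧
      (∀ z, ‖f z - z‖ ≤ s) ∧ ∀ b ∈ B, f b = b := by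
  obtain ⟨δ, hδ, h⟩ := EK1
  set μ := min (η/5) (min s (1/3)) with hμd
  have hμ : 0 < μ := by positivity
  have hμ1 : μ ≤ η/5 := min_le_left _ _
  have hμ2 : μ ≤ s := (min_le_right _ _).trans (min_le_left _ _)
  have hμ3 : μ ≤ 1/3 := (min_le_right _ _).trans (min_le_right _ _)
  refine ⟨μ * δ, by positivity, fun B a ha hB => ?_⟩
  have hμi : μ * μ⁻¹ = 1 := mul_inv_cancel₀ hμ.ne'
  have hn1 : ∀ z : E2, ‖(0:E2) + μ • z‖ = μ * ‖z‖ := fun z => by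
    rw [zero_add, norm_smul, Real.norm_of_nonneg hμ.le]
  have hR : ∀ z : E2, ‖z‖ ≤ μ⁻¹ + 3 → ‖(0:E2) + μ • z‖ ≤ 3 := by
    intro z hz
    rw [hn1]
    have := mul_le_mul_of_nonneg_left hz hμ.le
    rw [mul_add, hμi] at this; linarith
  obtain ⟨f, f1, f2, f3, f4⟩ := h μ⁻¹ (conjA a 0 μ hμ)
    (conjA_NI a 0 μ hμ {z | ‖z‖ ≤ 3} _ _ ha (fun z hz => hR z hz))
  set A := aff (0:E2) μ hμ with hA
  have hn : ∀ z, ‖z‖ = μ * ‖A.symm z‖ := by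
    intro z
    conv_lhs => rw [← A.apply_symm_apply z]
    rw [hA, aff_apply, hn1]
  refine ⟨(A.symm.trans f).trans A, ?_, ?_, ?_, ?_⟩
  · intro z hz
    show A (f (A.symm z)) = z
    rw [f1, A.apply_symm_apply]
    by_contra hcon
    push Not at hcon
    have := mul_lt_mul_of_pos_left hcon hμ
    rw [← hn, mul_add, hμi] at this; linarith
  · intro z hz
    show A (f (A.symm z)) = a z
    rw [f2]
    · show A (A.symm (a (A (A.symm z)))) = a z
      rw [A.apply_symm_apply, A.apply_symm_apply]
    · rw [hn] at hz
      by_contra hcon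
      push Not at hcon
      have := mul_lt_mul_of_pos_left hcon hμ
      rw [hμi] at this; linarith
  · intro z
    show ‖A (f (A.symm z)) - z‖ ≤ s
    have h1 := f3 (A.symm z)
    have h2 : A (f (A.symm z)) - z = μ • (f (A.symm z) - A.symm z) := by
      conv_lhs => rw [← A.apply_symm_apply z]
      rw [A.symm_apply_apply]
      rw [hA, aff_apply, aff_apply, smul_sub, add_sub_add_left_eq_sub]
    rw [h2, norm_smul, Real.norm_of_nonneg hμ.le]
    have := mul_le_mul_of_nonneg_left h1 hμ.le
    linarith
  · intro b hb
    show A (f (A.symm b)) = b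
    rw [f4, A.apply_symm_apply]
    intro z hz hz3
    rw [conjA_apply, hB b hb _ _ (hR z hz3)]
    · rw [sub_zero, zero_add, inv_smul_smul₀ hμ.ne']
    · have : (0:E2) + μ • z - b = μ • (z - A.symm b) := by
        conv_lhs => rw [← A.apply_symm_apply b]
        rw [hA, aff_apply, smul_sub, add_sub_add_left_eq_sub]
      rw [this, norm_smul, Real.norm_of_nonneg hμ.le]
      have := mul_le_mul_of_nonneg_left hz hμ.le
      linarith
end HS

namespace HS

theorem td0 {K : Type*} [TopologicalSpace K] [CompactSpace K] [T2Space K] [ConnectedSpace K]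
    {ι : Type*} [Countable ι] (C : ι → Set K) (hC : ∀ i, IsClosed (C i))
    (ht : ∀ i, IsTotallyDisconnected (C i)) (hU : (⋃ i, C i) = univ) : Subsingleton K := by
  obtain ⟨i, p, hp⟩ := nonempty_interior_of_iUnion_of_closed hC hU
  obtain ⟨s, comp, xs, sU⟩ := exists_compact_subset isOpen_interior hp
  let u : Set s := ((↑) : s → K) ⁻¹' interior s
  have u_open : IsOpen u := isOpen_interior.preimage continuous_subtype_val
  have hcs : CompactSpace s := isCompact_iff_compactSpace.1 comp
  have hts : IsTotallyDisconnected s := fun t h1 h2 =>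
    ht i t (h1.trans (sU.trans interior_subset)) h2
  have htd : TotallyDisconnectedSpace s := totallyDisconnectedSpace_subtype_iff.2 hts
  obtain ⟨V, hV, Vx, Vs⟩ := compact_exists_isClopen_in_isOpen u_open
    (x := (⟨p, interior_subset xs⟩ : s)) xs
  have hcl : IsClosed (((↑) : s → K) '' V) :=
    comp.isClosed.isClosedEmbedding_subtypeVal.isClosed_iff_image_isClosed.1 hV.1
  have hop : IsOpen (((↑) : s → K) '' V) := by
    obtain ⟨O, hO, hOV⟩ := isOpen_induced_iff.1 hV.2
    have : ((↑) : s → K) '' V = O ∩ interior s := by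
      ext x
      constructor
      · rintro ⟨y, hy, rfl⟩
        refine ⟨?_, Vs hy⟩
        rw [← hOV] at hy; exact hy
      · rintro ⟨h1, h2⟩
        refine ⟨⟨x, interior_subset h2⟩, ?_, rfl⟩
        rw [← hOV]; exact h1
    rw [this]; exact hO.inter isOpen_interior
  have huniv := IsClopen.eq_univ ⟨hcl, hop⟩ ⟨p, _, Vx, rfl⟩
  have : (univ : Set K) ⊆ C i := by
    rw [← huniv]
    rintro x ⟨y, _, rfl⟩
    exact interior_subset (sU y.2)
  have h := ht i univ this isPreconnected_univ
  exact Set.subsingleton_univ_iff.1 h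

theorem td1 {X : Type*} [TopologicalSpace X] [CompactSpace X] [T2Space X]
    {ι : Type*} [Countable ι] (C : ι → Set X) (hC : ∀ i, IsClosed (C i))
    (ht : ∀ i, IsTotallyDisconnected (C i)) (hU : (⋃ i, C i) = univ) :
    TotallyDisconnectedSpace X := by
  rw [totallyDisconnectedSpace_iff_connectedComponent_subsingleton]
  intro x
  have h1 : CompactSpace (connectedComponent x) :=
    isCompact_iff_compactSpace.1 isClosed_connectedComponent.isCompact
  have h2 : ConnectedSpace (connectedComponent x) :=
    Subtype.connectedSpace isConnected_connectedComponent
  have := td0 (K := connectedComponent x) (fun i => Subtype.val ⁻¹' (C i))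
    (fun i => (hC i).preimage continuous_subtype_val)
    (fun i => by
      intro t h1 h2
      have h3 := ht i (Subtype.val '' t) (by rintro _ ⟨y, hy, rfl⟩; exact h1 hy)
        (h2.image _ continuous_subtype_val.continuousOn)
      exact Set.subsingleton_of_image Subtype.val_injective _ h3)
    (by rw [← preimage_iUnion, hU, preimage_univ])
  exact Set.subsingleton_coe _ |>.1 this

/-- subset version, with a finite partition subordinate to an open cover -/
theorem td_part {M : Type*} [TopologicalSpace M] [T2Space M] {X : Set M} (hX : IsCompact X)
    {ι : Type*} [Countable ι] (C : ι → Set M) (hC : ∀ i, IsClosed (C i))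
    (ht : ∀ i, IsTotallyDisconnected (C i)) (hU : X ⊆ ⋃ i, C i)
    {κ : Type*} (U : κ → Set M) (hUo : ∀ k, IsOpen (U k)) (hXU : ∀ x ∈ X, ∃ k, x ∈ U k) :
    ∃ (n : ℕ) (P : Fin n → Set M) (r : Fin n → κ), (∀ i, IsCompact (P i)) ∧
      (∀ i, P i ⊆ U (r i)) ∧ (∀ i j, i ≠ j → Disjoint (P i) (P j)) ∧ X ⊆ ⋃ i, P i := by
  have h1 : CompactSpace X := isCompact_iff_compactSpace.1 hX
  have h2 : TotallyDisconnectedSpace X := td1 (fun i => (Subtype.val ⁻¹' (C i) : Set X))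
    (fun i => (hC i).preimage continuous_subtype_val)
    (fun i => by
      intro t h1 h2
      have h3 := ht i (Subtype.val '' t) (by rintro _ ⟨y, hy, rfl⟩; exact h1 hy)
        (h2.image _ continuous_subtype_val.continuousOn)
      exact Set.subsingleton_of_image Subtype.val_injective _ h3)
    (by
      ext x; simp only [mem_iUnion, mem_preimage, mem_univ, iff_true]
      simpa using hU x.2)
  have hc : TopologicalSpace.IsOpenCover (fun k => (⟨Subtype.val ⁻¹' (U k),
      (hUo k).preimage continuous_subtype_val⟩ : TopologicalSpace.Opens X)) := by
    refine TopologicalSpace.IsOpenCover.of_sets _ ?_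
    ext x; simp only [mem_iUnion, mem_preimage, mem_univ, iff_true]
    exact hXU x x.2
  obtain ⟨n, W, hW, hWu, hWd⟩ := hc.exists_finite_nonempty_disjoint_clopen_cover
  choose hne r hr using hW
  refine ⟨n, fun i => Subtype.val '' (W i : Set X), r, ?_, ?_, ?_, ?_⟩
  · intro i
    exact ((W i).isClopen.1.isCompact).image continuous_subtype_val
  · rintro i _ ⟨y, hy, rfl⟩
    exact hr i hy
  · intro i j hij
    have := hWd hij
    rw [Set.disjoint_image_iff Subtype.val_injective]
    exact (TopologicalSpace.Clopens.coe_disjoint).2 this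
  · intro x hx
    have := hWu (mem_univ (⟨x, hx⟩ : X))
    simp only [mem_iUnion] at this ⊢
    obtain ⟨j, hj⟩ := this
    exact ⟨j, _, hj, rfl⟩

/-- coordinate -/
def co (e : Bool) (z : E2) : ℝ := if e then z.1 else z.2

def arc {M : Type*} (ι : E2 → M) (e : Bool) (c : ℝ) : Set M := ι '' {z | ‖z‖ ≤ 3 ∧ co e z = c}

theorem co_cont (e : Bool) : Continuous (co e) := by
  cases e
  · exact continuous_snd
  · exact continuous_fst

theorem co_ext {z w : E2} (e : Bool) (h1 : co e z = co e w) (h2 : co (!e) z = co (!e) w) :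
    z = w := by
  cases e
  · exact Prod.ext h2 h1
  · exact Prod.ext h1 h2

def ln (e : Bool) (c y : ℝ) : E2 := if e then (c, y) else (y, c)

theorem ln_cont (e : Bool) (c : ℝ) : Continuous (ln e c) := by
  cases e
  · exact (continuous_id.prodMk continuous_const)
  · exact (continuous_const.prodMk continuous_id)

theorem ln_co (e : Bool) (z : E2) : ln e (co e z) (co (!e) z) = z := by
  cases e <;> rfl

theorem arc_compact {M : Type*} [TopologicalSpace M] {ι : E2 → M} (h : Continuous ι) (e c) :
    IsCompact (arc ι e c) := by
  refine IsCompact.image ?_ h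
  have h1 : IsCompact (Metric.closedBall (0:E2) 3) := isCompact_closedBall _ _
  have h2 := h1.inter_right (isClosed_singleton (x := c) |>.preimage (co_cont e))
  convert h2 using 1
  ext z
  simp [Set.mem_inter_iff]

theorem arc_disj {M : Type*} {ι : E2 → M} (h : Function.Injective ι) (e) {c c' : ℝ}
    (hc : c ≠ c') : Disjoint (arc ι e c) (arc ι e c') := by
  rw [Set.disjoint_left]
  rintro _ ⟨z, hz, rfl⟩ ⟨w, hw, hzw⟩
  rw [h hzw] at hw
  exact hc (hz.2.symm.trans hw.2)

/-- bad set of second parameters -/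
theorem arc_bad {M : Type*} [TopologicalSpace M] [T2Space M] {ι ι' : E2 → M}
    (h : IsOpenEmbedding ι) (h' : IsOpenEmbedding ι') (e e' : Bool) (c : ℝ) :
    {c' : ℝ | ¬ IsTotallyDisconnected (arc ι e c ∩ arc ι' e' c')}.Countable := by
  let S : ℝ → Set ℝ := fun c' => {y | ι (ln e c y) ∈ arc ι' e' c'}
  have hS : {c' : ℝ | ¬ IsTotallyDisconnected (arc ι e c ∩ arc ι' e' c')} ⊆
      {c' | (interior (S c')).Nonempty} := by
    intro c' hc'
    by_contra hne
    refine hc' ?_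
    intro t ht1 ht2
    -- pull back
    have ht3 : t = ι '' (ι ⁻¹' t) := by
      rw [image_preimage_eq_of_subset]
      intro x hx
      obtain ⟨z, _, hz⟩ := (ht1 hx).1
      exact ⟨z, hz⟩
    have ht4 : IsPreconnected (ι ⁻¹' t) := by
      rw [ht3] at ht2
      exact (h.isInducing.isPreconnected_image).1 ht2
    have ht5 : IsPreconnected (co (!e) '' (ι ⁻¹' t)) :=
      ht4.image _ (co_cont _).continuousOn
    have hco : ∀ z ∈ ι ⁻¹' t, co e z = c := by
      intro z hz
      obtain ⟨w, hw, hzw⟩ := (ht1 hz).1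
      rw [← h.injective hzw]; exact hw.2
    have hsub : co (!e) '' (ι ⁻¹' t) ⊆ S c' := by
      rintro _ ⟨z, hz, rfl⟩
      show ι (ln e c (co (!e) z)) ∈ arc ι' e' c'
      rw [← hco z hz, ln_co]
      exact (ht1 hz).2
    have key : ∀ z ∈ ι ⁻¹' t, ∀ w ∈ ι ⁻¹' t, ¬ co (!e) z < co (!e) w := by
      intro z hz w hw hlt
      have h1 := ht5.Icc_subset (mem_image_of_mem _ hz) (mem_image_of_mem _ hw)
      refine hne ⟨(co (!e) z + co (!e) w)/2, ?_⟩
      rw [mem_interior]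
      refine ⟨Ioo (co (!e) z) (co (!e) w), (Ioo_subset_Icc_self.trans h1).trans hsub, isOpen_Ioo,
        ⟨by linarith, by linarith⟩⟩
    intro x hx y hy
    rw [ht3] at hx hy
    obtain ⟨z, hz, rfl⟩ := hx
    obtain ⟨w, hw, rfl⟩ := hy
    congr 1
    refine co_ext e ((hco z hz).trans (hco w hw).symm) ?_
    exact le_antisymm (not_lt.1 (key w hw z hz)) (not_lt.1 (key z hz w hw))
  refine Countable.mono hS ?_
  refine Set.PairwiseDisjoint.countable_of_nonempty_interior (s := S) ?_ (fun _ h => h)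
  intro c1 _ c2 _ hne
  show Disjoint (S c1) (S c2)
  rw [Set.disjoint_left]
  intro y h1 h2
  exact Set.disjoint_left.1 (arc_disj h'.injective e' hne) h1 h2

end HS

namespace HS

structure Cl (M : Type*) [MetricSpace M] (ε : ℝ) where
  J : Type
  fin : Finite J
  ι : J → E2 → M
  emb : ∀ j, IsOpenEmbedding (ι j)
  disj : ∀ i j, i ≠ j → ∀ z w, ‖z‖ ≤ 3 → ‖w‖ ≤ 3 → ι i z ≠ ι j w
  small : ∀ j z w, ‖z‖ ≤ 3 → ‖w‖ ≤ 3 → dist (ι j z) (ι j w) < ε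

def Cl.core {M : Type*} [MetricSpace M] {ε : ℝ} (C : Cl M ε) : Set M :=
  {p | ∃ j z, ‖z‖ < 1/2 ∧ C.ι j z = p}

theorem Cl.core_open {M : Type*} [MetricSpace M] {ε : ℝ} (C : Cl M ε) : IsOpen C.core := by
  have : C.core = ⋃ j, C.ι j '' Metric.ball 0 (1/2) := by
    ext p
    simp [Cl.core]
  rw [this]
  exact isOpen_iUnion fun j => (C.emb j).isOpenMap _ Metric.isOpen_ball

theorem box {M : Type*} [TopologicalSpace M] {ι : E2 → M} (h : IsOpenEmbedding ι) (c : E2)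
    {r ρ : ℝ} (hr : 0 < r) (hρ : ρ < r) :
    ∃ ι' : E2 → M, IsOpenEmbedding ι' ∧ (∀ z, ‖z‖ ≤ 3 → ∃ w, ‖w - c‖ < r ∧ ι' z = ι w) ∧
      (∀ w, ‖w - c‖ ≤ ρ → ∃ z, ‖z‖ < 1/2 ∧ ι' z = ι w) := by
  obtain ⟨R, hR3, hR4, hRρ⟩ : ∃ R : ℝ, 3 < R ∧ R < 4 ∧ 4 * ρ / r < R := by
    have h1 : 4 * ρ / r < 4 := by rw [div_lt_iff₀ hr]; linarith
    obtain ⟨R, h2, h3⟩ := exists_between (max_lt (show (3:ℝ) < 4 by norm_num) h1)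
    exact ⟨R, lt_of_le_of_lt (le_max_left _ _) h2, h3, lt_of_le_of_lt (le_max_right _ _) h2⟩
  obtain ⟨y, hy1, hy2⟩ := exists_between (max_lt (show (0:ℝ) < R by linarith) hRρ)
  have hy0 : 0 < y := lt_of_le_of_lt (le_max_left _ _) hy1
  have hyρ : 4 * ρ / r < y := lt_of_le_of_lt (le_max_right _ _) hy1
  obtain ⟨φ, hφ1, hφ2⟩ := exists_scale (V := E2) (c := 2*y) (x := 1/2) (R := R) (by linarith)
    (by norm_num) (by linarith) (by linarith)
  have hr4 : 0 < r / 4 := by positivity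
  refine ⟨fun z => ι (aff c (r/4) hr4 (φ z)), ?_, ?_, ?_⟩
  · exact h.comp ((φ.trans (aff c (r/4) hr4)).isOpenEmbedding)
  · intro z hz
    refine ⟨_, ?_, rfl⟩
    rw [aff_apply, add_sub_cancel_left, norm_smul, Real.norm_of_nonneg (by positivity)]
    have : ‖φ z‖ < R := by
      by_contra hcon
      push Not at hcon
      have h1 := hφ2 _ hcon
      rw [φ.injective h1] at hcon
      linarith
    nlinarith
  · intro w hw
    refine ⟨(1/(2*y)) • (4/r) • (w - c), ?_, ?_⟩
    · rw [norm_smul, norm_smul, Real.norm_of_nonneg (by positivity),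
        Real.norm_of_nonneg (by positivity)]
      have h1 : 4 / r * ‖w - c‖ < y := by
        refine lt_of_le_of_lt ?_ hyρ
        rw [mul_comm, ← mul_div_assoc, mul_comm]
        gcongr
      rw [one_div, inv_mul_lt_iff₀ (by positivity)]
      linarith
    · have h1 : ‖(1/(2*y)) • (4/r) • (w - c)‖ ≤ 1/2 := by
        rw [norm_smul, norm_smul, Real.norm_of_nonneg (by positivity),
          Real.norm_of_nonneg (by positivity)]
        have h1 : 4 / r * ‖w - c‖ < y := by
          refine lt_of_le_of_lt ?_ hyρ
          rw [mul_comm, ← mul_div_assoc, mul_comm]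
          gcongr
        rw [one_div, inv_mul_le_iff₀ (by positivity)]
        linarith
      simp only
      rw [hφ1 _ h1, aff_apply, smul_smul, smul_smul, smul_smul]
      rw [show r / 4 * (2 * y) * (1 / (2 * y)) * (4 / r) = 1 by field_simp, one_smul]
      congr 1
      abel

theorem mkCl {M : Type*} [MetricSpace M] {ε : ℝ} {J : Type} [Finite J] (ι : J → E2 → M)
    (h : ∀ j, IsOpenEmbedding (ι j)) (c : J → E2) (r ρ : J → ℝ) (hr : ∀ j, 0 < r j)
    (hρ : ∀ j, ρ j < r j)
    (hd : ∀ i j, i ≠ j → ∀ z w, ‖z - c i‖ < r i → ‖w - c j‖ < r j → ι i z ≠ ι j w)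
    (hs : ∀ j z w, ‖z - c j‖ < r j → ‖w - c j‖ < r j → dist (ι j z) (ι j w) < ε) :
    ∃ C : Cl M ε, ∀ j w, ‖w - c j‖ ≤ ρ j → ι j w ∈ C.core := by
  choose ι' h1 h2 h3 using fun j => box (h j) (c j) (hr j) (hρ j)
  refine ⟨⟨J, inferInstance, ι', h1, ?_, ?_⟩, ?_⟩
  · intro i j hij z w hz hw
    obtain ⟨z', hz', e1⟩ := h2 i z hz
    obtain ⟨w', hw', e2⟩ := h2 j w hw
    rw [e1, e2]
    exact hd i j hij _ _ hz' hw'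
  · intro j z w hz hw
    obtain ⟨z', hz', e1⟩ := h2 j z hz
    obtain ⟨w', hw', e2⟩ := h2 j w hw
    rw [e1, e2]
    exact hs j _ _ hz' hw'
  · intro j w hw
    obtain ⟨z, hz, e⟩ := h3 j w hw
    exact ⟨j, z, hz, e⟩

theorem sep_fin {M : Type*} [TopologicalSpace M] [T2Space M] {n : Type*} [Finite n]
    (P : n → Set M)
    (hP : ∀ i, IsCompact (P i)) (hd : ∀ i j, i ≠ j → Disjoint (P i) (P j)) :
    ∃ O : n → Set M, (∀ i, IsOpen (O i)) ∧ (∀ i, P i ⊆ O i) ∧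
      ∀ i j, i ≠ j → Disjoint (O i) (O j) := by
  have : ∀ i j, ∃ U V : Set M, IsOpen U ∧ IsOpen V ∧ P i ⊆ U ∧ P j ⊆ V ∧
      (i ≠ j → Disjoint U V) := by
    intro i j
    by_cases h : i = j
    · exact ⟨univ, univ, isOpen_univ, isOpen_univ, subset_univ _, subset_univ _, fun h' => absurd h h'⟩
    · obtain ⟨U, V, h1, h2, h3, h4, h5⟩ :=
        SeparatedNhds.of_isCompact_isCompact (hP i) (hP j) (hd i j h)
      exact ⟨U, V, h1, h2, h3, h4, fun _ => h5⟩
  choose U V h1 h2 h3 h4 h5 using this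
  refine ⟨fun i => ⋂ j, (U i j ∩ V j i), ?_, ?_, ?_⟩
  · intro i
    exact isOpen_iInter_of_finite fun j => (h1 i j).inter (h2 j i)
  · intro i
    exact subset_iInter fun j => subset_inter (h3 i j) (h4 j i)
  · intro i j hij
    refine (h5 i j hij).mono ?_ ?_
    · exact (iInter_subset _ j).trans inter_subset_left
    · exact (iInter_subset _ i).trans inter_subset_right

theorem four {M : Type*} [MetricSpace M] {ε : ℝ} (hε : 0 < ε) {n : ℕ} (P : Fin n → Set M)
    (hP : ∀ i, IsCompact (P i)) (hd : ∀ i j, i ≠ j → Disjoint (P i) (P j))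
    (ι : Fin n → E2 → M) (hι : ∀ i, IsOpenEmbedding (ι i)) (hr : ∀ i, P i ⊆ range (ι i)) :
    ∃ C : Bool → Bool → Cl M ε, ∀ i, ∀ p ∈ P i, ∃ a b, p ∈ (C a b).core := by
  obtain ⟨O, hO, hPO, hOd⟩ := sep_fin P hP hd
  have hZ : ∀ i, IsCompact (ι i ⁻¹' P i) := fun i =>
    ((hι i).isInducing.isCompact_preimage_iff (hr i)).2 (hP i)
  have hleb : ∀ i, ∃ g > 0, ∀ z ∈ ι i ⁻¹' P i, ∃ p : M,
      Metric.ball z g ⊆ ι i ⁻¹' (Metric.ball p (ε/2) ∩ O i) := by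
    intro i
    refine lebesgue_number_lemma_of_metric (hZ i) (fun p =>
      (Metric.isOpen_ball.inter (hO i)).preimage (hι i).continuous) ?_
    intro z hz
    refine mem_iUnion.2 ⟨ι i z, Metric.mem_ball_self (by linarith), hPO i hz⟩
  choose g hg hgb using hleb
  have hgb' : ∀ i c, (∃ z ∈ ι i ⁻¹' P i, ‖z - c‖ ≤ g i/4) → ∃ p : M, ∀ w, ‖w - c‖ < g i/2 →
      ι i w ∈ Metric.ball p (ε/2) ∧ ι i w ∈ O i := by
    rintro i c ⟨z, hz, hzc⟩
    obtain ⟨p, hp⟩ := hgb i z hz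
    refine ⟨p, fun w hw => ?_⟩
    have : w ∈ Metric.ball z (g i) := by
      rw [Metric.mem_ball, dist_eq_norm]
      have h1 := norm_sub_le_norm_sub_add_norm_sub w c z
      have h2 := norm_sub_rev z c
      have := hg i
      linarith
    exact hp this
  let Jp : Bool → Bool → Set (Fin n × (ℤ × ℤ)) := fun a b =>
    {q | (decide (Even q.2.1) = a ∧ decide (Even q.2.2) = b) ∧
      ∃ z ∈ ι q.1 ⁻¹' P q.1, ‖z - (g q.1/2) • ip q.2‖ ≤ g q.1/4}
  have hfin : ∀ a b, (Jp a b).Finite := by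
    intro a b
    have hb : ∀ i, ∃ R, ∀ z ∈ ι i ⁻¹' P i, ‖z‖ ≤ R := fun i => (hZ i).isBounded.exists_norm_le
    choose R hR using hb
    refine (Set.finite_iUnion (fun i : Fin n => ((Set.finite_singleton i).prod
      (ip_fin ((R i + g i/4) / (g i/2)))))).subset ?_
    rintro ⟨i, p⟩ ⟨_, z, hz, hzp⟩
    refine mem_iUnion.2 ⟨i, rfl, ?_⟩
    show ‖ip p‖ ≤ _
    have := hg i
    rw [le_div_iff₀ (by positivity)]
    have h1 := hR i z hz
    have h2 : ‖(g i/2) • ip p‖ = g i/2 * ‖ip p‖ := by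
      rw [norm_smul, Real.norm_of_nonneg (by positivity)]
    have h3 := (near_norm hzp).2
    simp only at h3
    linarith
  have hC : ∀ a b, ∃ C : Cl M ε, ∀ (j : Jp a b) w,
      ‖w - (g j.1.1/2) • ip j.1.2‖ ≤ g j.1.1/4 → ι j.1.1 w ∈ C.core := by
    intro a b
    have := (hfin a b).to_subtype
    refine mkCl (J := Jp a b) (fun j => ι j.1.1) (fun j => hι _) (fun j => (g j.1.1/2) • ip j.1.2)
      (fun j => g j.1.1/2) (fun j => g j.1.1/4) (fun j => by have := hg j.1.1; positivity)
      (fun j => by have := hg j.1.1; linarith) ?_ ?_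
    · rintro ⟨⟨i, p⟩, ⟨hpa, hpb⟩, hp⟩ ⟨⟨i', p'⟩, ⟨hpa', hpb'⟩, hp'⟩ hne z w hz hw heq
      simp only at hz hw heq hp hp' hpa hpb hpa' hpb'
      by_cases hi : i = i'
      · subst hi
        have hzw := (hι i).injective heq
        subst hzw
        refine hne ?_
        have hgi := hg i
        have h1 := e2_norm_lt.1 hz
        have h2 := e2_norm_lt.1 hw
        simp only [abs_lt, Prod.fst_sub, Prod.snd_sub, Prod.smul_fst, Prod.smul_snd, smul_eq_mul,
          ip] at h1 h2
        have a1 : |p.1 - p'.1| < 2 := by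
          have : |(p.1:ℝ) - p'.1| < 2 := by rw [abs_lt]; constructor <;> nlinarith
          exact_mod_cast this
        have a2 : |p.2 - p'.2| < 2 := by
          have : |(p.2:ℝ) - p'.2| < 2 := by rw [abs_lt]; constructor <;> nlinarith
          exact_mod_cast this
        have b1 : Even p.1 ↔ Even p'.1 := by
          rw [← hpa'] at hpa; simpa using hpa
        have b2 : Even p.2 ↔ Even p'.2 := by
          rw [← hpb'] at hpb; simpa using hpb
        rw [abs_lt] at a1 a2
        rw [Int.even_iff, Int.even_iff] at b1 b2
        have c1 : p.1 = p'.1 := by omega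
        have c2 : p.2 = p'.2 := by omega
        have : p = p' := Prod.ext c1 c2
        subst this
        rfl
      · obtain ⟨x, hx⟩ := hgb' i _ hp
        obtain ⟨y, hy⟩ := hgb' i' _ hp'
        have h1 := (hx z hz).2
        have h2 := (hy w hw).2
        rw [heq] at h1
        exact Set.disjoint_left.1 (hOd i i' hi) h1 h2
    · rintro ⟨⟨i, p⟩, _, hp⟩ z w hz hw
      simp only at hz hw hp ⊢
      obtain ⟨x, hx⟩ := hgb' i _ hp
      have h1 := (hx z hz).1
      have h2 := (hx w hw).1
      rw [Metric.mem_ball] at h1 h2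
      have := dist_triangle_right (ι i z) (ι i w) x
      linarith
  choose C hC using hC
  refine ⟨C, ?_⟩
  intro i p hp
  obtain ⟨z, rfl⟩ := hr i hp
  have hgi := hg i
  let q : ℤ × ℤ := (round (z.1 / (g i/2)), round (z.2 / (g i/2)))
  have hq : ‖z - (g i/2) • ip q‖ ≤ g i/4 := by
    have key : ∀ x : ℝ, |x - g i/2 * (round (x / (g i/2)) : ℤ)| ≤ g i/4 := by
      intro x
      have h1 := abs_sub_round (x / (g i/2))
      have h2 : x - g i/2 * (round (x / (g i/2)) : ℤ) =
        (g i/2) * (x / (g i/2) - (round (x / (g i/2)) : ℤ)) := by field_simp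
      rw [h2, abs_mul, abs_of_pos (by positivity)]
      nlinarith
    exact e2_norm_le.2 ⟨key z.1, key z.2⟩
  refine ⟨_, _, hC _ _ ⟨(i, q), ⟨rfl, rfl⟩, z, hp, hq⟩ z hq⟩

end HS

namespace HS

/-- open dyadic square -/
def Q (t : ℝ) (k : ℕ) (p : ℤ × ℤ) : Set E2 :=
  {z | ((p.1:ℝ) < 2^k * (z.1 - t) ∧ 2^k * (z.1 - t) < p.1 + 1) ∧
    ((p.2:ℝ) < 2^k * (z.2 - t) ∧ 2^k * (z.2 - t) < p.2 + 1)}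

theorem Q_open (t k p) : IsOpen (Q t k p) := by
  have h1 : Continuous (fun z : E2 => 2^k * (z.1 - t)) := by fun_prop
  have h2 : Continuous (fun z : E2 => 2^k * (z.2 - t)) := by fun_prop
  exact ((isOpen_lt continuous_const h1).inter (isOpen_lt h1 continuous_const)).inter
    ((isOpen_lt continuous_const h2).inter (isOpen_lt h2 continuous_const))

noncomputable def qc (t : ℝ) (k : ℕ) (p : ℤ × ℤ) : E2 :=
  (t + (p.1 + 1/2) / 2^k, t + (p.2 + 1/2) / 2^k)

theorem Q_ball (t k p) (z : E2) : z ∈ Q t k p ↔ ‖z - qc t k p‖ < (1/2) / 2^k := by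
  have key : ∀ (x : ℝ) (m : ℤ), ((m:ℝ) < 2^k * (x - t) ∧ 2^k * (x - t) < m + 1) ↔
      |x - (t + (m + 1/2) / 2^k)| < (1/2) / 2^k := by
    intro x m
    have h2 : (0:ℝ) < 2^k := by positivity
    have h1 : x - (t + (m + 1/2) / 2^k) = (2^k * (x - t) - (m + 1/2)) / 2^k := by
      field_simp
      ring
    rw [h1, abs_div, abs_of_pos h2, div_lt_div_iff_of_pos_right h2, abs_lt]
    constructor
    · rintro ⟨a, b⟩
      constructor <;> linarith
    · rintro ⟨a, b⟩
      constructor <;> linarith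
  rw [e2_norm_lt]
  exact and_congr (key z.1 p.1) (key z.2 p.2)

theorem nest1 {k d : ℕ} {p p' : ℤ} {x y : ℝ} (h1 : (p:ℝ) < 2^(k+d) * x) (h2 : 2^(k+d) * x < p + 1)
    (h3 : (p':ℝ) < 2^k * x) (h4 : 2^k * x < p' + 1)
    (h5 : (p:ℝ) < 2^(k+d) * y) (h6 : 2^(k+d) * y < p + 1) :
    (p':ℝ) < 2^k * y ∧ 2^k * y < p' + 1 := by
  have hN : (0:ℝ) < 2^d := by positivity
  rw [pow_add] at *
  have a1 : (p:ℝ) < 2^d * (p' + 1) := by nlinarith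
  have a2 : 2^d * (p':ℝ) < p + 1 := by nlinarith
  have b1 : p + 1 ≤ 2^d * (p' + 1) := by
    have : p < 2^d * (p' + 1) := by exact_mod_cast a1
    omega
  have b2 : 2^d * p' ≤ p := by
    have : 2^d * p' < p + 1 := by exact_mod_cast a2
    omega
  have c1 : (p:ℝ) + 1 ≤ 2^d * (p' + 1) := by exact_mod_cast b1
  have c2 : 2^d * (p':ℝ) ≤ p := by exact_mod_cast b2
  constructor
  · have : 2^d * (p':ℝ) < 2^d * (2^k * y) := by nlinarith
    exact lt_of_mul_lt_mul_left this hN.le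
  · have : 2^d * (2^k * y) < 2^d * ((p':ℝ) + 1) := by nlinarith
    exact lt_of_mul_lt_mul_left this hN.le

theorem Q_nest {t k k' p p'} (hk : k' ≤ k) {z w : E2} (h1 : z ∈ Q t k p) (h2 : z ∈ Q t k' p')
    (h3 : w ∈ Q t k p) : w ∈ Q t k' p' := by
  obtain ⟨d, rfl⟩ := Nat.exists_eq_add_of_le hk
  exact ⟨nest1 h1.1.1 h1.1.2 h2.1.1 h2.1.2 h3.1.1 h3.1.2,
    nest1 h1.2.1 h1.2.2 h2.2.1 h2.2.2 h3.2.1 h3.2.2⟩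

theorem Q_uniq {t k p p'} {z : E2} (h1 : z ∈ Q t k p) (h2 : z ∈ Q t k p') : p = p' := by
  have key : ∀ (x : ℝ) (m m' : ℤ), (m:ℝ) < x → x < m + 1 → (m':ℝ) < x → x < m' + 1 → m = m' := by
    intro x m m' a b c d
    have e : (m:ℝ) < m' + 1 := by linarith
    have f : (m':ℝ) < m + 1 := by linarith
    have e' : m < m' + 1 := by exact_mod_cast e
    have f' : m' < m + 1 := by exact_mod_cast f
    omega
  exact Prod.ext (key _ _ _ h1.1.1 h1.1.2 h2.1.1 h2.1.2) (key _ _ _ h1.2.1 h1.2.2 h2.2.1 h2.2.2)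

theorem dy {M : Type*} [MetricSpace M] {ε : ℝ} {n : ℕ} (t : ℝ)
    (ι : Fin n → E2 → M) (hι : ∀ i, IsOpenEmbedding (ι i)) (R : Fin n → Set M)
    (hR : ∀ i j, i ≠ j → Disjoint (R i) (R j)) (G : Set (Fin n × ℕ × (ℤ × ℤ)))
    (hG : ∀ g ∈ G, ι g.1 '' Q t g.2.1 g.2.2 ⊆ R g.1)
    (hs : ∀ g ∈ G, ∀ z ∈ Q t g.2.1 g.2.2, ∀ w ∈ Q t g.2.1 g.2.2, dist (ι g.1 z) (ι g.1 w) < ε)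
    {K : Set M} (hK : IsCompact K) (hKG : K ⊆ ⋃ g ∈ G, ι g.1 '' Q t g.2.1 g.2.2) :
    ∃ C : Cl M ε, K ⊆ C.core := by
  classical
  let V : Fin n × ℕ × (ℤ × ℤ) → Set M := fun g => ι g.1 '' Q t g.2.1 g.2.2
  have hV : ∀ g, IsOpen (V g) := fun g => (hι _).isOpenMap _ (Q_open _ _ _)
  obtain ⟨F, hFG, hFf, hF⟩ := hK.elim_finite_subcover_image (fun g _ => hV g) hKG
  let F' : Set (Fin n × ℕ × (ℤ × ℤ)) :=
    {g | g ∈ F ∧ ∀ g' ∈ F, g'.1 = g.1 → (Q t g.2.1 g.2.2 ∩ Q t g'.2.1 g'.2.2).Nonempty →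
      g.2.1 ≤ g'.2.1}
  have hF'f : F'.Finite := hFf.subset (fun g hg => hg.1)
  have hcov : ∀ x ∈ K, ∃ g ∈ F', x ∈ V g := by
    intro x hx
    have hne : {g | g ∈ F ∧ x ∈ V g}.Nonempty := by
      obtain ⟨g, hg, hxg⟩ := mem_iUnion₂.1 (hF hx)
      exact ⟨g, hg, hxg⟩
    obtain ⟨g, ⟨hgF, hxg⟩, hmin⟩ := Set.exists_min_image {g | g ∈ F ∧ x ∈ V g} (fun g => g.2.1)
      (hFf.subset (fun g hg => hg.1)) hne
    refine ⟨g, ⟨hgF, ?_⟩, hxg⟩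
    intro g' hg' h1 ⟨w, hw1, hw2⟩
    by_contra hlt
    push Not at hlt
    obtain ⟨z, hz, hzx⟩ := hxg
    have := hmin g' ⟨hg', z, Q_nest hlt.le hw1 hw2 hz, by rw [h1]; exact hzx⟩
    omega
  have hdis : ∀ g ∈ F', ∀ g' ∈ F', g ≠ g' → ∀ z ∈ Q t g.2.1 g.2.2, ∀ w ∈ Q t g'.2.1 g'.2.2,
      ι g.1 z ≠ ι g'.1 w := by
    intro g hg g' hg' hne z hz w hw heq
    have h1 : g.1 = g'.1 := by
      by_contra hc
      refine Set.disjoint_left.1 (hR _ _ hc) (hG g (hFG hg.1) ⟨z, hz, rfl⟩) ?_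
      rw [heq]
      exact hG g' (hFG hg'.1) ⟨w, hw, rfl⟩
    have h2 : z = w := by
      rw [h1] at heq
      exact (hι _).injective heq
    subst h2
    have h3 := hg.2 g' hg'.1 h1.symm ⟨z, hz, hw⟩
    have h4 := hg'.2 g hg.1 h1 ⟨z, hw, hz⟩
    have h5 : g.2.1 = g'.2.1 := le_antisymm h3 h4
    rw [← h5] at hw
    exact hne (Prod.ext h1 (Prod.ext h5 (Q_uniq hz hw)))
  have hsh : ∀ g : F', ∃ ρ, ρ < (1/2) / 2^g.1.2.1 ∧ ∀ w ∈ Q t g.1.2.1 g.1.2.2, ι g.1.1 w ∈ K →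
      ‖w - qc t g.1.2.1 g.1.2.2‖ ≤ ρ := by
    rintro ⟨g, hg⟩
    have h1 : IsCompact (K \ ⋃ g' ∈ F' \ {g}, V g') :=
      hK.diff (isOpen_biUnion fun g' _ => hV g')
    have h2 : (K \ ⋃ g' ∈ F' \ {g}, V g') ⊆ V g := by
      rintro x ⟨hx, hxn⟩
      obtain ⟨g', hg', hxg'⟩ := hcov x hx
      by_cases h : g' = g
      · rw [← h]; exact hxg'
      · exact absurd (mem_iUnion₂.2 ⟨g', ⟨hg', h⟩, hxg'⟩) hxn
    have h3 : IsCompact (ι g.1 ⁻¹' (K \ ⋃ g' ∈ F' \ {g}, V g')) :=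
      ((hι g.1).isInducing.isCompact_preimage_iff (h2.trans (image_subset_range _ _))).2 h1
    have h4 : ι g.1 ⁻¹' (K \ ⋃ g' ∈ F' \ {g}, V g') ⊆
        Metric.ball (qc t g.2.1 g.2.2) ((1/2) / 2^g.2.1) := by
      intro z hz
      obtain ⟨w, hw, hwz⟩ := h2 hz
      rw [(hι g.1).injective hwz] at hw
      rw [Metric.mem_ball, dist_eq_norm]
      exact (Q_ball _ _ _ _).1 hw
    obtain ⟨ρ, hρ, hsub⟩ := exists_lt_subset_ball h3.isClosed h4
    refine ⟨ρ, hρ, fun w hw hwK => ?_⟩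
    have : w ∈ ι g.1 ⁻¹' (K \ ⋃ g' ∈ F' \ {g}, V g') := by
      refine ⟨hwK, fun hcon => ?_⟩
      obtain ⟨g', ⟨hg', hne⟩, y, hy, hyw⟩ := mem_iUnion₂.1 hcon
      exact hdis g' hg' g hg hne y hy w hw hyw
    have := hsub this
    rw [Metric.mem_ball, dist_eq_norm] at this
    exact this.le
  choose ρ hρ1 hρ2 using hsh
  have := hF'f.to_subtype
  obtain ⟨C, hC⟩ := mkCl (ε := ε) (J := F') (fun g => ι g.1.1) (fun g => hι _)
    (fun g => qc t g.1.2.1 g.1.2.2) (fun g => (1/2) / 2^g.1.2.1) ρ (fun g => by positivity) hρ1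
    (by
      intro g g' hne z w hz hw
      exact hdis g.1 g.2 g'.1 g'.2 (fun h => hne (Subtype.ext h)) z ((Q_ball _ _ _ _).2 hz) w
        ((Q_ball _ _ _ _).2 hw))
    (by
      intro g z w hz hw
      exact hs g.1 (hFG g.2.1) z ((Q_ball _ _ _ _).2 hz) w ((Q_ball _ _ _ _).2 hw))
  refine ⟨C, fun x hx => ?_⟩
  obtain ⟨g, hg, w, hw, rfl⟩ := hcov x hx
  exact hC ⟨g, hg⟩ w (hρ2 ⟨g, hg⟩ w hw hx)

/-- One shift: an open set `D` all of whose compact subsets are covered by one class,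
with complement in a countable union of arcs. -/
theorem shift {M : Type*} [MetricSpace M] {ε : ℝ} (hε : 0 < ε) {n : ℕ} {t : ℝ} (ht0 : 0 < t)
    (ht1 : t < 1)
    (ι : Fin n → E2 → M) (hι : ∀ i, IsOpenEmbedding (ι i)) (hcov : ∀ p, ∃ i z, ‖z‖ < 1 ∧ ι i z = p) :
    ∃ D : Set M, IsOpen D ∧ (∀ K, IsCompact K → K ⊆ D → ∃ C : Cl M ε, K ⊆ C.core) ∧
      ∀ p, p ∉ D → ∃ (i : Fin n) (e : Bool) (m : ℤ) (k : ℕ), p ∈ arc (ι i) e (t + m / 2^k) := by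
  let R : Fin n → Set M := fun m => ι m '' Metric.ball (t,t) 2 \
    ⋃ l ∈ {l | l < m}, ι l '' Metric.closedBall (t,t) 2
  have hRo : ∀ m, IsOpen (R m) := by
    intro m
    have : IsClosed (⋃ l ∈ {l | l < m}, ι l '' Metric.closedBall (t,t) 2) :=
      (Set.toFinite _).isClosed_biUnion fun l _ =>
        ((isCompact_closedBall _ _).image (hι l).continuous).isClosed
    exact ((hι m).isOpenMap _ Metric.isOpen_ball).sdiff this
  have hRd : ∀ i j, i < j → Disjoint (R i) (R j) := by
    intro i j hij
    rw [Set.disjoint_left]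
    rintro x ⟨⟨z, hz, rfl⟩, _⟩ ⟨_, h2⟩
    exact h2 (mem_iUnion₂.2 ⟨i, hij, z, Metric.ball_subset_closedBall hz, rfl⟩)
  have hRd' : ∀ i j, i ≠ j → Disjoint (R i) (R j) := by
    intro i j hij
    rcases lt_or_gt_of_ne hij with h | h
    · exact hRd i j h
    · exact (hRd j i h).symm
  let G : Set (Fin n × ℕ × (ℤ × ℤ)) := {g | ι g.1 '' Q t g.2.1 g.2.2 ⊆ R g.1 ∧
    ∀ z ∈ Q t g.2.1 g.2.2, ∀ w ∈ Q t g.2.1 g.2.2, dist (ι g.1 z) (ι g.1 w) < ε}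
  refine ⟨⋃ g ∈ G, ι g.1 '' Q t g.2.1 g.2.2, ?_, ?_, ?_⟩
  · exact isOpen_biUnion fun g _ => (hι _).isOpenMap _ (Q_open _ _ _)
  · intro K hK hKG
    exact dy t ι hι R hRd' G (fun g hg => hg.1) (fun g hg => hg.2) hK hKG
  · intro p hp
    have hne : {m | p ∈ ι m '' Metric.closedBall (t,t) 2}.Nonempty := by
      obtain ⟨i, z, hz, rfl⟩ := hcov p
      refine ⟨i, z, ?_, rfl⟩
      rw [mem_closedBall_iff_norm]
      rw [e2_norm_lt, abs_lt, abs_lt] at hz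
      refine e2_norm_le.2 ⟨?_, ?_⟩
      · show |z.1 - t| ≤ 2
        rw [abs_le]; constructor <;> linarith
      · show |z.2 - t| ≤ 2
        rw [abs_le]; constructor <;> linarith
    obtain ⟨m, ⟨z, hz, rfl⟩, hmin⟩ := Set.exists_min_image _ id (Set.toFinite _) hne
    rw [mem_closedBall_iff_norm] at hz
    have hz3 : ‖z‖ ≤ 3 := by
      rw [e2_norm_le] at hz ⊢
      simp only [Prod.fst_sub, Prod.snd_sub, abs_le] at hz ⊢
      refine ⟨⟨?_, ?_⟩, ⟨?_, ?_⟩⟩ <;> linarith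
    by_contra hcon
    push Not at hcon
    have hgen : ∀ (e : Bool) (k : ℕ) (i : ℤ), 2^k * (co e z - t) ≠ i := by
      intro e k i heq
      refine hcon m e i k ⟨z, ⟨hz3, ?_⟩, rfl⟩
      rw [← heq]
      have : (2:ℝ)^k ≠ 0 := by positivity
      field_simp
      ring
    have hlt : ‖z - (t,t)‖ < 2 := by
      rw [e2_norm_le] at hz
      have key : ∀ e, |co e z - t| ≠ 2 := by
        intro e h
        rcases (abs_eq (by norm_num)).1 h with h | h
        · exact hgen e 0 2 (by rw [h]; norm_num)
        · exact hgen e 0 (-2) (by rw [h]; norm_num)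
      exact e2_norm_lt.2 ⟨lt_of_le_of_ne hz.1 (key true), lt_of_le_of_ne hz.2 (key false)⟩
    have hzR : ι m z ∈ R m := by
      refine ⟨⟨z, mem_ball_iff_norm.2 hlt, rfl⟩, fun h => ?_⟩
      obtain ⟨l, hl, h⟩ := mem_iUnion₂.1 h
      have := hmin l h
      exact absurd hl (not_lt.2 this)
    have hop : IsOpen (ι m ⁻¹' (R m ∩ Metric.ball (ι m z) (ε/2))) :=
      ((hRo m).inter Metric.isOpen_ball).preimage (hι m).continuous
    obtain ⟨δ, hδ, hball⟩ := Metric.isOpen_iff.1 hop z ⟨hzR, Metric.mem_ball_self (by linarith)⟩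
    obtain ⟨k, hk⟩ := exists_pow_lt_of_lt_one hδ (show (1/2:ℝ) < 1 by norm_num)
    have h2k : (0:ℝ) < 2^k := by positivity
    have hk' : 1 < δ * 2^k := by
      rw [one_div, inv_pow, ← one_div, div_lt_iff₀ h2k] at hk
      exact hk
    let q : ℤ × ℤ := (⌊2^k * (z.1 - t)⌋, ⌊2^k * (z.2 - t)⌋)
    have hzq : z ∈ Q t k q := by
      refine ⟨⟨lt_of_le_of_ne (Int.floor_le _) (hgen true k _).symm, Int.lt_floor_add_one _⟩,
        ⟨lt_of_le_of_ne (Int.floor_le _) (hgen false k _).symm, Int.lt_floor_add_one _⟩⟩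
    have hsub : Q t k q ⊆ Metric.ball z δ := by
      intro w hw
      rw [mem_ball_iff_norm]
      obtain ⟨⟨a1, a2⟩, ⟨a3, a4⟩⟩ := hw
      obtain ⟨⟨b1, b2⟩, ⟨b3, b4⟩⟩ := hzq
      refine e2_norm_lt.2 ⟨?_, ?_⟩
      · show |w.1 - z.1| < δ
        rw [abs_lt]
        constructor <;> nlinarith
      · show |w.2 - z.2| < δ
        rw [abs_lt]
        constructor <;> nlinarith
    refine hp (mem_iUnion₂.2 ⟨(m, k, q), ⟨?_, ?_⟩, z, hzq, rfl⟩)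
    · rintro _ ⟨w, hw, rfl⟩
      exact (hball (hsub hw)).1
    · intro w hw w' hw'
      have h1 : dist (ι m w) (ι m z) < ε/2 := (hball (hsub hw)).2
      have h2 : dist (ι m w') (ι m z) < ε/2 := (hball (hsub hw')).2
      have := dist_triangle_right (ι m w) (ι m w') (ι m z)
      show dist (ι m w) (ι m w') < ε
      linarith

theorem cover6 {M : Type*} [MetricSpace M] [CompactSpace M] {ε : ℝ} (hε : 0 < ε) {n : ℕ}
    (ι : Fin n → E2 → M) (hι : ∀ i, IsOpenEmbedding (ι i)) (hcov : ∀ p, ∃ i z, ‖z‖ < 1 ∧ ι i z = p) :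
    ∃ C : Fin 6 → Cl M ε, ∀ p, ∃ k, p ∈ (C k).core := by
  obtain ⟨D, hDo, hDK, hD⟩ := shift (t := 1/2) hε (by norm_num) (by norm_num) ι hι hcov
  let I := Fin n × Bool × ℤ × ℕ
  let B : Set ℝ := ⋃ i : I × I, {b | ¬ IsTotallyDisconnected
    (arc (ι i.1.1) i.1.2.1 (1/2 + i.1.2.2.1 / 2^i.1.2.2.2) ∩
      arc (ι i.2.1) i.2.2.1 (b + i.2.2.2.1 / 2^i.2.2.2.2))}
  have hB : B.Countable := by
    refine countable_iUnion fun i => ?_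
    have := arc_bad (hι i.1.1) (hι i.2.1) i.1.2.1 i.2.2.1 (1/2 + i.1.2.2.1 / 2^i.1.2.2.2)
    exact this.preimage (f := fun b => b + (i.2.2.2.1 / 2^i.2.2.2.2 : ℝ)) (add_left_injective _)
  obtain ⟨b, hb01, hbB⟩ : ∃ b, b ∈ Ioo (0:ℝ) 1 ∧ b ∉ B := by
    by_contra hcon
    push Not at hcon
    have h1 : (Ioo (0:ℝ) 1).Countable := hB.mono hcon
    exact absurd (Cardinal.Real.Ioo_countable_iff.1 h1) (by norm_num)
  obtain ⟨D', hDo', hDK', hD'⟩ := shift (t := b) hε hb01.1 hb01.2 ι hι hcov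
  let X : Set M := (D ∪ D')ᶜ
  have hX : IsCompact X := (hDo.union hDo').isClosed_compl.isCompact
  obtain ⟨N, P, r, hP, hPU, hPd, hXP⟩ := td_part hX (fun i : I × I =>
    (arc (ι i.1.1) i.1.2.1 (1/2 + i.1.2.2.1 / 2^i.1.2.2.2) ∩
      arc (ι i.2.1) i.2.2.1 (b + i.2.2.2.1 / 2^i.2.2.2.2)))
    (fun i => ((arc_compact (hι _).continuous _ _).isClosed).inter
      ((arc_compact (hι _).continuous _ _).isClosed))
    (fun i => by
      by_contra hc
      exact hbB (mem_iUnion.2 ⟨i, hc⟩))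
    (by
      intro x hx
      have h1 : x ∉ D := fun h => hx (Or.inl h)
      have h2 : x ∉ D' := fun h => hx (Or.inr h)
      obtain ⟨i, e, m, k, hm⟩ := hD x h1
      obtain ⟨i', e', m', k', hm'⟩ := hD' x h2
      exact mem_iUnion.2 ⟨((i, e, m, k), (i', e', m', k')), hm, hm'⟩)
    (fun i : Fin n => range (ι i)) (fun i => (hι i).isOpen_range)
    (fun x _ => by
      obtain ⟨i, z, _, h⟩ := hcov x
      exact ⟨i, z, h⟩)
  obtain ⟨C4, hC4⟩ := four hε P hP hPd (fun i => ι (r i)) (fun i => hι _) hPU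
  let N4 : Set M := ⋃ a, ⋃ b, (C4 a b).core
  have hN4 : IsOpen N4 := isOpen_iUnion fun a => isOpen_iUnion fun b => (C4 a b).core_open
  obtain ⟨K, K', hK, hK', hKD, hKD', hKK⟩ := (hN4.isClosed_compl.isCompact).binary_compact_cover
    hDo hDo' (by
      intro x hx
      by_contra hc
      obtain ⟨i, hi⟩ := mem_iUnion.1 (hXP (show x ∈ X from hc))
      obtain ⟨a, b, hab⟩ := hC4 i x hi
      exact hx (mem_iUnion₂.2 ⟨a, b, hab⟩))
  obtain ⟨C, hC⟩ := hDK K hK hKD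
  obtain ⟨C', hC'⟩ := hDK' K' hK' hKD'
  refine ⟨![C, C', C4 false false, C4 false true, C4 true false, C4 true true], fun p => ?_⟩
  by_cases hp : p ∈ N4
  · obtain ⟨a, b, hab⟩ := mem_iUnion₂.1 hp
    cases a <;> cases b
    · exact ⟨2, hab⟩
    · exact ⟨3, hab⟩
    · exact ⟨4, hab⟩
    · exact ⟨5, hab⟩
  · have : p ∈ K ∪ K' := by rw [← hKK]; exact hp
    rcases this with h | h
    · exact ⟨0, hC h⟩
    · exact ⟨1, hC' h⟩

end HS

namespace HS

theorem charts (M : Type*) [TopologicalSpace M] [CompactSpace M]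
    [ChartedSpace (EuclideanSpace ℝ (Fin 2)) M] :
    ∃ (n : ℕ) (ι : Fin n → E2 → M), (∀ i, IsOpenEmbedding (ι i)) ∧
      ∀ p, ∃ i z, ‖z‖ < 1 ∧ ι i z = p := by
  let L : E2 ≃ₜ EuclideanSpace ℝ (Fin 2) :=
    ((EuclideanSpace.equiv (Fin 2) ℝ).trans
      (ContinuousLinearEquiv.finTwoArrow ℝ ℝ)).symm.toHomeomorph
  have hL : L 0 = 0 := by
    simp [L]
  have hp : ∀ p : M, ∃ ι : E2 → M, IsOpenEmbedding ι ∧ ι 0 = p := by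
    intro p
    let e := chartAt (EuclideanSpace ℝ (Fin 2)) p
    obtain ⟨r, hr, hb⟩ := Metric.isOpen_iff.1 e.open_target (e p)
      (e.map_source (mem_chart_source _ p))
    let u := (OpenPartialHomeomorph.univBall (e p) r).trans e.symm
    have hu : u.source = univ := by
      ext x
      simp only [u, OpenPartialHomeomorph.trans_source, OpenPartialHomeomorph.univBall_source,
        univ_inter, mem_univ, iff_true, mem_preimage, OpenPartialHomeomorph.symm_source]
      apply hb
      rw [← OpenPartialHomeomorph.univBall_target (e p) hr]
      exact OpenPartialHomeomorph.map_source _ (by simp)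
    refine ⟨u ∘ L, (u.isOpenEmbedding hu).comp L.isOpenEmbedding, ?_⟩
    simp only [Function.comp, hL, u, OpenPartialHomeomorph.coe_trans,
      OpenPartialHomeomorph.univBall_apply_zero]
    exact e.left_inv (mem_chart_source _ p)
  choose ι hι h0 using hp
  obtain ⟨t, ht⟩ := isCompact_univ.elim_finite_subcover (fun p => ι p '' Metric.ball 0 1)
    (fun p => (hι p).isOpenMap _ Metric.isOpen_ball)
    (fun p _ => mem_iUnion.2 ⟨p, 0, by simp, h0 p⟩)
  refine ⟨t.card, fun i => ι (t.equivFin.symm i), fun i => hι _, fun p => ?_⟩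
  obtain ⟨q, hq, z, hz, hzp⟩ := mem_iUnion₂.1 (ht (mem_univ p))
  refine ⟨t.equivFin ⟨q, hq⟩, z, by simpa using hz, by simpa using hzp⟩

theorem fin_min {J : Type*} [Finite J] (δ : J → ℝ) (h : ∀ j, 0 < δ j) :
    ∃ d > 0, ∀ j, d ≤ δ j := by
  cases isEmpty_or_nonempty J
  · exact ⟨1, one_pos, fun j => isEmptyElim j⟩
  · obtain ⟨i, hi⟩ := Finite.exists_min δ
    exact ⟨δ i, h i, hi⟩

section
variable {M : Type*} [MetricSpace M]

theorem ball_compact (r : ℝ) : IsCompact {z : E2 | ‖z‖ ≤ r} := by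
  have h : {z : E2 | ‖z‖ ≤ r} = Metric.closedBall 0 r := by
    ext z; rw [mem_closedBall_zero_iff]; rfl
  rw [h]
  exact isCompact_closedBall (0:E2) r

theorem loc_unif {ι : E2 → M} (h : IsOpenEmbedding ι) {d : ℝ} (hd : 0 < d) :
    ∃ δ > 0, ∀ z, ‖z‖ ≤ 3 → ∀ y, dist y (ι z) ≤ δ → ∃ w, ι w = y ∧ ‖w - z‖ ≤ d := by
  obtain ⟨δ, hδ, H⟩ := lebesgue_number_lemma_of_metric ((ball_compact 3).image h.continuous)
    (c := fun z : E2 => ι '' Metric.ball z (d/2)) (fun z => h.isOpenMap _ Metric.isOpen_ball)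
    (by
      rintro _ ⟨z, _, rfl⟩
      exact mem_iUnion.2 ⟨z, z, Metric.mem_ball_self (by linarith), rfl⟩)
  refine ⟨δ/2, by linarith, fun z hz y hy => ?_⟩
  obtain ⟨c, hc⟩ := H _ ⟨z, hz, rfl⟩
  obtain ⟨w, hw, hwy⟩ := hc (show y ∈ Metric.ball (ι z) δ by rw [Metric.mem_ball]; linarith)
  obtain ⟨z', hz', hzz⟩ := hc (Metric.mem_ball_self hδ)
  rw [h.injective hzz] at hz'
  refine ⟨w, hwy, ?_⟩
  rw [Metric.mem_ball] at hw hz'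
  rw [← dist_eq_norm]
  have := dist_triangle_right w z c
  linarith

theorem img_unif {ι : E2 → M} (h : Continuous ι) {s : ℝ} (hs : 0 < s) :
    ∃ δ > 0, ∀ z w, ‖z‖ ≤ 3 → ‖w‖ ≤ 3 → ‖z - w‖ ≤ δ → dist (ι z) (ι w) ≤ s := by
  have := (ball_compact 3).uniformContinuousOn_of_continuous h.continuousOn
  obtain ⟨δ, hδ, H⟩ := Metric.uniformContinuousOn_iff.1 this s hs
  refine ⟨δ/2, by linarith, fun z w hz hw hzw => (H z hz w hw ?_).le⟩
  rw [dist_eq_norm]; linarith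

/-- `F` preserves each piece and is the identity off the pieces -/
def Sp {J : Type*} (S : J → Set M) (F : M ≃ₜ M) : Prop :=
  (∀ x, (∀ j, x ∉ S j) → F x = x) ∧ ∀ j, ∀ x ∈ S j, F x ∈ S j

def pc {ε : ℝ} (C : Cl M ε) (r : ℝ) (j : C.J) : Set M := C.ι j '' {z | ‖z‖ ≤ r}

theorem pc_disj {ε : ℝ} (C : Cl M ε) {r : ℝ} (hr : r ≤ 3) (i j : C.J) (h : i ≠ j) :
    Disjoint (pc C r i) (pc C r j) := by
  rw [Set.disjoint_left]
  rintro _ ⟨z, hz, rfl⟩ ⟨w, hw, hwz⟩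
  have hz : ‖z‖ ≤ r := hz
  have hw : ‖w‖ ≤ r := hw
  exact C.disj i j h z w (hz.trans hr) (hw.trans hr) hwz.symm

noncomputable def toE {ι : E2 → M} (h : IsOpenEmbedding ι) : OpenPartialHomeomorph E2 M :=
  h.toOpenPartialHomeomorph ι

/-- extend a family of homeos of `E2` supported in the ball of radius `r` -/
theorem ext_class {ε : ℝ} (C : Cl M ε) {r : ℝ} (hr : r ≤ 3) (f : C.J → E2 ≃ₜ E2)
    (hf : ∀ j z, r ≤ ‖z‖ → f j z = z) :
    ∃ F : M ≃ₜ M, Sp (pc C r) F ∧ ∀ j z, ‖z‖ ≤ 3 → F (C.ι j z) = C.ι j (f j z) := by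
  have := C.fin
  have hψ : ∀ j, ∃ ψ : M ≃ₜ M, (∀ z, ψ (C.ι j z) = C.ι j (f j z)) ∧
      ∀ y, y ∉ pc C r j → ψ y = y := by
    intro j
    obtain ⟨ψ, h1, _, h3⟩ := ext_homeo (toE (C.emb j)) (ball_compact r) (by simp [toE]) (f j)
      (fun x hx => hf j x (le_of_lt (not_le.1 hx)))
    exact ⟨ψ, fun z => h1 z (by simp [toE]), h3⟩
  choose ψ h1 h2 using hψ
  obtain ⟨F, hF1, hF2⟩ := glue_finite ψ (pc C r) (pc_disj C hr) h2
  have hval : ∀ j z, ‖z‖ ≤ 3 → F (C.ι j z) = C.ι j (f j z) := by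
    intro j z hz
    by_cases hzr : ‖z‖ ≤ r
    · rw [hF1 j _ ⟨z, hzr, rfl⟩, h1]
    · rw [hf j z (le_of_lt (not_le.1 hzr))]
      refine hF2 _ fun i => ?_
      rintro ⟨w, hw, hwz⟩
      have hw : ‖w‖ ≤ r := hw
      by_cases hij : i = j
      · subst hij
        rw [(C.emb i).injective hwz] at hw
        exact hzr hw
      · exact C.disj i j hij w z (hw.trans hr) hz hwz
  refine ⟨F, ⟨hF2, ?_⟩, hval⟩
  rintro j _ ⟨z, hz, rfl⟩
  have hz' : ‖z‖ ≤ r := hz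
  rw [hval j z (hz'.trans hr)]
  refine ⟨_, ?_, rfl⟩
  show ‖f j z‖ ≤ r
  by_contra hc
  push Not at hc
  have := (f j).injective (hf j _ hc.le)
  rw [this] at hc
  linarith

theorem step [CompactSpace M] {ε : ℝ} (C : Cl M ε) {A Ω : Set M} (hA : IsCompact A) (hΩ : IsOpen Ω)
    (hAΩ : A ⊆ Ω) {s : ℝ} (hs : 0 < s) :
    ∃ δ > 0, ∀ g : M ≃ₜ M, (∀ x, dist (g x) x ≤ δ) → (∀ x ∈ Ω, g x = x) →
      ∃ F : M ≃ₜ M, Sp (pc C 2) F ∧ (∀ x ∈ A, F x = x) ∧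
        (∀ j z, ‖z‖ ≤ 1 → F (C.ι j z) = g (C.ι j z)) ∧ ∀ x, dist (F x) x ≤ s := by
  have := C.fin
  have hj : ∀ j, ∃ δ > 0, ∀ g : M ≃ₜ M, (∀ x, dist (g x) x ≤ δ) → (∀ x ∈ Ω, g x = x) →
      ∃ f : E2 ≃ₜ E2, (∀ z, 2 ≤ ‖z‖ → f z = z) ∧ (∀ z, ‖z‖ ≤ 2 → C.ι j z ∈ A → f z = z) ∧
        (∀ z, ‖z‖ ≤ 1 → C.ι j (f z) = g (C.ι j z)) ∧
        ∀ z, ‖z‖ ≤ 2 → dist (C.ι j (f z)) (C.ι j z) ≤ s := by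
    intro j
    have hι := C.emb j
    obtain ⟨s', hs', hsi⟩ := img_unif hι.continuous hs
    have hBc : IsCompact ({z : E2 | ‖z‖ ≤ 2} ∩ C.ι j ⁻¹' A) :=
      (ball_compact 2).inter_right (hA.isClosed.preimage hι.continuous)
    obtain ⟨η, hη, hηs⟩ := hBc.exists_cthickening_subset_open (hΩ.preimage hι.continuous)
      (fun z hz => hAΩ hz.2)
    obtain ⟨d, hd, hEK⟩ := EK hη (lt_min hs' one_pos)
    obtain ⟨δ, hδ, hloc⟩ := loc_unif hι hd
    refine ⟨δ, hδ, fun g hg hgΩ => ?_⟩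
    have hg' : ∀ x, dist (g.symm x) x ≤ δ := by
      intro x
      have := hg (g.symm x)
      rw [g.apply_symm_apply, dist_comm] at this
      exact this
    let e := toE hι
    have he : ∀ z, e z = C.ι j z := fun z => rfl
    have hes : ∀ z, e.symm (C.ι j z) = z := fun z => by
      rw [← he]; exact e.left_inv (by simp [e, toE])
    have het : ∀ z, C.ι j z ∈ e.target := fun z => by
      rw [← he]; exact e.map_source (by simp [e, toE])
    let a : OpenPartialHomeomorph E2 E2 := (e.transHomeomorph g).trans e.symm
    have ha : ∀ z, a z = e.symm (g (C.ι j z)) := fun z => rfl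
    have ha' : ∀ z, a.symm z = e.symm (g.symm (C.ι j z)) := fun z => rfl
    have hN : NI a {z | ‖z‖ ≤ 3} d := by
      intro z hz
      have hz : ‖z‖ ≤ 3 := hz
      obtain ⟨w, hw, hwz⟩ := hloc z hz _ (hg (C.ι j z))
      obtain ⟨w', hw', hwz'⟩ := hloc z hz _ (hg' (C.ι j z))
      refine ⟨?_, ?_, ?_, ?_⟩
      · refine ⟨by simp [e, toE], ?_⟩
        show g (C.ι j z) ∈ e.target
        rw [← hw]; exact het w
      · show z ∈ e.symm.target ∧ e z ∈ (g.symm : M → M) ⁻¹' e.target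
        refine ⟨by simp [e, toE], ?_⟩
        show g.symm (C.ι j z) ∈ e.target
        rw [← hw']; exact het w'
      · rw [ha, ← hw, hes]; exact hwz
      · rw [ha', ← hw', hes]; exact hwz'
    obtain ⟨f, hf1, hf2, hf3, hf4⟩ := hEK ({z : E2 | ‖z‖ ≤ 2} ∩ C.ι j ⁻¹' A) a hN (by
      intro b hb z hzb _
      have : C.ι j z ∈ Ω := hηs (Metric.mem_cthickening_of_dist_le z b _ _ hb
        (by rw [dist_eq_norm]; exact hzb))
      rw [ha, hgΩ _ this, hes])
    refine ⟨f, hf1, fun z hz hzA => hf4 z ⟨hz, hzA⟩, ?_, ?_⟩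
    · intro z hz
      obtain ⟨w, hw, hwz⟩ := hloc z (by linarith) _ (hg (C.ι j z))
      rw [hf2 z hz, ha, ← hw, hes]
    · intro z hz
      have h1 := hf3 z
      have h2 := near_norm (h1.trans (min_le_right _ _))
      exact hsi _ _ (by linarith) (by linarith) (h1.trans (min_le_left _ _))
  choose δ hδ H using hj
  obtain ⟨d, hd, hdj⟩ := fin_min δ hδ
  refine ⟨d, hd, fun g hg hgΩ => ?_⟩
  choose f h1 h2 h3 h4 using fun j => H j g (fun x => (hg x).trans (hdj j)) hgΩ
  obtain ⟨F, hF, hv⟩ := ext_class C (by norm_num) f h1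
  have hcase : ∀ x, F x = x ∨ ∃ j z, ‖z‖ ≤ 2 ∧ x = C.ι j z := by
    intro x
    by_cases h : ∀ j, x ∉ pc C 2 j
    · exact Or.inl (hF.1 x h)
    · push Not at h
      obtain ⟨j, z, hz, rfl⟩ := h
      exact Or.inr ⟨j, z, hz, rfl⟩
  refine ⟨F, hF, ?_, ?_, ?_⟩
  · intro x hx
    rcases hcase x with h | ⟨j, z, hz, rfl⟩
    · exact h
    · rw [hv j z (by linarith), h2 j z hz hx]
  · intro j z hz
    rw [hv j z (by linarith), h3 j z hz]
  · intro x
    rcases hcase x with h | ⟨j, z, hz, rfl⟩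
    · rw [h, dist_self]; exact hs.le
    · rw [hv j z (by linarith)]; exact h4 j z hz

def Pr {ε : ℝ} (C : ℕ → Cl M ε) : ℕ → (M ≃ₜ M) → Prop
  | 0, L => L = 1
  | k+1, L => ∃ L' F, Pr C k L' ∧ Sp (pc (C k) 2) F ∧ L = L' * F

theorem frag [CompactSpace M] {ε : ℝ} (C : ℕ → Cl M ε) (k : ℕ) : ∀ s > 0, ∃ δ > 0,
    ∀ g : M ≃ₜ M, (∀ x, dist (g x) x ≤ δ) → ∃ L, Pr C k L ∧ (∀ x, dist ((L⁻¹ * g) x) x ≤ s) ∧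
      ∀ l < k, ∀ j z, ‖z‖ < 21/20 - k/20 → (L⁻¹ * g) ((C l).ι j z) = (C l).ι j z := by
  induction k with
  | zero =>
    intro s hs
    refine ⟨s, hs, fun g hg => ⟨1, rfl, ?_, ?_⟩⟩
    · intro x; simpa using hg x
    · intro l hl; omega
  | succ k ih =>
    intro s hs
    have hfin : ∀ l, Finite (C l).J := fun l => (C l).fin
    let A : Set M := ⋃ l : Fin k, ⋃ j, (C l).ι j '' {z | ‖z‖ ≤ 1 - k/20}
    let Ω : Set M := ⋃ l : Fin k, ⋃ j, (C l).ι j '' {z | ‖z‖ < 21/20 - k/20}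
    have hA : IsCompact A := isCompact_iUnion fun l => isCompact_iUnion fun j =>
      (ball_compact _).image ((C l).emb j).continuous
    have hΩ : IsOpen Ω := isOpen_iUnion fun l => isOpen_iUnion fun j =>
      ((C l).emb j).isOpenMap _ (isOpen_lt continuous_norm continuous_const)
    have hAΩ : A ⊆ Ω := by
      refine iUnion_mono fun l => iUnion_mono fun j => image_mono ?_
      intro z hz
      have hz : ‖z‖ ≤ 1 - k/20 := hz
      show ‖z‖ < _
      linarith
    obtain ⟨δ1, hδ1, H1⟩ := step (C k) hA hΩ hAΩ (half_pos hs)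
    obtain ⟨δ, hδ, H⟩ := ih (min δ1 (s/2)) (lt_min hδ1 (half_pos hs))
    refine ⟨δ, hδ, fun g hg => ?_⟩
    obtain ⟨L, hL, hL1, hL2⟩ := H g hg
    obtain ⟨F, hF, hFA, hFg, hFs⟩ := H1 (L⁻¹ * g) (fun x => (hL1 x).trans (min_le_left _ _)) (by
      intro x hx
      simp only [Ω, mem_iUnion] at hx
      obtain ⟨l, j, z, hz, rfl⟩ := hx
      exact hL2 l l.2 j z hz)
    have hinv : ∀ x, ((L * F)⁻¹ * g) x = F.symm ((L⁻¹ * g) x) := by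
      intro x
      rw [mul_inv_rev, mul_assoc]; rfl
    refine ⟨L * F, ⟨L, F, hL, hF, rfl⟩, ?_, ?_⟩
    · intro x
      rw [hinv]
      have h1 : dist (F.symm ((L⁻¹ * g) x)) ((L⁻¹ * g) x) ≤ s/2 := by
        have := hFs (F.symm ((L⁻¹ * g) x))
        rw [F.apply_symm_apply, dist_comm] at this
        exact this
      have h2 := (hL1 x).trans (min_le_right _ _)
      have := dist_triangle (F.symm ((L⁻¹ * g) x)) ((L⁻¹ * g) x) x
      linarith
    · intro l hl j z hz
      push_cast at hz
      rw [hinv, F.symm_apply_eq]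
      have hk0 : (0:ℝ) ≤ k := Nat.cast_nonneg k
      rcases Nat.lt_succ_iff_lt_or_eq.1 hl with hl' | rfl
      · have hm : (C l).ι j z ∈ A := by
          refine mem_iUnion₂.2 ⟨⟨l, hl'⟩, j, z, ?_, rfl⟩
          show ‖z‖ ≤ _
          linarith
        rw [hFA _ hm]
        exact hL2 l hl' j z (by linarith)
      · rw [hFg j z (by linarith)]

theorem frag6 [CompactSpace M] {ε : ℝ} (C : Fin 6 → Cl M ε) (hC : ∀ p, ∃ k, p ∈ (C k).core) :
    ∃ C' : ℕ → Cl M ε, ∃ δ > 0, ∀ g : M ≃ₜ M, (∀ x, dist (g x) x ≤ δ) → Pr C' 6 g := by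
  let C' : ℕ → Cl M ε := fun k => C (Fin.ofNat 6 k)
  refine ⟨C', ?_⟩
  obtain ⟨δ, hδ, H⟩ := frag C' 6 1 one_pos
  refine ⟨δ, hδ, fun g hg => ?_⟩
  obtain ⟨L, hL, _, h2⟩ := H g hg
  have : L⁻¹ * g = 1 := by
    ext x
    obtain ⟨k, j, z, hz, rfl⟩ := hC x
    have hk : C k = C' k := by
      simp [C']
    have key : ∀ c : Cl M ε, c = C' k → ∀ (j : c.J) z, ‖z‖ < 1/2 →
        (L⁻¹ * g) (c.ι j z) = c.ι j z := by
      rintro c rfl j z hz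
      exact h2 k k.2 j z (by push_cast; linarith)
    exact key _ hk j z hz
  rw [inv_mul_eq_one] at this
  rw [← this]; exact hL

end
end HS

namespace HS
section
variable {M : Type*} [MetricSpace M]

theorem Sp_inv {J : Type*} {S : J → Set M} (hd : ∀ i j, i ≠ j → Disjoint (S i) (S j))
    {f : M ≃ₜ M} (hf : Sp S f) : Sp S f⁻¹ := by
  have h1 : ∀ x, (∀ j, x ∉ S j) → f⁻¹ x = x := by
    intro x hx
    show f.symm x = x
    rw [Homeomorph.symm_apply_eq, hf.1 x hx]
  refine ⟨h1, fun j x hx => ?_⟩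
  have e : f (f⁻¹ x) = x := f.apply_symm_apply x
  by_contra hc
  by_cases h : ∀ j, f⁻¹ x ∉ S j
  · have := hf.1 _ h
    rw [e] at this
    exact h j (this ▸ hx)
  · push Not at h
    obtain ⟨k, hk⟩ := h
    have h2 := hf.2 k _ hk
    rw [e] at h2
    by_cases hkj : k = j
    · exact hc (hkj ▸ hk)
    · exact disjoint_left.1 (hd _ _ hkj) h2 hx

theorem Sp_one {J : Type*} (S : J → Set M) : Sp S (1 : M ≃ₜ M) :=
  ⟨fun _ _ => rfl, fun _ _ h => h⟩

theorem Sp_mul {J : Type*} {S : J → Set M} {f g : M ≃ₜ M} (hf : Sp S f) (hg : Sp S g) :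
    Sp S (f * g) :=
  ⟨fun x hx => by show f (g x) = x; rw [hg.1 x hx, hf.1 x hx],
   fun j x hx => hf.2 j _ (hg.2 j x hx)⟩

theorem Sp_conj {J : Type*} {S S' : J → Set M} {f g : M ≃ₜ M} (hf : Sp S f)
    (h1 : ∀ j, ∀ x ∈ S j, g x ∈ S' j) (h2 : ∀ j, ∀ x ∈ S' j, g⁻¹ x ∈ S j) :
    Sp S' (g * f * g⁻¹) := by
  refine ⟨fun x hx => ?_, fun j x hx => h1 j _ (hf.2 j _ (h2 j x hx))⟩
  show g (f (g.symm x)) = x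
  have e : g (g.symm x) = x := g.apply_symm_apply x
  rw [hf.1, e]
  intro j hj
  have := h1 j _ hj
  rw [e] at this
  exact hx j this

variable {W : Set (M ≃ₜ M)}

theorem inv_mem_pow (hW : W⁻¹ = W) {n : ℕ} {w : M ≃ₜ M} (h : w ∈ W ^ n) : w⁻¹ ∈ W ^ n := by
  rw [← Set.mem_inv, ← inv_pow, hW]
  exact h

theorem coset_sq (hW : W⁻¹ = W) {c w1 w2 : M ≃ₜ M} (h1 : w1 ∈ c • W) (h2 : w2 ∈ c • W) :
    w2⁻¹ * w1 ∈ W ^ 2 := by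
  obtain ⟨a, ha, rfl⟩ := h1
  obtain ⟨b, hb, rfl⟩ := h2
  have : (c • b)⁻¹ * (c • a) = b⁻¹ * a := by simp [smul_eq_mul, mul_inv_rev, mul_assoc]
  show (c • b)⁻¹ * (c • a) ∈ W ^ 2
  rw [this, pow_two]
  exact Set.mul_mem_mul (by rw [← hW]; simpa using hb) ha

theorem comm_main {J : Type*} (hW : W⁻¹ = W) (c : ℕ → M ≃ₜ M) (hc : (⋃ n, c n • W) = Set.univ)
    (P : ℕ → J → Set M)
    (hP : ∀ i j i' j' x, x ∈ P i j → x ∈ P i' j' → i = i' ∧ j = j')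
    (hGL : ∀ f : ℕ → M ≃ₜ M, (∀ i, Sp (P i) (f i)) → ∃ F : M ≃ₜ M,
      (∀ i j, ∀ x ∈ P i j, F x = f i x) ∧ (∀ x, (∀ i j, x ∉ P i j) → F x = x)) :
    ∃ q, ∀ a b, Sp (P q) a → Sp (P q) b → a * b * a⁻¹ * b⁻¹ ∈ W ^ 8 := by
  have hd : ∀ q i j, i ≠ j → Disjoint (P q i) (P q j) := fun q i j hij =>
    disjoint_left.2 fun x h1 h2 => hij (hP _ _ _ _ x h1 h2).2
  have hcov : ∀ F : M ≃ₜ M, ∃ n, F ∈ c n • W := fun F => by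
    have : F ∈ ⋃ n, c n • W := by rw [hc]; trivial
    exact mem_iUnion.1 this
  -- first claim
  have claim1 : ∃ n, ∀ f : ℕ → M ≃ₜ M, (∀ i, Sp (P (Nat.pair n i)) (f i)) →
      ∃ w ∈ c n • W, ∀ i j, ∀ x ∈ P (Nat.pair n i) j, w x = f i x := by
    by_contra hcon
    push Not at hcon
    choose f hf hbad using hcon
    obtain ⟨F, hF, -⟩ := hGL (fun q => f q.unpair.1 q.unpair.2) (fun q => by
      have := hf q.unpair.1 q.unpair.2
      rwa [Nat.pair_unpair] at this)
    obtain ⟨n, hn⟩ := hcov F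
    obtain ⟨i, j, x, hx, hne⟩ := hbad n F hn
    apply hne
    rw [hF _ _ _ hx]
    simp
  obtain ⟨n, hn⟩ := claim1
  have claim1' : ∀ f : ℕ → M ≃ₜ M, (∀ i, Sp (P (Nat.pair n i)) (f i)) →
      ∃ w ∈ W ^ 2, ∀ i j, ∀ x ∈ P (Nat.pair n i) j, w x = f i x := by
    intro f hf
    obtain ⟨w1, h1, h1'⟩ := hn f hf
    obtain ⟨w2, h2, h2'⟩ := hn (fun _ => 1) (fun _ => Sp_one _)
    refine ⟨_, coset_sq hW h1 h2, fun i j x hx => ?_⟩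
    show w2.symm (w1 x) = f i x
    rw [Homeomorph.symm_apply_eq, h1' i j x hx]
    exact (h2' i j _ ((hf i).2 j x hx)).symm
  have claim2 : ∃ i, ∀ b, Sp (P (Nat.pair n i)) b → ∃ F ∈ c i • W,
      (∀ j, ∀ x ∈ P (Nat.pair n i) j, F x = b x) ∧
      Sp (fun p : ℕ × J => P (Nat.pair n p.1) p.2) F := by
    by_contra hcon
    push Not at hcon
    choose b hb hbad using hcon
    obtain ⟨F, hF, hF'⟩ := hGL (fun q => if q.unpair.1 = n then b q.unpair.2 else 1) (fun q => by
      split_ifs with h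
      · have := hb q.unpair.2
        rwa [← h, Nat.pair_unpair] at this
      · exact Sp_one _)
    have hFb : ∀ i j, ∀ x ∈ P (Nat.pair n i) j, F x = b i x := by
      intro i j x hx
      rw [hF _ _ _ hx]
      simp
    obtain ⟨i, hi⟩ := hcov F
    refine hbad i F hi (hFb i) ⟨fun x hx => ?_, fun p x hx => ?_⟩
    · by_cases h : ∀ i j, x ∉ P i j
      · exact hF' x h
      · push Not at h
        obtain ⟨q, j, hq⟩ := h
        rw [hF _ _ _ hq]
        by_cases hqn : q.unpair.1 = n
        · exfalso
          apply hx (q.unpair.2, j)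
          show x ∈ P (Nat.pair n q.unpair.2) j
          rwa [← hqn, Nat.pair_unpair]
        · rw [if_neg hqn]; rfl
    · have hx : x ∈ P (Nat.pair n p.1) p.2 := hx
      show F x ∈ P (Nat.pair n p.1) p.2
      rw [hFb _ _ _ hx]
      exact (hb p.1).2 _ _ hx
  obtain ⟨i, hi⟩ := claim2
  have hdn : ∀ p p' : ℕ × J, p ≠ p' → Disjoint (P (Nat.pair n p.1) p.2)
      (P (Nat.pair n p'.1) p'.2) := by
    intro p p' hpp
    refine disjoint_left.2 fun x h1 h2 => hpp ?_
    obtain ⟨e1, e2⟩ := hP _ _ _ _ x h1 h2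
    have := (Nat.pair_eq_pair.1 e1).2
    exact Prod.ext this e2
  have claim2' : ∀ b, Sp (P (Nat.pair n i)) b → ∃ F ∈ W ^ 2,
      (∀ j, ∀ x ∈ P (Nat.pair n i) j, F x = b x) ∧
      Sp (fun p : ℕ × J => P (Nat.pair n p.1) p.2) F := by
    intro b hb
    obtain ⟨w1, h1, h1', h1''⟩ := hi b hb
    obtain ⟨w2, h2, h2', h2''⟩ := hi 1 (Sp_one _)
    refine ⟨_, coset_sq hW h1 h2, fun j x hx => ?_, Sp_mul (Sp_inv hdn h2'') h1''⟩
    show w2.symm (w1 x) = b x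
    rw [Homeomorph.symm_apply_eq, h1' j x hx]
    exact (h2' j _ (hb.2 j x hx)).symm
  refine ⟨Nat.pair n i, fun a b ha hb => ?_⟩
  have hfa : ∀ i', Sp (P (Nat.pair n i')) ((fun i' => if i' = i then a else 1 : ℕ → M ≃ₜ M) i') := by
    intro i'
    by_cases h : i' = i
    · subst h; simpa using ha
    · simpa [h] using Sp_one _
  obtain ⟨wa, hwa, hwa'⟩ := claim1' (fun i' => if i' = i then a else 1) hfa
  obtain ⟨wb, hwb, hwb', hwb''⟩ := claim2' b hb
  have ha1 : ∀ j, ∀ x ∈ P (Nat.pair n i) j, wa x = a x := fun j x hx => by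
    rw [hwa' i j x hx]; simp
  have ha2 : ∀ i', i' ≠ i → ∀ j, ∀ x ∈ P (Nat.pair n i') j, wa x = x := fun i' h j x hx => by
    rw [hwa' i' j x hx]; simp [h]
  have hcf : ∀ x, (∀ j, x ∉ P (Nat.pair n i) j) → (a * b * a⁻¹ * b⁻¹) x = x := fun x hx => by
    have ha' := Sp_inv (hd _) ha
    have hb' := Sp_inv (hd _) hb
    exact (Sp_mul (Sp_mul (Sp_mul ha hb) ha') hb').1 x hx
  have hother : ∀ i', i' ≠ i → ∀ j, ∀ x ∈ P (Nat.pair n i') j, ∀ j', x ∉ P (Nat.pair n i) j' := by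
    intro i' h j x hx j' hx'
    exact h (Nat.pair_eq_pair.1 (hP _ _ _ _ x hx hx').1).2
  have key : wa * wb = (a * b * a⁻¹ * b⁻¹) * (wb * wa) := by
    ext y
    show wa (wb y) = (a * b * a⁻¹ * b⁻¹) (wb (wa y))
    by_cases hy : ∃ i' j, y ∈ P (Nat.pair n i') j
    · obtain ⟨i', j, hy⟩ := hy
      by_cases h : i' = i
      · subst h
        rw [hwb' j y hy, ha1 j _ (hb.2 j y hy), ha1 j y hy, hwb' j _ (ha.2 j y hy)]
        show a (b y) = a (b (a.symm (b.symm (b (a y)))))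
        simp
      · have h1 : wb y ∈ P (Nat.pair n i') j := hwb''.2 (i', j) y hy
        rw [ha2 i' h j _ h1, ha2 i' h j y hy, hcf _ (hother i' h j _ h1)]
    · push Not at hy
      have h1 : wb y = y := hwb''.1 y (fun p => hy p.1 p.2)
      have h2 : ∀ i' j, wa y ∉ P (Nat.pair n i') j := by
        intro i' j hj
        have hfi := Sp_inv (hd _) (hfa i')
        have h3 := hfi.2 j _ hj
        have h4 := hwa' i' j _ h3
        have h5 := wa.injective (h4.trans (Homeomorph.apply_symm_apply _ (wa y)))
        rw [h5] at h3
        exact hy i' j h3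
      rw [h1, hwb''.1 (wa y) (fun p => h2 p.1 p.2), hcf _ (h2 i)]
  have : a * b * a⁻¹ * b⁻¹ = wa * wb * (wa⁻¹ * wb⁻¹) := by
    rw [key]; group
  rw [this, show 8 = (2 + 2) + (2 + 2) from rfl, pow_add, pow_add]
  exact Set.mul_mem_mul (Set.mul_mem_mul hwa hwb)
    (Set.mul_mem_mul (inv_mem_pow hW hwa) (inv_mem_pow hW hwb))
end
end HS

namespace HS
section
variable {M : Type*} [MetricSpace M]

/-- base point of the sequence of small discs -/
noncomputable def uu : E2 := (3/8, 0)

theorem uu_norm : ‖uu‖ ≤ 3/8 := by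
  rw [e2_norm_le]
  constructor
  · show |(3/8:ℝ)| ≤ 3/8
    rw [abs_of_pos (by norm_num)]
  · show |(0:ℝ)| ≤ 3/8
    rw [abs_zero]; norm_num

/-- the `i`-th disc -/
def D (i : ℕ) : Set E2 := {z | ‖z - (1/2:ℝ)^i • uu‖ ≤ (1/2)^i/16}

theorem D_fst {i : ℕ} {z : E2} (h : z ∈ D i) :
    (1/2:ℝ)^i * (5/16) ≤ z.1 ∧ z.1 ≤ (1/2)^i * (7/16) := by
  have h : ‖z - (1/2:ℝ)^i • uu‖ ≤ (1/2)^i/16 := h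
  rw [e2_norm_le] at h
  have h1 := abs_le.1 h.1
  simp only [uu, Prod.fst_sub, Prod.smul_fst, smul_eq_mul] at h1
  constructor <;> linarith [h1.1, h1.2]

theorem D_disj_lt {i i' : ℕ} (h : i < i') {z : E2} (h1 : z ∈ D i) (h2 : z ∈ D i') : False := by
  have e1 := (D_fst h1).1
  have e2 := (D_fst h2).2
  have : (1/2:ℝ)^i' ≤ (1/2)^(i+1) := pow_le_pow_of_le_one (by norm_num) (by norm_num) h
  rw [pow_succ] at this
  have hp : (0:ℝ) < (1/2)^i := by positivity
  linarith

theorem D_disj {i i' : ℕ} {z : E2} (h1 : z ∈ D i) (h2 : z ∈ D i') : i = i' := by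
  rcases lt_trichotomy i i' with h | h | h
  · exact (D_disj_lt h h1 h2).elim
  · exact h
  · exact (D_disj_lt h h2 h1).elim

theorem half_le (i : ℕ) : (1/2:ℝ)^i ≤ 1 := pow_le_one₀ (by norm_num) (by norm_num)

theorem half_pos' (i : ℕ) : 0 < (1/2:ℝ)^i := by positivity

theorem pu_norm (i : ℕ) : ‖(1/2:ℝ)^i • uu‖ ≤ 3/8 := by
  rw [norm_smul, Real.norm_of_nonneg (half_pos' i).le]
  have := mul_le_mul (half_le i) uu_norm (norm_nonneg _) zero_le_one
  linarith

theorem D_norm {i : ℕ} {z : E2} (h : z ∈ D i) : ‖z‖ ≤ 7/16 := by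
  have h : ‖z - (1/2:ℝ)^i • uu‖ ≤ (1/2)^i/16 := h
  have := (near_norm h).1
  linarith [pu_norm i, half_le i]

theorem D_diam {i : ℕ} {z w : E2} (h : z ∈ D i) (h' : w ∈ D i) : ‖z - w‖ ≤ (1/2)^i := by
  have h : ‖z - (1/2:ℝ)^i • uu‖ ≤ (1/2)^i/16 := h
  have h' : ‖w - (1/2:ℝ)^i • uu‖ ≤ (1/2)^i/16 := h'
  have := dist_triangle_right z w ((1/2:ℝ)^i • uu)
  rw [dist_eq_norm, dist_eq_norm, dist_eq_norm] at this
  linarith [half_pos' i]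

theorem D_half {i : ℕ} {z : E2} : (1/2:ℝ) • z ∈ D (i+1) ↔ z ∈ D i := by
  show ‖(1/2:ℝ) • z - (1/2:ℝ)^(i+1) • uu‖ ≤ (1/2)^(i+1)/16 ↔ ‖z - (1/2:ℝ)^i • uu‖ ≤ (1/2)^i/16
  have : (1/2:ℝ) • z - (1/2:ℝ)^(i+1) • uu = (1/2:ℝ) • (z - (1/2:ℝ)^i • uu) := by
    rw [smul_sub, smul_smul, pow_succ, mul_comm]
  rw [this, norm_smul, Real.norm_of_nonneg (by norm_num), pow_succ]
  constructor <;> intro h <;> linarith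

variable {ε : ℝ}

/-- pieces -/
def Dp (C : Cl M ε) (i : ℕ) (j : C.J) : Set M := C.ι j '' D i

theorem Dp_disj (C : Cl M ε) (i : ℕ) (j : C.J) (i' : ℕ) (j' : C.J) (x : M)
    (h : x ∈ Dp C i j) (h' : x ∈ Dp C i' j') : i = i' ∧ j = j' := by
  obtain ⟨z, hz, rfl⟩ := h
  obtain ⟨w, hw, e⟩ := h'
  have hj : j = j' := by
    by_contra hne
    exact C.disj j j' hne z w (by linarith [D_norm hz]) (by linarith [D_norm hw]) e.symm
  subst hj
  have := (C.emb j).injective e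
  subst this
  exact ⟨D_disj hz hw, rfl⟩

theorem Dp_pc (C : Cl M ε) {i : ℕ} {j : C.J} {x : M} (h : x ∈ Dp C i j) : x ∈ pc C 1 j := by
  obtain ⟨z, hz, rfl⟩ := h
  exact ⟨z, show ‖z‖ ≤ 1 by linarith [D_norm hz], rfl⟩

theorem glueD (C : Cl M ε) (f : ℕ → M ≃ₜ M) (hf : ∀ i, Sp (Dp C i) (f i)) : ∃ F : M ≃ₜ M,
      (∀ i j, ∀ x ∈ Dp C i j, F x = f i x) ∧ (∀ x, (∀ i j, x ∉ Dp C i j) → F x = x) := by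
  have := C.fin
  obtain ⟨F, h1, h2⟩ := glue f (fun i => ⋃ j, Dp C i j) (by
    intro i i' h
    refine disjoint_left.2 fun x hx hx' => ?_
    obtain ⟨j, hj⟩ := mem_iUnion.1 hx
    obtain ⟨j', hj'⟩ := mem_iUnion.1 hx'
    exact h (Dp_disj C _ _ _ _ x hj hj').1) (by
    intro i x hx
    exact (hf i).1 x (fun j hj => hx (mem_iUnion.2 ⟨j, hj⟩))) (by
    intro s hs
    choose δ hδ H using fun j => img_unif (C.emb j).continuous hs
    obtain ⟨d, hd, hdj⟩ := fin_min δ hδ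
    obtain ⟨N, hN⟩ := exists_pow_lt_of_lt_one hd (show (1/2:ℝ) < 1 by norm_num)
    refine (finite_lt_nat N).subset ?_
    rintro i ⟨x, hx⟩
    show i < N
    by_contra hi
    push Not at hi
    by_cases h : ∀ j, x ∉ Dp C i j
    · rw [(hf i).1 x h, dist_self] at hx
      linarith
    · push Not at h
      obtain ⟨j, hj⟩ := h
      have hfx := (hf i).2 j x hj
      obtain ⟨z, hz, e⟩ := hj
      obtain ⟨w, hw, e'⟩ := hfx
      have h3 := D_diam hw hz
      have h4 : (1/2:ℝ)^i ≤ (1/2)^N := pow_le_pow_of_le_one (by norm_num) (by norm_num) hi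
      have h5 := H j w z (by linarith [D_norm hw]) (by linarith [D_norm hz]) (by linarith [hdj j])
      rw [e', e] at h5
      linarith)
  refine ⟨F, fun i j x hx => h1 i x (mem_iUnion.2 ⟨j, hx⟩), fun x hx => h2 x fun i hi => ?_⟩
  obtain ⟨j, hj⟩ := mem_iUnion.1 hi
  exact hx i j hj

theorem as_comm (C : Cl M ε) (f : M ≃ₜ M) (hf : Sp (Dp C 0) f) :
    ∃ a Φ : M ≃ₜ M, Sp (pc C 1) a ∧ Sp (pc C 1) Φ ∧ f = a * Φ * a⁻¹ * Φ⁻¹ := by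
  obtain ⟨φ, hφ, hφ'⟩ := exists_scale (V := E2) (c := 1/2) (x := 1/2) (R := 1) (by norm_num)
    (by norm_num) (by norm_num) (by norm_num)
  obtain ⟨Φ, hΦ, hΦ'⟩ := ext_class C (r := 1) (by norm_num) (fun _ => φ) (fun _ z hz => hφ' z hz)
  have hs : ∀ j z, ‖z‖ ≤ 1/2 → Φ (C.ι j z) = C.ι j ((1/2:ℝ) • z) := by
    intro j z hz
    rw [hΦ' j z (by linarith), hφ z hz]
  have m1 : ∀ i j, ∀ x ∈ Dp C i j, Φ x ∈ Dp C (i+1) j := by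
    rintro i j _ ⟨z, hz, rfl⟩
    rw [hs j z (by linarith [D_norm hz])]
    exact ⟨_, D_half.2 hz, rfl⟩
  have m2 : ∀ i j, ∀ x ∈ Dp C (i+1) j, Φ⁻¹ x ∈ Dp C i j := by
    rintro i j _ ⟨w, hw, rfl⟩
    have e : w = (1/2:ℝ) • ((2:ℝ) • w) := by rw [smul_smul]; norm_num
    rw [e, D_half] at hw
    refine ⟨_, hw, ?_⟩
    show _ = Φ.symm (C.ι j w)
    rw [Homeomorph.eq_symm_apply, hs j _ (by linarith [D_norm hw]), ← e]
  let F : ℕ → M ≃ₜ M := fun i => Nat.rec f (fun _ g => Φ * g * Φ⁻¹) i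
  have F0 : F 0 = f := rfl
  have Fs : ∀ i, F (i+1) = Φ * F i * Φ⁻¹ := fun i => rfl
  have hF : ∀ i, Sp (Dp C i) (F i) := by
    intro i
    induction i with
    | zero => exact hf
    | succ i ih =>
      rw [Fs]
      exact Sp_conj ih (m1 i) (m2 i)
  obtain ⟨a, ha, ha'⟩ := glueD C F hF
  have key : a * Φ = f * (Φ * a) := by
    ext y
    show a (Φ y) = f (Φ (a y))
    by_cases hy : ∃ i j, y ∈ Dp C i j
    · obtain ⟨i, j, hy⟩ := hy
      rw [ha i j y hy, ha (i+1) j _ (m1 i j y hy), Fs, hf.1]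
      · show Φ (F i (Φ.symm (Φ y))) = _
        rw [Homeomorph.symm_apply_apply]
      · intro j' hj'
        have := (Dp_disj C _ _ _ _ _ hj' (m1 i j _ ((hF i).2 j y hy))).1
        omega
    · push Not at hy
      rw [ha' y hy]
      by_cases h0 : ∃ j, Φ y ∈ Dp C 0 j
      · obtain ⟨j, hj⟩ := h0
        rw [ha 0 j _ hj, F0]
      · push Not at h0
        rw [hf.1 _ h0]
        apply ha'
        intro i j hj
        cases i with
        | zero => exact h0 j hj
        | succ i =>
          have := m2 i j _ hj
          rw [show Φ⁻¹ (Φ y) = y from Φ.symm_apply_apply y] at this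
          exact hy i j this
  refine ⟨a, Φ, ⟨fun x hx => ha' x fun i j hij => hx j (Dp_pc C hij), fun j x hx => ?_⟩, hΦ, ?_⟩
  · by_cases hy : ∃ i j, x ∈ Dp C i j
    · obtain ⟨i, j', hj'⟩ := hy
      have hjj : j = j' := by
        by_contra hne
        exact disjoint_left.1 (pc_disj C (by norm_num : (1:ℝ) ≤ 3) j j' hne) hx (Dp_pc C hj')
      subst hjj
      rw [ha i j x hj']
      exact Dp_pc C ((hF i).2 j x hj')
    · push Not at hy
      rw [ha' x hy]; exact hx
  · rw [key]; group

theorem im_ball (v : E2) {s r : ℝ} (hs : 0 < s) (u : E2) :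
    (fun z => v + s • z) '' {z : E2 | ‖z - u‖ ≤ r} = {z | ‖z - (v + s • u)‖ ≤ s * r} := by
  ext y
  constructor
  · rintro ⟨z, hz, rfl⟩
    have hz : ‖z - u‖ ≤ r := hz
    show ‖v + s • z - (v + s • u)‖ ≤ s * r
    rw [add_sub_add_left_eq_sub, ← smul_sub, norm_smul, Real.norm_of_nonneg hs.le]
    exact mul_le_mul_of_nonneg_left hz hs.le
  · intro hy
    have hy : ‖y - (v + s • u)‖ ≤ s * r := hy
    have e : v + s • (s⁻¹ • (y - v)) = y := by rw [smul_smul, mul_inv_cancel₀ hs.ne']; simp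
    refine ⟨s⁻¹ • (y - v), ?_, e⟩
    show ‖s⁻¹ • (y - v) - u‖ ≤ r
    rw [← e, add_sub_add_left_eq_sub, ← smul_sub, norm_smul, Real.norm_of_nonneg hs.le] at hy
    exact le_of_mul_le_mul_left hy hs

theorem small_in {W : Set (M ≃ₜ M)} (hW : W⁻¹ = W) (c : ℕ → M ≃ₜ M)
    (hc : (⋃ n, c n • W) = Set.univ) (C : Cl M ε) :
    ∃ (v : E2) (ρ : ℝ), 0 < ρ ∧ ρ ≤ 1 ∧ ‖v‖ ≤ 2/5 ∧
      ∀ f, Sp (fun j => C.ι j '' {z | ‖z - v‖ ≤ ρ}) f → f ∈ W ^ 8 := by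
  obtain ⟨q, hq⟩ := comm_main hW c hc (Dp C) (Dp_disj C) (glueD C)
  set v0 := (1/2:ℝ)^q • uu with hv0
  set ρ0 := (1/2:ℝ)^q/16 with hρ0
  have hp : 0 < ρ0 := by have := half_pos' q; positivity
  have hp1 : ρ0 ≤ 1/16 := by have := half_le q; linarith
  have hv : ‖v0‖ ≤ 3/8 := pu_norm q
  let C' : Cl M ε :=
    { J := C.J, fin := C.fin, ι := fun j => C.ι j ∘ aff v0 ρ0 hp
      emb := fun j => (C.emb j).comp (aff v0 ρ0 hp).isOpenEmbedding
      disj := by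
        have hb : ∀ z : E2, ‖z‖ ≤ 3 → ‖aff v0 ρ0 hp z‖ ≤ 3 := by
          intro z hz
          rw [aff_apply]
          have h1 := norm_add_le v0 (ρ0 • z)
          rw [norm_smul ρ0, Real.norm_of_nonneg hp.le] at h1
          nlinarith
        exact fun i j hij z w hz hw => C.disj i j hij _ _ (hb z hz) (hb w hw)
      small := by
        have hb : ∀ z : E2, ‖z‖ ≤ 3 → ‖aff v0 ρ0 hp z‖ ≤ 3 := by
          intro z hz
          rw [aff_apply]
          have h1 := norm_add_le v0 (ρ0 • z)
          rw [norm_smul ρ0, Real.norm_of_nonneg hp.le] at h1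
          nlinarith
        exact fun j z w hz hw => C.small j _ _ (hb z hz) (hb w hw) }
  have e1 : pc C' 1 = Dp C q := by
    funext j
    show (C.ι j ∘ (fun z => v0 + ρ0 • z)) '' {z | ‖z‖ ≤ 1} = C.ι j '' D q
    rw [image_comp]
    congr 1
    have := im_ball v0 (r := 1) hp 0
    simp only [sub_zero, smul_zero, add_zero, mul_one] at this
    rw [this]
    rfl
  have e2 : Dp C' 0 = fun j => C.ι j '' {z | ‖z - (v0 + ρ0 • uu)‖ ≤ ρ0 / 16} := by
    funext j
    show (C.ι j ∘ (fun z => v0 + ρ0 • z)) '' D 0 = _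
    rw [image_comp]
    congr 1
    have := im_ball v0 (r := 1/16) hp uu
    rw [show ρ0 / 16 = ρ0 * (1/16) by ring, ← this]
    simp [D]
  refine ⟨v0 + ρ0 • uu, ρ0 / 16, by positivity, by linarith, ?_, fun f hf => ?_⟩
  · have h1 := norm_add_le v0 (ρ0 • uu)
    rw [norm_smul ρ0, Real.norm_of_nonneg hp.le] at h1
    nlinarith [uu_norm, norm_nonneg uu]
  · have hf' : Sp (Dp C' 0) f := by rw [e2]; exact hf
    obtain ⟨a, Φ, ha, hΦ, rfl⟩ := as_comm C' f hf'
    have ha' : Sp (Dp C q) a := by rw [← e1]; exact ha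
    have hΦ' : Sp (Dp C q) Φ := by rw [← e1]; exact hΦ
    exact hq a Φ ha' hΦ'
end
end HS

namespace HS
section
variable {M : Type*} [MetricSpace M] [CompactSpace M]

/-- pairs of mutually inverse continuous maps -/
def TT (M : Type*) [MetricSpace M] : Set (C(M, M) × C(M, M)) :=
  {p | p.1.comp p.2 = ContinuousMap.id M ∧ p.2.comp p.1 = ContinuousMap.id M}

theorem TT_closed : IsClosed (TT M) := by
  have h1 : Continuous fun p : C(M, M) × C(M, M) => p.1.comp p.2 :=
    continuous_fst.compCM continuous_snd
  have h2 : Continuous fun p : C(M, M) × C(M, M) => p.2.comp p.1 :=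
    continuous_snd.compCM continuous_fst
  exact (isClosed_eq h1 continuous_const).inter (isClosed_eq h2 continuous_const)

def toTT (g : M ≃ₜ M) : TT M := ⟨((g : C(M, M)), (g.symm : C(M, M))), by
  constructor <;> ext x <;> simp⟩

theorem TT_surj (p : TT M) : ∃ g : M ≃ₜ M, toTT g = p := by
  obtain ⟨⟨f, g⟩, h1, h2⟩ := p
  refine ⟨mkHomeo f g (fun x => ?_) (fun x => ?_) f.continuous g.continuous, ?_⟩
  · exact DFunLike.congr_fun h2 x
  · exact DFunLike.congr_fun h1 x
  · rfl

theorem TT_dist {g h : M ≃ₜ M} {r : ℝ} (hr : 0 < r) : dist (toTT g) (toTT h) < r ↔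
    (∀ x, dist (g x) (h x) < r) ∧ ∀ x, dist (g.symm x) (h.symm x) < r := by
  rw [Subtype.dist_eq, Prod.dist_eq, max_lt_iff, ContinuousMap.dist_lt_iff hr,
    ContinuousMap.dist_lt_iff hr]
  rfl

theorem dense_near {W : Set (M ≃ₜ M)} (hW : W⁻¹ = W) (c : ℕ → M ≃ₜ M)
    (hc : (⋃ n, c n • W) = Set.univ) : ∃ ε0 > 0, ∀ k : M ≃ₜ M, (∀ x, dist (k x) x < ε0) →
      ∀ τ > 0, ∃ w ∈ W ^ 2, ∀ x, dist (w x) (k x) < τ := by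
  have : CompleteSpace (TT M) := TT_closed.completeSpace_coe
  have : Nonempty (TT M) := ⟨toTT 1⟩
  obtain ⟨n, p, hp⟩ := nonempty_interior_of_iUnion_of_closed
    (f := fun n => closure (toTT '' (c n • W))) (fun n => isClosed_closure) (by
      refine eq_univ_of_forall fun p => ?_
      obtain ⟨g, rfl⟩ := TT_surj p
      have : g ∈ ⋃ n, c n • W := by rw [hc]; trivial
      obtain ⟨n, hn⟩ := mem_iUnion.1 this
      exact mem_iUnion.2 ⟨n, subset_closure ⟨g, hn, rfl⟩⟩)
  obtain ⟨r, hr, hb⟩ := Metric.isOpen_iff.1 isOpen_interior p hp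
  obtain ⟨h0, rfl⟩ := TT_surj p
  have near : ∀ h : M ≃ₜ M, dist (toTT h) (toTT h0) < r → ∀ τ > 0, ∃ w ∈ c n • W,
      (∀ x, dist (h x) (w x) < τ) ∧ ∀ x, dist (h.symm x) (w.symm x) < τ := by
    intro h hh τ hτ
    obtain ⟨_, ⟨w, hw, rfl⟩, hd⟩ := Metric.mem_closure_iff.1 (interior_subset (hb hh)) τ hτ
    exact ⟨w, hw, (TT_dist hτ).1 hd⟩
  obtain ⟨d1, hd1, H1⟩ := Metric.uniformContinuous_iff.1
    (CompactSpace.uniformContinuous_of_continuous h0.continuous) r hr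
  refine ⟨min d1 r, lt_min hd1 hr, fun k hk τ hτ => ?_⟩
  obtain ⟨d2, hd2, H2⟩ := Metric.uniformContinuous_iff.1
    (CompactSpace.uniformContinuous_of_continuous h0.symm.continuous) (τ/2) (by linarith)
  obtain ⟨w1, hw1, hw1', -⟩ := near (h0 * k) (by
    rw [TT_dist hr]
    refine ⟨fun x => H1 (lt_of_lt_of_le (hk x) (min_le_left _ _)), fun x => ?_⟩
    have := hk (k.symm (h0.symm x))
    rw [Homeomorph.apply_symm_apply, dist_comm] at this
    exact lt_of_lt_of_le this (min_le_right _ _)) d2 hd2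
  obtain ⟨w2, hw2, -, hw2'⟩ := near h0 (by rw [dist_self]; exact hr) (τ/2) (by linarith)
  refine ⟨_, coset_sq hW hw1 hw2, fun x => ?_⟩
  show dist (w2.symm (w1 x)) (k x) < τ
  have e1 := hw2' (w1 x)
  have e2 := H2 (hw1' x)
  rw [show h0.symm ((h0 * k) x) = k x from h0.symm_apply_apply (k x)] at e2
  have := dist_triangle_left (w2.symm (w1 x)) (k x) (h0.symm (w1 x))
  rw [dist_comm (h0.symm (w1 x)) (k x)] at this
  linarith

theorem frag_in {W : Set (M ≃ₜ M)} (hW : W⁻¹ = W) (c : ℕ → M ≃ₜ M)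
    (hc : (⋃ n, c n • W) = Set.univ) {ε : ℝ} (hε : 0 < ε)
    (hd : ∀ k : M ≃ₜ M, (∀ x, dist (k x) x < ε) →
      ∀ τ > 0, ∃ w ∈ W ^ 2, ∀ x, dist (w x) (k x) < τ)
    (C : Cl M ε) (f : M ≃ₜ M) (hf : Sp (pc C 2) f) : f ∈ W ^ 12 := by
  have := C.fin
  obtain ⟨v, ρ, hρ, hρ1, hv, hin⟩ := small_in hW c hc C
  obtain ⟨φ, hφ, hφ'⟩ := exists_scale (V := E2) (c := ρ/5) (x := 12/5) (R := 13/5) (by linarith)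
    (by norm_num) (by norm_num) (by linarith)
  let h : E2 ≃ₜ E2 := (Homeomorph.subRight v).trans (φ.trans (Homeomorph.addLeft v))
  have hh : ∀ z, h z = v + φ (z - v) := fun z => rfl
  obtain ⟨H, hH, hH'⟩ := ext_class C (r := 3) le_rfl (fun _ => h) (fun _ z hz => by
    rw [hh, hφ' _ _, add_sub_cancel]
    have := norm_sub_norm_le z v
    linarith)
  choose δ hδ hl using fun j => loc_unif (C.emb j) (show 0 < ρ/2 by linarith)
  obtain ⟨τ, hτ, hτj⟩ := fin_min δ hδ
  obtain ⟨w, hw, hwH⟩ := hd H (fun x => by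
    by_cases hx : ∀ j, x ∉ pc C 3 j
    · rw [hH.1 x hx, dist_self]; exact hε
    · push Not at hx
      obtain ⟨j, hj⟩ := hx
      obtain ⟨z', hz', e'⟩ := hH.2 j x hj
      obtain ⟨z, hz, e⟩ := hj
      rw [← e', ← e]
      exact C.small j _ _ hz' hz) τ hτ
  set S' : C.J → Set M := fun j => C.ι j '' {z | ‖z - v‖ ≤ ρ} with hS'
  have hm : ∀ j, ∀ x ∈ pc C 2 j, w x ∈ S' j := by
    rintro j _ ⟨z, hz, rfl⟩
    have hz : ‖z‖ ≤ 2 := hz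
    have h1 := norm_sub_le z v
    have h2 : ‖h z - v‖ ≤ ρ / 2 := by
      rw [hh, hφ _ (by linarith), add_sub_cancel_left, norm_smul,
        Real.norm_of_nonneg (by linarith)]
      nlinarith
    have h3 := (near_norm h2).1
    have h4 := hwH (C.ι j z)
    rw [hH' j z (by linarith)] at h4
    obtain ⟨w', e, hw'⟩ := hl j (h z) (by linarith) _ (h4.le.trans (hτj j))
    refine ⟨w', ?_, e⟩
    show ‖w' - v‖ ≤ ρ
    have := norm_sub_le_norm_sub_add_norm_sub w' (h z) v
    linarith
  have hS3 : ∀ j, S' j ⊆ pc C 3 j := by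
    rintro j _ ⟨z, hz, rfl⟩
    have hz : ‖z - v‖ ≤ ρ := hz
    exact ⟨z, show ‖z‖ ≤ 3 by linarith [(near_norm hz).1], rfl⟩
  have hSp : Sp S' (w * f * w⁻¹) := by
    have hfix : ∀ x, (∀ j, w⁻¹ x ∉ pc C 2 j) → (w * f * w⁻¹) x = x := by
      intro x hx
      show w (f (w⁻¹ x)) = x
      rw [hf.1 _ hx]
      exact w.apply_symm_apply x
    have ew : ∀ x, w (w⁻¹ x) = x := fun x => w.apply_symm_apply x
    refine ⟨fun x hx => hfix x fun j hj => hx j ?_, fun j x hx => ?_⟩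
    · have := hm j _ hj
      rwa [ew] at this
    · by_cases h2 : ∀ j, w⁻¹ x ∉ pc C 2 j
      · rw [hfix x h2]; exact hx
      · push Not at h2
        obtain ⟨j', hj'⟩ := h2
        have h3 := hm j' _ hj'
        rw [ew] at h3
        have hjj : j' = j := by
          by_contra hne
          exact disjoint_left.1 (pc_disj C le_rfl j' j hne) (hS3 _ h3) (hS3 _ hx)
        subst hjj
        exact hm j' _ (hf.2 j' _ hj')
  have h8 := hin _ hSp
  have : f = w⁻¹ * (w * f * w⁻¹) * w := by group
  rw [this, show 12 = 2 + 8 + 2 from rfl, pow_add, pow_add]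
  exact Set.mul_mem_mul (Set.mul_mem_mul (inv_mem_pow hW hw) h8) hw

theorem Pr_mem {W : Set (M ≃ₜ M)} {ε : ℝ}
    (H : ∀ (C : Cl M ε) (f : M ≃ₜ M), Sp (pc C 2) f → f ∈ W ^ 12)
    (C : ℕ → Cl M ε) (k : ℕ) : ∀ g, Pr C k g → g ∈ W ^ (12 * k) := by
  induction k with
  | zero =>
    intro g hg
    have hg : g = 1 := hg
    rw [hg, mul_zero, pow_zero]
    exact Set.mem_one.2 rfl
  | succ k ih =>
    rintro g ⟨L, F, hL, hF, rfl⟩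
    rw [mul_add, mul_one, pow_add]
    exact Set.mul_mem_mul (ih L hL) (H _ _ hF)

theorem main_metric {n : ℕ} (ι : Fin n → E2 → M) (hι : ∀ i, IsOpenEmbedding (ι i))
    (hcov : ∀ p, ∃ i z, ‖z‖ < 1 ∧ ι i z = p) (W : Set (M ≃ₜ M)) (hW : W⁻¹ = W)
    (c : ℕ → M ≃ₜ M) (hc : (⋃ n, c n • W) = Set.univ) :
    (@interior _ (TopologicalSpace.induced (fun g : M ≃ₜ M => (g : C(M, M)))
      ContinuousMap.compactOpen) (W ^ 92)).Nonempty := by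
  let _ : TopologicalSpace (M ≃ₜ M) :=
      TopologicalSpace.induced (fun g : M ≃ₜ M => (g : C(M, M))) ContinuousMap.compactOpen
  obtain ⟨ε, hε, hd⟩ := dense_near hW c hc
  obtain ⟨C, hC⟩ := cover6 hε ι hι hcov
  obtain ⟨C', δ, hδ, hP⟩ := frag6 C hC
  have h72 : ∀ g : M ≃ₜ M, (∀ x, dist (g x) x ≤ δ) → g ∈ W ^ 72 := fun g hg =>
    Pr_mem (fun C f hf => frag_in hW c hc hε hd C f hf) C' 6 g (hP g hg)
  have h1 : (1 : M ≃ₜ M) ∈ W ^ 2 := by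
    have : (1 : M ≃ₜ M) ∈ ⋃ n, c n • W := by rw [hc]; trivial
    obtain ⟨n, hn⟩ := mem_iUnion.1 this
    have := coset_sq hW hn hn
    rwa [inv_mul_cancel] at this
  have hsub : W ^ 72 ⊆ W ^ 92 := by
    rw [show 72 = 2 * 36 from rfl, show 92 = 2 * 46 from rfl, pow_mul, pow_mul]
    exact Set.pow_subset_pow_right h1 (by norm_num)
  refine ⟨1, mem_interior.2 ⟨(fun g : M ≃ₜ M => (g : C(M, M))) ⁻¹'
    Metric.ball (ContinuousMap.id M) δ, fun g hg => hsub (h72 g fun x => ?_),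
    Metric.isOpen_ball.preimage continuous_induced_dom, ?_⟩⟩
  · have hg : dist (g : C(M, M)) (ContinuousMap.id M) < δ := hg
    exact (ContinuousMap.dist_lt_iff hδ).1 hg x |>.le
  · show dist ((1 : M ≃ₜ M) : C(M, M)) (ContinuousMap.id M) < δ
    rw [ContinuousMap.dist_lt_iff hδ]
    intro x
    show dist x x < δ
    rw [dist_self]; exact hδ
end
end HS

/-- `Homeo(M)` of a compact 2-manifold with the compact-open topology is Steinhaus:
for every symmetric countably syndetic `W`, `W^92` has nonempty interior. -/
theorem homeo_surface_steinhaus (M : Type*) [TopologicalSpace M]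
    [CompactSpace M] [T2Space M] [ChartedSpace (EuclideanSpace ℝ (Fin 2)) M] :
    letI : TopologicalSpace (M ≃ₜ M) :=
      TopologicalSpace.induced (fun g : M ≃ₜ M => (g : C(M, M))) ContinuousMap.compactOpen
    ∀ W : Set (M ≃ₜ M), W⁻¹ = W →
      (∃ c : ℕ → M ≃ₜ M, (⋃ n, c n • W) = Set.univ) →
      (interior (W ^ 92)).Nonempty := by
  intro W hW hc
  obtain ⟨c, hc⟩ := hc
  obtain ⟨n, ι, hι, hcov⟩ := HS.charts M
  have : SecondCountableTopology M :=
    ChartedSpace.secondCountable_of_sigmaCompact (EuclideanSpace ℝ (Fin 2)) M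
  have hm : TopologicalSpace.MetrizableSpace M := inferInstance
  let m : MetricSpace M := TopologicalSpace.metrizableSpaceMetric M
  exact HS.main_metric ι hι hcov W hW c hc
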